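/- For every z ∈ I_ℤ, Q_z = Σ_T Q_{shape(T)}, where the sum is over the (finite) set of distinct shifted tableaux {P_EGᴼ(a) : a ∈ R_inv^+(z)} and shape(T) denotes the strict partition giving the shape of T. -/

import Mathlib

/-! ## Primed letters: the alphabet `ℤ ⊔ ℤ'`, with `i' = i - 1/2`.
A letter is encoded by its "ceiling" together with a flag recording whether it is primed. -/

structure Letter where
  ceil : ℤ
  primed : Bool
deriving DecidableEq, Repr

instance : Inhabited Letter := ⟨⟨0, false⟩⟩

/-- The order `⋯ < 1' < 1 < 2' < 2 < ⋯`. -/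
instance : LinearOrder Letter :=
  LinearOrder.lift' (fun x : Letter => toLex (x.ceil, !x.primed))
    (fun a b h => by
      have h' : (a.ceil, !a.primed) = (b.ceil, !b.primed) := toLex.injective h
      obtain ⟨ac, ap⟩ := a
      obtain ⟨bc, bp⟩ := b
      simp only [Prod.mk.injEq] at h'
      obtain ⟨h1, h2⟩ := h'
      cases ap <;> cases bp <;> simp_all)

/-- A primed word. -/
abbrev PWord := List Letter

def Letter.unprime (x : Letter) : Letter := ⟨x.ceil, false⟩

def Letter.succL (x : Letter) : Letter := ⟨x.ceil + 1, x.primed⟩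

/-- `unprime` of a primed word: replace each letter `x` by `⌈x⌉`. -/
def unprimeWord (a : PWord) : List ℤ := a.map Letter.ceil

/-- `unprime` of a primed word, as a primed word with no primes. -/
def unprimeP (a : PWord) : PWord := a.map Letter.unprime

/-! ## Involution words -/

/-- The simple transposition `s_i = (i, i+1)` of `ℤ`. -/
def sPerm (i : ℤ) : Equiv.Perm ℤ := Equiv.swap i (i + 1)

/-- The Demazure product `s_{w_1} ∘ s_{w_2} ∘ ⋯ ∘ s_{w_k}` of a word, computed by the
defining recursion `σ ∘ s_i = σ·s_i` if `σ(i) < σ(i+1)` and `σ ∘ s_i = σ` otherwise. -/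
def heckeProd (w : List ℤ) : Equiv.Perm ℤ :=
  w.foldl (fun σ i => if σ i < σ (i + 1) then σ * sPerm i else σ) 1

/-- `s_{a_n} ∘ ⋯ ∘ s_{a_2} ∘ s_{a_1} ∘ s_{a_2} ∘ ⋯ ∘ s_{a_n}` for `a = a_1 a_2 ⋯ a_n`. -/
def invHecke (a : List ℤ) : Equiv.Perm ℤ := heckeProd (a.reverse ++ a.tail)

/-- Membership in `I_ℤ`: a finitely supported involution of `ℤ`. -/
def IZ (z : Equiv.Perm ℤ) : Prop := {x : ℤ | z x ≠ x}.Finite ∧ z * z = 1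

/-- The set of involution words of `z`. -/
def Rinv (z : Equiv.Perm ℤ) : Set (List ℤ) :=
  {a | invHecke a = z ∧ ∀ b : List ℤ, invHecke b = z → a.length ≤ b.length}

/-- 0-based index `k` is a commutation in the word `a` (this corresponds to the 1-based
index `k+1`): `a_{k+1}` and `a_{k+1} + 1` are both fixed points of
`s_{a_k} ∘ ⋯ ∘ s_{a_1} ∘ ⋯ ∘ s_{a_k}`. -/
def IsCommutation (a : List ℤ) (k : ℕ) : Prop :=
  ∃ x, a[k]? = some x ∧ invHecke (a.take k) x = x ∧ invHecke (a.take k) (x + 1) = x + 1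

/-- The set of primed involution words of `z`. -/
def RinvPlus (z : Equiv.Perm ℤ) : Set PWord :=
  {a | unprimeWord a ∈ Rinv z ∧
     ∀ (k : ℕ) (x : Letter), a[k]? = some x → x.primed = true →
       IsCommutation (unprimeWord a) k}

/-! ## Shifted tableaux.
A shifted tableau is recorded as its list of rows, from the first (bottom) row upward;
the entry at 0-based index `k` of 0-based row `r` occupies the box in row `r+1` and
column `r+1+k` of the shifted diagram. -/

abbrev STab := List (List Letter)

/-- A strict partition, recorded as its (strictly decreasing) list of positive parts. -/
def IsStrictPartition (sh : List ℕ) : Prop :=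
  List.Chain' (fun a b => b < a) sh ∧ ∀ m ∈ sh, 0 < m

def shapeOf {α : Type*} (T : List (List α)) : List ℕ := T.map List.length

/-- The rows form the shifted diagram of a strict partition. -/
def IsShifted {α : Type*} (T : List (List α)) : Prop := IsStrictPartition (shapeOf T)

/-- The entry of `T` in (0-based) row `r` and column `c` of the shifted diagram. -/
def entryG? {α : Type*} (T : List (List α)) (r c : ℕ) : Option α :=
  if r ≤ c then (T[r]?).bind (fun row => row[c - r]?) else none

def entry? (T : STab) (r c : ℕ) : Option Letter := entryG? T r c

def setRowG {α : Type*} (T : List (List α)) (r : ℕ) (row : List α) : List (List α) :=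
  if r < T.length then T.set r row else T ++ [row]

def setEntryG {α : Type*} (T : List (List α)) (r c : ℕ) (x : α) : List (List α) :=
  T.set r ((T.getD r []).set (c - r) x)

def numCols {α : Type*} (T : List (List α)) : ℕ := (T.getD 0 []).length

/-- Row reading word: rows left to right, starting with the last (top) row. -/
def rowWord (T : STab) : PWord := T.reverse.flatten

/-- Column reading word: columns top to bottom, starting with the first column. -/
def colWord (T : STab) : PWord :=
  (List.range (numCols T)).flatMap (fun c =>
    ((List.range (c + 1)).reverse).filterMap (fun r => entry? T r c))

def unprimeT (T : STab) : STab := T.map (List.map Letter.unprime)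

/-- Remove the primes from all main-diagonal entries. -/
def unprimeDiagT (T : STab) : STab :=
  T.map (fun row =>
    match row with
    | [] => []
    | x :: rest => Letter.unprime x :: rest)

/-- Rows and columns are strictly increasing. -/
def IsIncreasing (T : STab) : Prop :=
  (∀ r c x y, entry? T r c = some x → entry? T r (c + 1) = some y → x < y) ∧
  (∀ r c x y, entry? T r c = some x → entry? T (r + 1) c = some y → x < y)

/-- No primed entries on the main diagonal. -/
def NoDiagPrimes (T : STab) : Prop :=
  ∀ r x, entry? T r r = some x → x.primed = false

/-- Entries positive, rows and columns weakly increasing, no primed entry repeated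
in a row and no unprimed entry repeated in a column. -/
def IsSemistandard (T : STab) : Prop :=
  (∀ x ∈ T.flatten, 0 < x.ceil) ∧
  (∀ r c x y, entry? T r c = some x → entry? T r (c + 1) = some y → x ≤ y) ∧
  (∀ r c x y, entry? T r c = some x → entry? T (r + 1) c = some y → x ≤ y) ∧
  (∀ r c c' x, c < c' → entry? T r c = some x → entry? T r c' = some x →
    x.primed = false) ∧
  (∀ r r' c x, r < r' → entry? T r c = some x → entry? T r' c = some x →
    x.primed = true)

/-- Increasing, with exactly one of `i` or `i'` as an entry for each `i = 1, …, n`,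
where `n` is the number of boxes. -/
def IsStandard (T : STab) : Prop :=
  IsIncreasing T ∧
  ∀ i : ℤ, 1 ≤ i → i ≤ (T.flatten.length : ℤ) →
    T.flatten.countP (fun x => decide (x.ceil = i)) = 1
/-! ## Orthogonal Edelman–Greene insertion -/

/-- "Switching the primes" of a pair: reverse the primes on both letters if exactly one
of them is unprimed, and leave them unchanged otherwise. -/
def switchPrimes (x y : Letter) : Letter × Letter :=
  if x.primed = y.primed then (x, y)
  else (⟨x.ceil, !x.primed⟩, ⟨y.ceil, !y.primed⟩)

/-- Column-insertion stage of orthogonal Edelman–Greene insertion: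
insert letter `w` into column `c` of `T` (then continue into later columns). -/
def egCol : ℕ → STab → ℕ → Letter → STab × Bool
  | 0, T, _, _ => (T, true)
  | fuel + 1, T, c, w =>
    let occ := (List.range (c + 1)).filterMap (fun r => (entry? T r c).map (fun x => (r, x)))
    match occ.findIdx? (fun p => decide (w.ceil < p.2.ceil)) with
    | none =>
        -- place `w` in the first empty box of the column
        let r := occ.length
        let w' := if r = c ∧ w.primed then Letter.unprime w else w
        (setRowG T r ((T.getD r []) ++ [w']), if r = c then w.primed else true)
    | some kM =>
        let km := (occ.findIdx? (fun p => decide (w.ceil ≤ p.2.ceil))).getD kM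
        let im := (occ.getD km (0, default)).1
        let m := (occ.getD km (0, default)).2
        if km = kM then
          if im = c then
            -- m = M on the main diagonal
            egCol fuel (setEntryG T im c (Letter.unprime w)) (c + 1) ⟨m.ceil, w.primed⟩
          else
            -- m = M off the main diagonal
            egCol fuel (setEntryG T im c w) (c + 1) m
        else
          -- m < M : switch the primes on m and M, insert w+1 into the next column
          let iM := (occ.getD kM (0, default)).1
          let M := (occ.getD kM (0, default)).2
          let p := switchPrimes m M
          egCol fuel (setEntryG (setEntryG T im c p.1) iM c p.2) (c + 1) (Letter.succL w)

/-- Row-insertion stage of orthogonal Edelman–Greene insertion: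
insert letter `w` into row `r` of `T`. -/
def egRow : ℕ → STab → ℕ → Letter → STab × Bool
  | 0, T, _, _ => (T, true)
  | fuel + 1, T, r, w =>
    let row := T.getD r []
    match row.findIdx? (fun x => decide (w.ceil < x.ceil)) with
    | none =>
        if row.isEmpty ∧ w.primed then (setRowG T r [Letter.unprime w], true)
        else (setRowG T r (row ++ [w]), false)
    | some kM =>
        let km := (row.findIdx? (fun x => decide (w.ceil ≤ x.ceil))).getD kM
        let m := row.getD km default
        if km = kM then
          if km = 0 then
            -- m = M on the main diagonal
            egCol fuel (setRowG T r (row.set 0 (Letter.unprime w))) (r + 1)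
              ⟨m.ceil, w.primed⟩
          else
            -- m = M off the main diagonal
            egRow fuel (setRowG T r (row.set km w)) (r + 1) m
        else
          -- m < M : switch primes; insert w+1 into the next column (if m is on the
          -- main diagonal) or the next row (otherwise)
          let M := row.getD kM default
          let p := switchPrimes m M
          let row' := (row.set km p.1).set kM p.2
          if km = 0 then egCol fuel (setRowG T r row') (r + 1) (Letter.succL w)
          else egRow fuel (setRowG T r row') (r + 1) (Letter.succL w)

/-- `T ←ᴼ u` together with the flag recording whether the insertion ended in
column insertion. -/
def egInsert (T : STab) (u : Letter) : STab × Bool :=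
  egRow (T.flatten.length + T.length + 2) T 0 u

/-- The orthogonal Edelman–Greene insertion tableau `P_EGᴼ(a)`. -/
def PEG (a : PWord) : STab := a.foldl (fun T u => (egInsert T u).1) []

/-- Add the recording letter `x` to `Q` in the unique box of `Pnew` not in `Pold`. -/
def addBox (Q Pold Pnew : STab) (x : Letter) : STab :=
  match (List.range Pnew.length).find?
      (fun r => decide ((Pold.getD r []).length ≠ (Pnew.getD r []).length)) with
  | some r => setRowG Q r ((Q.getD r []) ++ [x])
  | none => Q

def QEGaux : STab → STab → ℕ → PWord → STab
  | _, Q, _, [] => Q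
  | P, Q, n, u :: rest =>
      let res := egInsert P u
      QEGaux res.1 (addBox Q P res.1 ⟨(n : ℤ), res.2⟩) (n + 1) rest

/-- The orthogonal Edelman–Greene recording tableau `Q_EGᴼ(a)`. -/
def QEG (a : PWord) : STab := QEGaux [] [] 1 a

/-! ## Orthogonal Coxeter–Knuth operators -/

def ock1 (x : Letter) : Letter := ⟨x.ceil, !x.primed⟩

def ock2 (x y : Letter) : Letter × Letter := (⟨y.ceil, x.primed⟩, ⟨x.ceil, y.primed⟩)

def ock3 (x y z : Letter) : Letter × Letter × Letter :=
  if x.ceil = z.ceil ∧ (x.ceil - y.ceil = 1 ∨ y.ceil - x.ceil = 1) then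
    if x.primed = false ∧ y.primed = false ∧ z.primed = false then
      -- XYX ↔ YXY
      (⟨y.ceil, false⟩, ⟨x.ceil, false⟩, ⟨y.ceil, false⟩)
    else if x.primed = true ∧ y.primed = false ∧ z.primed = false then
      -- X'YX ↦ YXY'
      (⟨y.ceil, false⟩, ⟨x.ceil, false⟩, ⟨y.ceil, true⟩)
    else if x.primed = false ∧ y.primed = false ∧ z.primed = true then
      -- YXY' ↦ X'YX
      (⟨y.ceil, true⟩, ⟨x.ceil, false⟩, ⟨y.ceil, false⟩)
    else (x, y, z)
  else if (x.ceil < z.ceil ∧ z.ceil < y.ceil) ∨ (y.ceil < z.ceil ∧ z.ceil < x.ceil) then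
    -- ACB ↔ CAB
    (y, x, z)
  else if (y.ceil < x.ceil ∧ x.ceil < z.ceil) ∨ (z.ceil < x.ceil ∧ x.ceil < y.ceil) then
    -- BCA ↔ BAC
    (x, z, y)
  else (x, y, z)

/-- The operator `ock_i` for `i ∈ ℤ`. -/
def ockW (i : ℤ) (a : PWord) : PWord :=
  if i = -1 then
    match a with
    | [] => []
    | x :: rest => ock1 x :: rest
  else if i = 0 then
    match a with
    | x :: y :: rest => (ock2 x y).1 :: (ock2 x y).2 :: rest
    | _ => a
  else if 1 ≤ i ∧ i + 2 ≤ (a.length : ℤ) then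
    let k := (i - 1).toNat
    match a[k]?, a[k + 1]?, a[k + 2]? with
    | some x, some y, some z =>
        a.take k ++ [(ock3 x y z).1, (ock3 x y z).2.1, (ock3 x y z).2.2] ++ a.drop (k + 3)
    | _, _, _ => a
  else a

/-- Orthogonal Coxeter–Knuth equivalence: generated by `a ∼ ock_i(a)` for all `i ∈ ℤ`. -/
def OckEquiv : PWord → PWord → Prop :=
  Relation.EqvGen (fun a b => ∃ i : ℤ, b = ockW i a)
/-! ## Descents -/

/-- Descent set of a primed word (as a set of 1-based positions). -/
def DesWord (a : PWord) : Set ℤ :=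
  {i | ∃ k : ℕ, i = (k : ℤ) + 1 ∧ ∃ x y, a[k]? = some x ∧ a[k + 1]? = some y ∧ y < x}

/-- Descent set of a standard shifted tableau. -/
def DesT (T : STab) : Set ℤ :=
  {i | 0 < i ∧ (
    (∃ r c r' c', entry? T r c = some ⟨i, false⟩ ∧
        entry? T r' c' = some ⟨i + 1, false⟩ ∧ r < r') ∨
    (∃ r c r' c', entry? T r c = some ⟨i, true⟩ ∧
        entry? T r' c' = some ⟨i + 1, true⟩ ∧ c < c') ∨
    (∃ r c r' c', entry? T r c = some ⟨i, false⟩ ∧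
        entry? T r' c' = some ⟨i + 1, true⟩))}

/-! ## Dual equivalence operators on standard shifted tableaux -/

def numPrimes (T : STab) : ℕ := T.flatten.countP (fun x => x.primed)

/-- The entries of column `c`, read from bottom to top (increasing). -/
def colLetters (T : STab) (c : ℕ) : PWord :=
  (List.range (c + 1)).filterMap (fun r => entry? T r c)

/-- The shifted reading word `unprime(C_q R_q ⋯ C_1 R_1)`. -/
def shword (T : STab) : List ℤ :=
  (((List.range (numCols T)).reverse).flatMap (fun idx =>
    (colLetters T idx).filter (fun x => x.primed) ++
      ((T.getD idx []).filter (fun x => !x.primed)))).map Letter.ceil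

def idxOfZ (v : ℤ) : List ℤ → ℕ
  | [] => 0
  | x :: r => if x = v then 0 else idxOfZ v r + 1

def positionsOf (T : STab) : List (ℕ × ℕ) :=
  (List.range T.length).flatMap (fun r =>
    (List.range (T.getD r []).length).map (fun k => (r, r + k)))

/-- The box `□_v` of `T` containing `v` or `v'`. -/
def boxOf (T : STab) (v : ℤ) : Option (ℕ × ℕ) :=
  (positionsOf T).find? (fun p =>
    match entry? T p.1 p.2 with
    | some x => decide (x.ceil = v)
    | none => false)

/-- Reverse the prime of the entry in position `(r, c)`. -/
def togglePos (T : STab) (r c : ℕ) : STab :=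
  match entry? T r c with
  | some x => setEntryG T r c ⟨x.ceil, !x.primed⟩
  | none => T

/-- Switch the primes of the entries in the two given positions. -/
def switchAt (T : STab) (p q : ℕ × ℕ) : STab :=
  match entry? T p.1 p.2, entry? T q.1 q.2 with
  | some x, some y =>
      if x.primed = y.primed then T else togglePos (togglePos T p.1 p.2) q.1 q.2
  | _, _ => T

/-- The row index of `□_v` if it is a main-diagonal box. -/
def diagBox? (T : STab) (v : ℤ) : Option ℕ :=
  (boxOf T v).bind (fun p => if p.1 = p.2 then some p.1 else none)

def switchDiag (T T' : STab) (u v : ℤ) : STab :=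
  match diagBox? T u, diagBox? T v with
  | some r, some s => switchAt T' (r, r) (s, s)
  | _, _ => T'

/-- The operator `𝔰_i`. -/
def sOp (i : ℤ) (T : STab) : STab :=
  match boxOf T i, boxOf T (i + 1) with
  | some (r1, c1), some (r2, c2) =>
      if r1 ≠ r2 ∧ c1 ≠ c2 then
        -- swap i ↔ i+1 and i' ↔ (i+1)'
        setEntryG (setEntryG T r1 c1 ⟨i + 1, ((entry? T r1 c1).getD default).primed⟩)
          r2 c2 ⟨i, ((entry? T r2 c2).getD default).primed⟩
      else if r1 ≠ c1 ∧ r2 ≠ c2 then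
        -- same row or column, neither box diagonal: reverse both primes
        togglePos (togglePos T r1 c1) r2 c2
      else
        -- same row or column, one box diagonal
        let T1 := if r1 = c1 then togglePos T r2 c2 else togglePos T r1 c1
        let T2 :=
          if 1 ≤ i - 1 ∧ (diagBox? T (i - 1)).isSome ∧ (diagBox? T (i + 1)).isSome then
            switchDiag T T1 (i - 1) (i + 1)
          else T1
        if i + 2 ≤ (T.flatten.length : ℤ) ∧ (diagBox? T i).isSome ∧
            (diagBox? T (i + 2)).isSome then
          switchDiag T T2 i (i + 2)
        else T2
  | _, _ => T

def btwn (a m b : ℕ) : Prop := (a < m ∧ m < b) ∨ (b < m ∧ m < a)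

instance (a m b : ℕ) : Decidable (btwn a m b) := by unfold btwn; infer_instance

/-- The dual equivalence operator `𝔡_i` for `i ∈ ℤ`. -/
def dOp (i : ℤ) (T : STab) : STab :=
  if ¬(1 ≤ i + 2 ∧ i + 2 ≤ (T.flatten.length : ℤ)) then T
  else if i = -1 then togglePos T 0 0
  else if i = 0 then togglePos T 0 1
  else
    let w := shword T
    if btwn (idxOfZ i w) (idxOfZ (i + 2) w) (idxOfZ (i + 1) w) then sOp i T
    else if btwn (idxOfZ (i + 1) w) (idxOfZ i w) (idxOfZ (i + 2) w) then sOp (i + 1) T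
    else T

/-! ## Marked cycles -/

/-- The 2-cycles of `z`, as ordered pairs `(i, j)` with `i < j = z(i)`. -/
def cycSet (z : Equiv.Perm ℤ) : Set (ℤ × ℤ) := {p | p.1 < p.2 ∧ z p.1 = p.2}

/-- `s_{a_n} ⋯ s_{a_{k+2}} s_{a_{k+1}}` (ordinary product; 0-based index `k`). -/
def suffixPerm (a : List ℤ) (k : ℕ) : Equiv.Perm ℤ :=
  ((a.drop (k + 1)).reverse.map sPerm).prod

/-- `γ_{k+1}(a)` as an ordered pair (junk value `(0,0)` off the commutation set). -/
def gammaPair (a : List ℤ) (k : ℕ) : ℤ × ℤ :=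
  match a[k]? with
  | some x => (min (suffixPerm a k x) (suffixPerm a k (x + 1)),
               max (suffixPerm a k x) (suffixPerm a k (x + 1)))
  | none => (0, 0)
/-! ## Increasing factorization sequences and Schur Q-functions -/

/-- `Incr_∞(R_inv^+(z))`: sequences of weakly increasing primed words, all but
finitely many empty, whose concatenation is a primed involution word for `z`. -/
def IncrSeq (z : Equiv.Perm ℤ) : Set (ℕ → PWord) :=
  {φ | (∀ n, List.Chain' (· ≤ ·) (φ n)) ∧
    ∃ N, (∀ n, N ≤ n → φ n = []) ∧ ((List.range N).map φ).flatten ∈ RinvPlus z}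

/-- Least bound past which a sequence of words is empty. -/
noncomputable def seqBound (φ : ℕ → PWord) : ℕ := sInf {N | ∀ n, N ≤ n → φ n = []}

/-- The concatenation `a^1 a^2 ⋯` of a sequence of words. -/
noncomputable def concatSeq (φ : ℕ → PWord) : PWord :=
  ((List.range (seqBound φ)).map φ).flatten

/-- `ℓ(a^1) + ⋯ + ℓ(a^i)`. -/
def prefLen (φ : ℕ → PWord) (i : ℕ) : ℕ := (((List.range i).map φ).map List.length).sum

/-- The minimal `i ≥ 1` with `j ≤ ℓ(a^1) + ⋯ + ℓ(a^i)`. -/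
noncomputable def relabel (φ : ℕ → PWord) (j : ℤ) : ℤ :=
  ((sInf {i : ℕ | 1 ≤ i ∧ j ≤ (prefLen φ i : ℤ)} : ℕ) : ℤ)

/-- The semistandard recording tableau `Q_EGᴼ(φ)`. -/
noncomputable def QEGseq (φ : ℕ → PWord) : STab :=
  (QEG (concatSeq φ)).map (List.map (fun x => (⟨relabel φ x.ceil, x.primed⟩ : Letter)))

/-- The insertion tableau `P_EGᴼ(φ)`. -/
noncomputable def PEGseq (φ : ℕ → PWord) : STab := PEG (concatSeq φ)

/-- The Schur Q-function of a strict partition: the coefficient of the monomial with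
exponent vector `d` is the number of semistandard shifted tableaux `T` of the given
shape with `x^T = x^d`. -/
noncomputable def SchurQ (sh : List ℕ) : MvPowerSeries ℤ ℤ :=
  fun d => (({T : STab | shapeOf T = sh ∧ IsSemistandard T ∧
    ∀ i : ℤ, d i = T.flatten.countP (fun x => decide (x.ceil = i))} : Set STab).ncard : ℤ)

/-- `Q_z = Σ_{φ ∈ Incr_∞(R_inv^+(z))} x^φ`. -/
noncomputable def Qz (z : Equiv.Perm ℤ) : MvPowerSeries ℤ ℤ :=
  fun d => (({φ : ℕ → PWord | φ ∈ IncrSeq z ∧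
    (∀ i : ℕ, d ((i : ℤ) + 1) = (φ i).length) ∧
    (∀ j : ℤ, j ≤ 0 → d j = 0)} : Set (ℕ → PWord)).ncard : ℤ)

/-! ## Dominant involutions -/

/-- The shifted diagram `SD_λ ⊆ ℤ × ℤ` of a strict partition. -/
def SDset (sh : List ℕ) : Set (ℤ × ℤ) :=
  {p | ∃ i j : ℕ, 1 ≤ i ∧ i ≤ sh.length ∧ 1 ≤ j ∧ j ≤ sh.getD (i - 1) 0 ∧
    p.1 = (i : ℤ) ∧ p.2 = (i : ℤ) + (j : ℤ) - 1}

/-- The involution Rothe diagram `D̂(z) = {(i,j) : z(i) > j ≤ i < z(j)}`. -/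
def invRothe (z : Equiv.Perm ℤ) : Set (ℤ × ℤ) :=
  {p | p.2 < z p.1 ∧ p.2 ≤ p.1 ∧ p.1 < z p.2}

/-- The tableau `T_λ` with entry `i + j - 1` in box `(i, j)` of `SD_λ`. -/
def Tlam (sh : List ℕ) : STab :=
  (List.range sh.length).map (fun r =>
    (List.range (sh.getD r 0)).map (fun k =>
      (⟨2 * (r : ℤ) + (k : ℤ) + 1, false⟩ : Letter)))

/-- The permutation `i + m ↦ w(i) + m` (fixing everything outside `m + support`). -/
def shiftPerm (m : ℕ) (w : Equiv.Perm ℤ) : Equiv.Perm ℤ :=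
  (Equiv.addLeft (m : ℤ)).permCongr w

/-- `z ∈ S_m`: `z` fixes every point outside `[1, m]`. -/
def SupportedOn (z : Equiv.Perm ℤ) (m : ℕ) : Prop :=
  ∀ x : ℤ, x < 1 ∨ (m : ℤ) < x → z x = x
/-! ## Primed compatible sequences -/

/-- A primed compatible sequence, recorded as the list of its columns `(index; value)`. -/
def IsPrimedCompatible (φ : List (ℕ × Letter)) : Prop :=
  (∀ p ∈ φ, 0 < p.1 ∧ 0 < p.2.ceil) ∧
  List.Chain' (fun p q : ℕ × Letter => p.1 ≤ q.1 ∧ (p.1 = q.1 → p.2 ≤ q.2)) φ ∧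
  (∀ (k l : ℕ) (p : ℕ × Letter), k < l → φ[k]? = some p → φ[l]? = some p →
    p.2.primed = false)

def IsIndexStrict (φ : List (ℕ × Letter)) : Prop :=
  List.Chain' (fun p q : ℕ × Letter => p.1 < q.1) φ

/-! ## Sagan–Worley insertion (orthogonal and symplectic versions) -/

/-- Whether `u` bumps `v`: strict comparison when inserting an unprimed letter into a
row or a primed letter into a column, weak comparison otherwise. -/
def swBump (isRow : Bool) (u v : Letter) : Bool :=
  if (isRow && !u.primed) || (!isRow && u.primed) then decide (u < v) else decide (u ≤ v)

/-- Column stage of orthogonal Sagan–Worley insertion. -/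
def swColO : ℕ → STab → ℕ → Letter → STab × Bool
  | 0, T, _, _ => (T, true)
  | fuel + 1, T, c, u =>
    let occ := (List.range (c + 1)).filterMap (fun r => (entry? T r c).map (fun x => (r, x)))
    match occ.find? (fun p => swBump false u p.2) with
    | none =>
        let r := occ.length
        let u' := if r = c ∧ u.primed then Letter.unprime u else u
        (setRowG T r ((T.getD r []) ++ [u']), true)
    | some p =>
        if p.1 = c then
          if u.ceil = p.2.ceil then swColO fuel T (c + 1) (Letter.unprime p.2)
          else
            let q := switchPrimes u p.2
            swColO fuel (setEntryG T p.1 c q.1) (c + 1) q.2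
        else swColO fuel (setEntryG T p.1 c u) (c + 1) p.2

/-- Row stage of orthogonal Sagan–Worley insertion. -/
def swRowO : ℕ → STab → ℕ → Letter → STab × Bool
  | 0, T, _, _ => (T, true)
  | fuel + 1, T, r, u =>
    let row := T.getD r []
    match row.findIdx? (fun v => swBump true u v) with
    | none =>
        if row.isEmpty ∧ u.primed then (setRowG T r [Letter.unprime u], true)
        else (setRowG T r (row ++ [u]), false)
    | some k =>
        let v := row.getD k default
        if k = 0 then
          if u.ceil = v.ceil then swColO fuel T (r + 1) (Letter.unprime v)
          else
            let q := switchPrimes u v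
            swColO fuel (setRowG T r (row.set 0 q.1)) (r + 1) q.2
        else swRowO fuel (setRowG T r (row.set k u)) (r + 1) v

def swInsertO (T : STab) (u : Letter) : STab × Bool :=
  swRowO (T.flatten.length + T.length + 2) T 0 u

/-- Column stage of symplectic (original) Sagan–Worley insertion. -/
def swColSp : ℕ → STab → ℕ → Letter → STab × Bool
  | 0, T, _, _ => (T, true)
  | fuel + 1, T, c, u =>
    let occ := (List.range (c + 1)).filterMap (fun r => (entry? T r c).map (fun x => (r, x)))
    match occ.find? (fun p => swBump false u p.2) with
    | none => (setRowG T occ.length ((T.getD occ.length []) ++ [u]), true)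
    | some p =>
        if p.1 = c then
          if u.ceil = p.2.ceil then swColSp fuel T (c + 1) (Letter.unprime p.2)
          else swColSp fuel (setEntryG T p.1 c u) (c + 1) p.2
        else swColSp fuel (setEntryG T p.1 c u) (c + 1) p.2

/-- Row stage of symplectic (original) Sagan–Worley insertion. -/
def swRowSp : ℕ → STab → ℕ → Letter → STab × Bool
  | 0, T, _, _ => (T, true)
  | fuel + 1, T, r, u =>
    let row := T.getD r []
    match row.findIdx? (fun v => swBump true u v) with
    | none => (setRowG T r (row ++ [u]), false)
    | some k =>
        let v := row.getD k default
        if k = 0 then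
          if u.ceil = v.ceil then swColSp fuel T (r + 1) (Letter.unprime v)
          else swColSp fuel (setRowG T r (row.set 0 u)) (r + 1) v
        else swRowSp fuel (setRowG T r (row.set k u)) (r + 1) v

def swInsertSp (T : STab) (u : Letter) : STab × Bool :=
  swRowSp (T.flatten.length + T.length + 2) T 0 u

def PSWO (φ : List (ℕ × Letter)) : STab := φ.foldl (fun T p => (swInsertO T p.2).1) []

def PSWSp (φ : List (ℕ × Letter)) : STab := φ.foldl (fun T p => (swInsertSp T p.2).1) []

def QSWaux (ins : STab → Letter → STab × Bool) : STab → STab → List (ℕ × Letter) → STab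
  | _, Q, [] => Q
  | P, Q, p :: rest =>
      let res := ins P p.2
      QSWaux ins res.1 (addBox Q P res.1 ⟨(p.1 : ℤ), res.2⟩) rest

def QSWO (φ : List (ℕ × Letter)) : STab := QSWaux swInsertO [] [] φ

def QSWSp (φ : List (ℕ × Letter)) : STab := QSWaux swInsertSp [] [] φ

/-- Entry `A_{ij}` of the circled matrix of `φ` (forgetting the circles). -/
def cmEntry (φ : List (ℕ × Letter)) (i j : ℕ) : ℕ :=
  φ.countP (fun p => decide (p.1 = i ∧ p.2.ceil = (j : ℤ)))

/-! ## Shifted mixed insertion (orthogonal and symplectic versions) -/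

/-- Tableaux whose entries are signed letters `(ε, u)`, `ε ∈ {+, -}`
(`true` records the sign `-`). -/
abbrev MTab := List (List (Bool × Letter))

def extractO (U : MTab) : STab :=
  U.map (fun row =>
    match row with
    | [] => []
    | (e, x) :: rest => (if e then (⟨x.ceil, true⟩ : Letter) else x) :: rest.map Prod.snd)

def extractSp (U : MTab) : STab := U.map (List.map Prod.snd)

/-- One mixed insertion, of the pair `β` into row (`isCol = false`) or column
(`isCol = true`) number `idx`; returns the tableau and the added box. -/
def hmIns (sympl : Bool) : ℕ → MTab → Bool → ℕ → Bool × Letter → MTab × (ℕ × ℕ)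
  | 0, T, _, _, _ => (T, (0, 0))
  | fuel + 1, T, isCol, idx, β =>
    if isCol then
      let c := idx
      let occ := (List.range (c + 1)).filterMap
        (fun r => (entryG? T r c).map (fun x => (r, x)))
      match occ.find? (fun p => decide (β.2 < p.2.2)) with
      | none =>
          let r := occ.length
          (setRowG T r ((T.getD r []) ++ [β]), (r, c))
      | some p =>
          if p.1 = c then
            hmIns sympl fuel
              (setEntryG T p.1 c (if sympl then (p.2.1, β.2) else β)) true (c + 1)
              (if sympl then (β.1, ⟨p.2.2.ceil, true⟩) else (p.2.1, ⟨p.2.2.ceil, true⟩))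
          else
            hmIns sympl fuel (setEntryG T p.1 c (p.2.1, β.2)) p.2.2.primed
              (if p.2.2.primed then c + 1 else p.1 + 1) (β.1, p.2.2)
    else
      let r := idx
      let row := T.getD r []
      match row.findIdx? (fun p => decide (β.2 < p.2)) with
      | none => (setRowG T r (row ++ [β]), (r, r + row.length))
      | some k =>
          let q := row.getD k default
          if k = 0 then
            hmIns sympl fuel
              (setRowG T r (row.set 0 (if sympl then (q.1, β.2) else β))) true (r + 1)
              (if sympl then (β.1, ⟨q.2.ceil, true⟩) else (q.1, ⟨q.2.ceil, true⟩))
          else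
            hmIns sympl fuel (setRowG T r (row.set k (q.1, β.2))) q.2.primed
              (if q.2.primed then r + k + 1 else r + 1) (β.1, q.2)

def hmInsert (sympl : Bool) (T : MTab) (x : Letter) : MTab × (ℕ × ℕ) :=
  hmIns sympl (2 * T.flatten.length + 4) T false 0 (x.primed, ⟨x.ceil, false⟩)

def hmAuxCS (sympl : Bool) : MTab → STab → List (ℕ × Letter) → MTab × STab
  | U, Q, [] => (U, Q)
  | U, Q, p :: rest =>
      let res := hmInsert sympl U p.2
      let pos := res.2
      let sgn := ((entryG? res.1 pos.1 pos.2).map Prod.fst).getD false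
      let pr : Bool := if sympl then sgn else (decide (pos.1 ≠ pos.2) && sgn)
      hmAuxCS sympl res.1
        (setRowG Q pos.1 ((Q.getD pos.1 []) ++ [(⟨(p.1 : ℤ), pr⟩ : Letter)])) rest

def PHMO (φ : List (ℕ × Letter)) : STab := extractO (hmAuxCS false [] [] φ).1
def QHMO (φ : List (ℕ × Letter)) : STab := (hmAuxCS false [] [] φ).2
def PHMSp (φ : List (ℕ × Letter)) : STab := extractSp (hmAuxCS true [] [] φ).1
def QHMSp (φ : List (ℕ × Letter)) : STab := (hmAuxCS true [] [] φ).2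

/-- A primed word, identified with the primed compatible sequence with
index row `1, 2, …, n`. -/
def wordCS (a : PWord) : List (ℕ × Letter) :=
  ((List.range a.length).zip a).map (fun p => (p.1 + 1, p.2))

/-! ## The transpose of a primed compatible sequence -/

def insSortedCS (p : ℕ × Letter) : List (ℕ × Letter) → List (ℕ × Letter)
  | [] => [p]
  | q :: rest =>
      if p.1 < q.1 ∨ (p.1 = q.1 ∧ p.2 ≤ q.2) then p :: q :: rest
      else q :: insSortedCS p rest

def sortCS (l : List (ℕ × Letter)) : List (ℕ × Letter) := l.foldr insSortedCS []

/-- `φ^⊤`: move each prime from the value to the index above it, interchange the two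
rows, and reorder the columns lexicographically. -/
def transposeCS (φ : List (ℕ × Letter)) : List (ℕ × Letter) :=
  sortCS (φ.map (fun p => (p.2.ceil.toNat, (⟨(p.1 : ℤ), p.2.primed⟩ : Letter))))

namespace OEG

/-! ### Demazure operators on permutations of `ℤ` -/

def demR (i : ℤ) (σ : Equiv.Perm ℤ) : Equiv.Perm ℤ :=
  if σ i < σ (i + 1) then σ * sPerm i else σ

def demL (i : ℤ) (σ : Equiv.Perm ℤ) : Equiv.Perm ℤ := (demR i σ⁻¹)⁻¹

def dem (i : ℤ) (σ : Equiv.Perm ℤ) : Equiv.Perm ℤ := demL i (demR i σ)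

lemma sPerm_apply (i k : ℤ) :
    sPerm i k = if k = i then i + 1 else if k = i + 1 then i else k := by
  simp [sPerm, Equiv.swap_apply_def]

@[simp] lemma sPerm_mul_self (i : ℤ) : sPerm i * sPerm i = 1 := by
  simp [sPerm]

@[simp] lemma sPerm_inv (i : ℤ) : (sPerm i)⁻¹ = sPerm i := by
  simp [sPerm]

lemma demR_apply (i : ℤ) (σ : Equiv.Perm ℤ) (k : ℤ) :
    demR i σ k = if σ i < σ (i + 1) then
      (if k = i then σ (i + 1) else if k = i + 1 then σ i else σ k) else σ k := by
  unfold demR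
  split_ifs <;> simp_all [sPerm_apply]

lemma demL_eq (i : ℤ) (σ : Equiv.Perm ℤ) :
    demL i σ = if σ⁻¹ i < σ⁻¹ (i + 1) then sPerm i * σ else σ := by
  unfold demL demR
  split_ifs <;> simp

lemma demR_far {i j : ℤ} (h : 2 ≤ |i - j|) (σ : Equiv.Perm ℤ) :
    demR i (demR j σ) = demR j (demR i σ) := by
  have : i ≠ j ∧ i ≠ j + 1 ∧ j ≠ i + 1 := by
    refine ⟨?_, ?_, ?_⟩ <;> rintro rfl <;> simp at h
  ext k
  simp only [demR_apply]
  grind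

lemma demR_braid_succ (i : ℤ) (σ : Equiv.Perm ℤ) :
    demR i (demR (i + 1) (demR i σ)) = demR (i + 1) (demR i (demR (i + 1) σ)) := by
  ext k
  simp only [demR_apply]
  grind

lemma demR_braid {i j : ℤ} (h : |i - j| = 1) (σ : Equiv.Perm ℤ) :
    demR i (demR j (demR i σ)) = demR j (demR i (demR j σ)) := by
  have : i = j + 1 ∨ j = i + 1 := by
    rcases abs_eq (by norm_num : (0 : ℤ) ≤ 1) |>.1 h with h | h <;> omega
  rcases this with rfl | rfl
  · rw [demR_braid_succ]
  · rw [demR_braid_succ]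

lemma sPerm_lt_iff {i a b : ℤ} (h1 : ¬ (a = i ∧ b = i + 1)) (h2 : ¬ (a = i + 1 ∧ b = i)) :
    sPerm i a < sPerm i b ↔ a < b := by
  simp only [sPerm_apply]
  split_ifs <;> omega

lemma demL_demR_comm (i j : ℤ) (σ : Equiv.Perm ℤ) :
    demL i (demR j σ) = demR j (demL i σ) := by
  have hi : ∀ k l, σ⁻¹ k = l ↔ σ l = k := by
    intro k l
    rw [Equiv.Perm.inv_eq_iff_eq]
    exact eq_comm
  by_cases hA : σ j = i ∧ σ (j + 1) = i + 1
  · have e1 := (hi _ _).2 hA.1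
    have e2 := (hi _ _).2 hA.2
    have e : σ * sPerm j = sPerm i * σ := by
      ext k
      have c1 : σ k = σ j ↔ k = j := σ.injective.eq_iff
      have c2 : σ k = σ (j + 1) ↔ k = j + 1 := σ.injective.eq_iff
      simp only [Equiv.Perm.mul_apply, sPerm_apply]
      grind
    have e3 : demR j σ = σ * sPerm j := by
      unfold demR; rw [if_pos (by omega)]
    have e4 : demL i σ = sPerm i * σ := by
      rw [demL_eq, if_pos (by omega)]
    rw [e4, ← e, e3, e, demL_eq, if_neg, demR, if_neg]
    · rw [Equiv.Perm.mul_apply, Equiv.Perm.mul_apply, ← Equiv.Perm.mul_apply, ← e]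
      simp [sPerm_apply, hA.2]
    · rw [mul_inv_rev, sPerm_inv, Equiv.Perm.mul_apply, Equiv.Perm.mul_apply]
      simp only [sPerm_apply, if_true]
      rw [if_neg (by omega), e1, e2]
      omega
  by_cases hB : σ j = i + 1 ∧ σ (j + 1) = i
  · have e1 := (hi _ _).2 hB.1
    have e2 := (hi _ _).2 hB.2
    have e3 : demR j σ = σ := by
      unfold demR; rw [if_neg (by omega)]
    have e4 : demL i σ = σ := by
      rw [demL_eq, if_neg (by omega)]
    rw [e4, e3, e4]
  have hR := sPerm_lt_iff hA hB
  have hL : sPerm j (σ⁻¹ i) < sPerm j (σ⁻¹ (i + 1)) ↔ σ⁻¹ i < σ⁻¹ (i + 1) := by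
    apply sPerm_lt_iff
    · rw [hi, hi]; exact hA
    · rw [hi, hi]; tauto
  have e1 : demL i (σ * sPerm j) = if σ⁻¹ i < σ⁻¹ (i + 1) then sPerm i * (σ * sPerm j)
      else σ * sPerm j := by
    simp only [demL_eq, mul_inv_rev, sPerm_inv, Equiv.Perm.mul_apply, hL]
  have e2 : demR j (sPerm i * σ) = if σ j < σ (j + 1) then sPerm i * (σ * sPerm j)
      else sPerm i * σ := by
    simp only [demR, Equiv.Perm.mul_apply, hR, mul_assoc]
  by_cases h1 : σ j < σ (j + 1) <;> by_cases h2 : σ⁻¹ i < σ⁻¹ (i + 1) <;>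
    simp only [demR, h1, if_true, if_false, demL_eq i σ, h2, e1]
  · simpa [demR, h1, mul_assoc] using e2.symm
  · simpa [demR, h1, mul_assoc] using e2.symm

lemma heckeProd_eq (w : List ℤ) : heckeProd w = w.foldl (fun σ i => demR i σ) 1 := rfl

lemma foldl_demR_demL (w : List ℤ) (i : ℤ) (σ : Equiv.Perm ℤ) :
    w.foldl (fun σ i => demR i σ) (demL i σ) = demL i (w.foldl (fun σ i => demR i σ) σ) := by
  induction w generalizing σ with
  | nil => rfl
  | cons j w ih => simp only [List.foldl_cons]; rw [← demL_demR_comm, ih]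

lemma dem_one (i : ℤ) : demR i 1 = demL i 1 := by
  simp [demR, demL_eq]

lemma heckeProd_cons (i : ℤ) (w : List ℤ) : heckeProd (i :: w) = demL i (heckeProd w) := by
  rw [heckeProd_eq, heckeProd_eq, ← foldl_demR_demL]
  simp only [List.foldl_cons]
  rw [dem_one]

lemma heckeProd_concat (i : ℤ) (w : List ℤ) : heckeProd (w ++ [i]) = demR i (heckeProd w) := by
  simp [heckeProd_eq]

lemma invHecke_concat (a : List ℤ) (i : ℤ) : invHecke (a ++ [i]) = dem i (invHecke a) := by
  cases a with
  | nil =>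
    simp only [invHecke, dem, List.nil_append, List.reverse_singleton, List.tail_cons,
      List.append_nil, List.reverse_nil, List.tail_nil]
    simp only [heckeProd_eq, List.foldl_cons, List.foldl_nil]
    rw [demL_eq, if_neg]
    simp [demR, sPerm_apply]
  | cons b a =>
    have : (b :: a ++ [i]).reverse ++ (b :: a ++ [i]).tail
        = i :: (((b :: a).reverse ++ (b :: a).tail) ++ [i]) := by simp
    rw [invHecke, this, heckeProd_cons, heckeProd_concat]
    rfl

/-- The action of a word on a permutation by Demazure conjugation. -/
def act (y : Equiv.Perm ℤ) (a : List ℤ) : Equiv.Perm ℤ := a.foldl (fun y i => dem i y) y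

lemma invHecke_eq_act (a : List ℤ) : invHecke a = act 1 a := by
  induction a using List.reverseRecOn with
  | nil => rfl
  | append_singleton a i ih => rw [invHecke_concat, ih]; simp [act]

lemma act_append (y : Equiv.Perm ℤ) (a b : List ℤ) : act y (a ++ b) = act (act y a) b := by
  simp [act]

@[simp] lemma act_nil (y : Equiv.Perm ℤ) : act y [] = y := rfl

@[simp] lemma act_cons (y : Equiv.Perm ℤ) (i : ℤ) (a : List ℤ) :
    act y (i :: a) = act (dem i y) a := rfl

def Invol (y : Equiv.Perm ℤ) : Prop := ∀ k, y (y k) = k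

def Comm (y : Equiv.Perm ℤ) (i : ℤ) : Prop := y i = i ∧ y (i + 1) = i + 1

lemma Invol.inv_eq {y : Equiv.Perm ℤ} (h : Invol y) : y⁻¹ = y := by
  ext k; rw [Equiv.Perm.inv_eq_iff_eq, h]

lemma dem_of_not_asc {y : Equiv.Perm ℤ} (h : Invol y) {i : ℤ} (hi : ¬ y i < y (i + 1)) :
    dem i y = y := by
  rw [dem, demR, if_neg hi, demL_eq, h.inv_eq, if_neg hi]

lemma dem_of_comm {y : Equiv.Perm ℤ} (h : Invol y) {i : ℤ} (hi : Comm y i) :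
    dem i y = y * sPerm i := by
  obtain ⟨h1, h2⟩ := hi
  rw [dem, demR, if_pos (by omega), demL_eq, if_neg]
  simp [h.inv_eq, sPerm_apply, h1, h2]

lemma dem_of_conj {y : Equiv.Perm ℤ} (h : Invol y) {i : ℤ} (hi : y i < y (i + 1))
    (hc : ¬ Comm y i) : dem i y = sPerm i * y * sPerm i := by
  rw [dem, demR, if_pos hi, demL_eq, if_pos, mul_assoc]
  have a1 := h i
  have a2 := h (i + 1)
  have : sPerm i (y i) < sPerm i (y (i + 1)) := by
    rw [sPerm_lt_iff]
    · exact hi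
    · exact hc
    · rintro ⟨h1, h2⟩
      omega
  simpa [h.inv_eq] using this

lemma dem_apply {y : Equiv.Perm ℤ} (h : Invol y) (i k : ℤ) :
    dem i y k = if y i < y (i + 1) then
      if y i = i ∧ y (i + 1) = i + 1 then y (sPerm i k) else sPerm i (y (sPerm i k))
      else y k := by
  split_ifs with h1 h2
  · rw [dem_of_comm h h2]; rfl
  · rw [dem_of_conj h h1 h2]; rfl
  · rw [dem_of_not_asc h h1]

lemma Invol.dem {y : Equiv.Perm ℤ} (h : Invol y) (i : ℤ) : Invol (dem i y) := by
  intro k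
  by_cases h1 : y i < y (i + 1)
  · by_cases h2 : Comm y i
    · rw [dem_of_comm h h2]
      simp only [Equiv.Perm.mul_apply]
      obtain ⟨h2, h3⟩ := h2
      have := h k
      have c1 : y k = y i ↔ k = i := y.injective.eq_iff
      have c2 : y k = y (i + 1) ↔ k = i + 1 := y.injective.eq_iff
      simp only [sPerm_apply]
      grind
    · rw [dem_of_conj h h1 h2]
      have e : ∀ m, sPerm i (sPerm i m) = m := fun m => by
        rw [← Equiv.Perm.mul_apply, sPerm_mul_self]; rfl
      simp only [Equiv.Perm.mul_apply, e, h _]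
  · rw [dem_of_not_asc h h1, h]

lemma invol_one : Invol 1 := fun _ => rfl

lemma demL_far {i j : ℤ} (h : 2 ≤ |i - j|) (σ : Equiv.Perm ℤ) :
    demL i (demL j σ) = demL j (demL i σ) := by
  simp only [demL, inv_inv, demR_far h]

lemma demL_braid {i j : ℤ} (h : |i - j| = 1) (σ : Equiv.Perm ℤ) :
    demL i (demL j (demL i σ)) = demL j (demL i (demL j σ)) := by
  simp only [demL, inv_inv, demR_braid h]

lemma dem_far {i j : ℤ} (h : 2 ≤ |i - j|) (σ : Equiv.Perm ℤ) :
    dem i (dem j σ) = dem j (dem i σ) := by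
  simp only [dem, ← demL_demR_comm, demR_far h, demL_far h]

lemma dem_braid {i j : ℤ} (h : |i - j| = 1) (σ : Equiv.Perm ℤ) :
    dem i (dem j (dem i σ)) = dem j (dem i (dem j σ)) := by
  simp only [dem, ← demL_demR_comm, demR_braid h, demL_braid h]

/-! ### The length function and the step-wise description of `RinvPlus` -/

def invSet (y : Equiv.Perm ℤ) : Set (ℤ × ℤ) := {p | p.1 < p.2 ∧ y p.2 < y p.1}

def movedSet (y : Equiv.Perm ℤ) : Set ℤ := {x | y x ≠ x}

lemma invSet_mul_sPerm {y : Equiv.Perm ℤ} {i : ℤ} (h : y i < y (i + 1)) :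
    invSet (y * sPerm i) =
      insert (i, i + 1) ((fun p : ℤ × ℤ => (sPerm i p.1, sPerm i p.2)) '' invSet y) := by
  have e : ∀ m, sPerm i (sPerm i m) = m := fun m => by
    rw [← Equiv.Perm.mul_apply, sPerm_mul_self]; rfl
  have key : ∀ a b : ℤ, sPerm i a < sPerm i b ↔
      ((a < b ∧ ¬ (a = i ∧ b = i + 1)) ∨ (a = i + 1 ∧ b = i)) := by
    intro a b
    simp only [sPerm_apply]
    split_ifs <;> omega
  have ei : sPerm i i = i + 1 := by simp [sPerm_apply]
  have ei' : sPerm i (i + 1) = i := by simp [sPerm_apply]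
  ext ⟨a, b⟩
  simp only [invSet, Set.mem_ofPred_eq, Set.mem_insert_iff, Set.mem_image, Prod.exists,
    Prod.mk.injEq, Equiv.Perm.mul_apply]
  constructor
  · rintro ⟨h1, h2⟩
    by_cases hab : a = i ∧ b = i + 1
    · exact Or.inl hab
    · refine Or.inr ⟨sPerm i a, sPerm i b, ⟨?_, h2⟩, e a, e b⟩
      rw [key]; exact Or.inl ⟨h1, hab⟩
  · rintro (⟨rfl, rfl⟩ | ⟨c, d, ⟨h1, h2⟩, rfl, rfl⟩)
    · rw [ei, ei']; exact ⟨by omega, h⟩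
    · rw [e, e, key]
      refine ⟨Or.inl ⟨h1, ?_⟩, h2⟩
      rintro ⟨rfl, rfl⟩
      omega

lemma finite_invSet_mul_sPerm {y : Equiv.Perm ℤ} {i : ℤ} (h : y i < y (i + 1))
    (hf : (invSet y).Finite) :
    (invSet (y * sPerm i)).Finite ∧ (invSet (y * sPerm i)).ncard = (invSet y).ncard + 1 := by
  rw [invSet_mul_sPerm h]
  refine ⟨(hf.image _).insert _, ?_⟩
  rw [Set.ncard_insert_of_notMem _ (hf.image _), Set.ncard_image_of_injective]
  · rintro ⟨a, b⟩ ⟨c, d⟩ h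
    simpa using h
  · rintro ⟨⟨a, b⟩, ⟨h1, h2⟩, h3⟩
    have e : ∀ m, sPerm i (sPerm i m) = m := fun m => by
      rw [← Equiv.Perm.mul_apply, sPerm_mul_self]; rfl
    simp only [Prod.mk.injEq] at h3
    have ha : a = i + 1 := by rw [← e a, h3.1]; simp [sPerm_apply]
    have hb : b = i := by rw [← e b, h3.2]; simp [sPerm_apply]
    dsimp at h1
    omega

lemma invSet_inv (y : Equiv.Perm ℤ) :
    invSet y⁻¹ = (fun p : ℤ × ℤ => (y p.2, y p.1)) '' invSet y := by
  ext ⟨a, b⟩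
  simp only [invSet, Set.mem_ofPred_eq, Set.mem_image, Prod.exists, Prod.mk.injEq]
  constructor
  · rintro ⟨h1, h2⟩
    exact ⟨y⁻¹ b, y⁻¹ a, ⟨h2, by simpa using h1⟩, by simp, by simp⟩
  · rintro ⟨c, d, ⟨h1, h2⟩, rfl, rfl⟩
    simpa using ⟨h2, h1⟩

lemma finite_invSet_inv {y : Equiv.Perm ℤ} (hf : (invSet y).Finite) :
    (invSet y⁻¹).Finite ∧ (invSet y⁻¹).ncard = (invSet y).ncard := by
  rw [invSet_inv]
  refine ⟨hf.image _, Set.ncard_image_of_injective _ ?_⟩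
  rintro ⟨a, b⟩ ⟨c, d⟩ h
  simpa [and_comm] using h

/-- Involutions with finite support. -/
structure Nice (y : Equiv.Perm ℤ) : Prop where
  invol : Invol y
  finInv : (invSet y).Finite
  finMoved : (movedSet y).Finite

noncomputable def invLen (y : Equiv.Perm ℤ) : ℕ := 2 * (invSet y).ncard + (movedSet y).ncard

lemma invSet_one : invSet 1 = ∅ := by
  ext ⟨a, b⟩; simp [invSet]; omega

lemma movedSet_one : movedSet 1 = ∅ := by
  ext a; simp [movedSet]

lemma nice_one : Nice 1 :=
  ⟨invol_one, by simp [invSet_one], by simp [movedSet_one]⟩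

lemma invLen_one : invLen 1 = 0 := by simp [invLen, invSet_one, movedSet_one]

lemma movedSet_conj (y : Equiv.Perm ℤ) (i : ℤ) :
    movedSet (sPerm i * y * sPerm i) = sPerm i '' movedSet y := by
  have e : ∀ m, sPerm i (sPerm i m) = m := fun m => by
    rw [← Equiv.Perm.mul_apply, sPerm_mul_self]; rfl
  ext a
  simp only [movedSet, Set.mem_ofPred_eq, Set.mem_image, Equiv.Perm.mul_apply]
  constructor
  · intro h
    refine ⟨sPerm i a, fun h' => h ?_, e a⟩
    rw [h', e]
  · rintro ⟨x, hx, rfl⟩ h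
    rw [e] at h
    exact hx ((sPerm i).injective h)

lemma movedSet_comm {y : Equiv.Perm ℤ} {i : ℤ} (h : Comm y i) :
    movedSet (y * sPerm i) = insert i (insert (i + 1) (movedSet y)) := by
  obtain ⟨h1, h2⟩ := h
  ext a
  have c1 : a = i → y a = i := by rintro rfl; exact h1
  have c2 : a = i + 1 → y a = i + 1 := by rintro rfl; exact h2
  simp only [movedSet, Set.mem_ofPred_eq, Equiv.Perm.mul_apply, Set.mem_insert_iff, sPerm_apply]
  split_ifs <;> grind

lemma Nice.dem_asc {y : Equiv.Perm ℤ} (h : Nice y) {i : ℤ} (hi : y i < y (i + 1)) :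
    Nice (dem i y) ∧ invLen (dem i y) = invLen y + 4 := by
  obtain ⟨f1, c1⟩ := finite_invSet_mul_sPerm hi h.finInv
  by_cases hc : Comm y i
  · have e := dem_of_comm h.invol hc
    have e2 := movedSet_comm hc
    refine ⟨⟨h.invol.dem i, e ▸ f1, ?_⟩, ?_⟩
    · rw [e, e2]; exact (h.finMoved.insert _).insert _
    · rw [invLen, e, c1, e2, Set.ncard_insert_of_notMem _ (h.finMoved.insert _),
        Set.ncard_insert_of_notMem _ h.finMoved, invLen]
      · ring
      · simp [movedSet, hc.2]
      · simp [movedSet, hc.1]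
  · have e := dem_of_conj h.invol hi hc
    obtain ⟨f2, c2⟩ := finite_invSet_inv f1
    have hi' : (y * sPerm i)⁻¹ i < (y * sPerm i)⁻¹ (i + 1) := by
      have a1 := h.invol i
      have a2 := h.invol (i + 1)
      rw [mul_inv_rev, sPerm_inv, h.invol.inv_eq, Equiv.Perm.mul_apply, Equiv.Perm.mul_apply,
        sPerm_lt_iff]
      · exact hi
      · exact hc
      · rintro ⟨h1, h2⟩
        omega
    obtain ⟨f3, c3⟩ := finite_invSet_mul_sPerm hi' f2
    have e3 : (y * sPerm i)⁻¹ * sPerm i = sPerm i * y * sPerm i := by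
      rw [mul_inv_rev, sPerm_inv, h.invol.inv_eq]
    rw [e3] at f3 c3
    refine ⟨⟨h.invol.dem i, e ▸ f3, ?_⟩, ?_⟩
    · rw [e, movedSet_conj]; exact h.finMoved.image _
    · rw [invLen, e, c3, c2, c1, movedSet_conj,
        Set.ncard_image_of_injective _ (sPerm i).injective, invLen]
      ring

/-- Every step of the word, started at `y`, is an ascent, and primes occur at commutations. -/
def Val : Equiv.Perm ℤ → PWord → Prop
  | _, [] => True
  | y, x :: a => y x.ceil < y (x.ceil + 1) ∧ (x.primed = true → Comm y x.ceil) ∧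
      Val (dem x.ceil y) a

lemma val_append (y : Equiv.Perm ℤ) (a b : PWord) :
    Val y (a ++ b) ↔ Val y a ∧ Val (act y (unprimeWord a)) b := by
  induction a generalizing y with
  | nil => simp [Val, unprimeWord]
  | cons x a ih => simp [Val, ih, unprimeWord, and_assoc]

lemma Val.invLen {y : Equiv.Perm ℤ} {a : PWord} (hy : Nice y) (h : Val y a) :
    Nice (act y (unprimeWord a)) ∧
      invLen (act y (unprimeWord a)) = invLen y + 4 * a.length := by
  induction a generalizing y with
  | nil => simpa [unprimeWord] using hy
  | cons x a ih =>
    obtain ⟨h1, h2, h3⟩ := h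
    obtain ⟨n1, l1⟩ := hy.dem_asc h1
    obtain ⟨n2, l2⟩ := ih n1 h3
    refine ⟨n2, ?_⟩
    have : act y (unprimeWord (x :: a)) = act (dem x.ceil y) (unprimeWord a) := rfl
    rw [this, l2, l1, List.length_cons]
    ring

lemma exists_val_subword {y : Equiv.Perm ℤ} (hy : Invol y) (a : List ℤ) :
    ∃ b : PWord, Val y b ∧ act y (unprimeWord b) = act y a ∧
      (b.length < a.length ∨ (unprimeWord b = a)) := by
  induction a generalizing y with
  | nil => exact ⟨[], trivial, rfl, Or.inr rfl⟩
  | cons i a ih =>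
    by_cases hi : y i < y (i + 1)
    · obtain ⟨b, h1, h2, h3⟩ := ih (hy.dem i)
      refine ⟨⟨i, false⟩ :: b, ⟨hi, by simp, h1⟩, h2, ?_⟩
      simpa [unprimeWord] using h3
    · obtain ⟨b, h1, h2, h3⟩ := ih hy
      refine ⟨b, h1, by rw [act_cons, dem_of_not_asc hy hi, h2], Or.inl ?_⟩
      rcases h3 with h3 | h3
      · simp; omega
      · rw [← h3]; simp [unprimeWord]

lemma val_of_primes {y : Equiv.Perm ℤ} {b : PWord} (h : Val y b) {a : PWord}
    (hab : unprimeWord a = unprimeWord b)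
    (hp : ∀ (k : ℕ) (x : Letter), a[k]? = some x → x.primed = true →
      Comm (act y ((unprimeWord a).take k)) x.ceil) : Val y a := by
  induction a generalizing y b with
  | nil => trivial
  | cons x a ih =>
    cases b with
    | nil => simp [unprimeWord] at hab
    | cons x' b =>
      simp only [unprimeWord, List.map_cons, List.cons.injEq] at hab
      obtain ⟨h1, h2, h3⟩ := h
      refine ⟨hab.1 ▸ h1, ?_, ih (hab.1 ▸ h3) hab.2 ?_⟩
      · intro hx
        simpa using hp 0 x rfl hx
      · intro k x'' hk hx
        simpa [unprimeWord] using hp (k + 1) x'' (by simpa using hk) hx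

lemma Val.comm {y : Equiv.Perm ℤ} {a : PWord} (h : Val y a) {k : ℕ} {x : Letter}
    (hk : a[k]? = some x) (hx : x.primed = true) :
    Comm (act y ((unprimeWord a).take k)) x.ceil := by
  induction a generalizing y k with
  | nil => simp at hk
  | cons x' a ih =>
    obtain ⟨h1, h2, h3⟩ := h
    cases k with
    | zero =>
      simp only [List.getElem?_cons_zero, Option.some.injEq] at hk
      subst hk
      simpa using h2 hx
    | succ k => simpa [unprimeWord] using ih h3 (by simpa using hk)

theorem mem_RinvPlus {z : Equiv.Perm ℤ} {a : PWord} :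
    a ∈ RinvPlus z ↔ Val 1 a ∧ act 1 (unprimeWord a) = z := by
  have hlen : ∀ c : PWord, (unprimeWord c).length = c.length := fun c => by simp [unprimeWord]
  constructor
  · rintro ⟨⟨h1, h2⟩, h3⟩
    rw [invHecke_eq_act] at h1
    refine ⟨?_, h1⟩
    obtain ⟨b, hb, hb2, hb3⟩ := exists_val_subword invol_one (unprimeWord a)
    have hb4 : unprimeWord b = unprimeWord a := by
      rcases hb3 with hb3 | hb3
      · have := h2 (unprimeWord b) (by rw [invHecke_eq_act, hb2, h1])
        rw [hlen b] at this
        omega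
      · exact hb3
    refine val_of_primes hb hb4.symm fun k x hk hx => ?_
    obtain ⟨x', hx', hc⟩ := h3 k x hk hx
    simp only [unprimeWord, List.getElem?_map, hk, Option.map_some, Option.some.injEq] at hx'
    subst hx'
    rw [← invHecke_eq_act]
    exact hc
  · rintro ⟨h1, h2⟩
    refine ⟨⟨by rw [invHecke_eq_act, h2], fun b hb => ?_⟩, fun k x hk hx => ?_⟩
    · rw [invHecke_eq_act] at hb
      obtain ⟨c, hc, hc2, hc3⟩ := exists_val_subword invol_one b
      obtain ⟨-, l1⟩ := h1.invLen nice_one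
      obtain ⟨-, l2⟩ := hc.invLen nice_one
      rw [hc2, hb] at l2
      rw [h2] at l1
      have l3 : c.length ≤ b.length := by
        rcases hc3 with hc3 | hc3
        · omega
        · rw [← hc3, hlen]
      rw [hlen]
      omega
    · refine ⟨x.ceil, by simp [unprimeWord, hk], ?_⟩
      rw [invHecke_eq_act]
      exact h1.comm hk hx

lemma mem_RinvPlus_one_nil : ([] : PWord) ∈ RinvPlus 1 := mem_RinvPlus.2 ⟨trivial, rfl⟩

lemma length_of_mem_RinvPlus {z : Equiv.Perm ℤ} {a : PWord} (h : a ∈ RinvPlus z) :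
    invLen z = 4 * a.length := by
  rw [mem_RinvPlus] at h
  have := (h.1.invLen nice_one).2
  rw [h.2, invLen_one] at this
  omega

/-! ### Local relations for words -/

section local_lemmas

variable {y : Equiv.Perm ℤ}

lemma Invol.eq_iff (hy : Invol y) (a b : ℤ) : y a = b ↔ y b = a := by
  constructor <;> rintro rfl <;> exact hy _

lemma asc_far (hy : Invol y) {i j : ℤ} (hij : 2 ≤ |i - j|) (h1 : y i < y (i + 1))
    (h2 : dem i y j < dem i y (j + 1)) : y j < y (j + 1) ∧ dem j y i < dem j y (i + 1) := by
  have hij' : i + 1 < j ∨ j + 1 < i := by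
    rcases le_abs'.1 hij with h | h <;> omega
  have e1 : sPerm i j = j := by rw [sPerm_apply, if_neg (by omega), if_neg (by omega)]
  have e2 : sPerm i (j + 1) = j + 1 := by
    rw [sPerm_apply, if_neg (by omega), if_neg (by omega)]
  have e3 : sPerm j i = i := by rw [sPerm_apply, if_neg (by omega), if_neg (by omega)]
  have e4 : sPerm j (i + 1) = i + 1 := by
    rw [sPerm_apply, if_neg (by omega), if_neg (by omega)]
  have a1 := hy.eq_iff i j
  have a2 := hy.eq_iff (i + 1) j
  have a3 := hy.eq_iff i (j + 1)
  have a4 := hy.eq_iff (i + 1) (j + 1)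
  rw [dem_apply hy, dem_apply hy] at h2 ⊢
  rw [e1, e2, if_pos h1, if_pos h1] at h2
  rw [e3, e4]
  simp only [sPerm_apply] at h2 ⊢
  generalize y i = A at *
  generalize y (i + 1) = B at *
  generalize y j = C at *
  generalize y (j + 1) = D at *
  grind

lemma comm_far (hy : Invol y) {i j : ℤ} (hij : 2 ≤ |i - j|) :
    Comm (dem i y) j ↔ Comm y j := by
  have hij' : i + 1 < j ∨ j + 1 < i := by
    rcases le_abs'.1 hij with h | h <;> omega
  have e1 : sPerm i j = j := by rw [sPerm_apply, if_neg (by omega), if_neg (by omega)]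
  have e2 : sPerm i (j + 1) = j + 1 := by
    rw [sPerm_apply, if_neg (by omega), if_neg (by omega)]
  unfold Comm
  rw [dem_apply hy, dem_apply hy, e1, e2]
  simp only [sPerm_apply]
  grind

lemma dem_self_not_asc (hy : Invol y) (i : ℤ) : ¬ dem i y i < dem i y (i + 1) := by
  have s1 : sPerm i i = i + 1 := by simp [sPerm_apply]
  have s2 : sPerm i (i + 1) = i := by simp [sPerm_apply]
  have a1 := hy.eq_iff i i
  have a2 := hy.eq_iff (i + 1) (i + 1)
  have a3 := hy.eq_iff i (i + 1)
  rw [dem_apply hy, dem_apply hy, s1, s2]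
  simp only [sPerm_apply]
  grind

lemma nice_dem (h : Nice y) (i : ℤ) : Nice (dem i y) ∧ invLen (dem i y) ≤ invLen y + 4 := by
  by_cases hi : y i < y (i + 1)
  · exact ⟨(h.dem_asc hi).1, (h.dem_asc hi).2.le⟩
  · rw [dem_of_not_asc h.invol hi]; exact ⟨h, by omega⟩

lemma Nice.asc_of_invLen (h : Nice y) {i : ℤ} (hl : invLen y + 4 ≤ invLen (dem i y)) :
    y i < y (i + 1) := by
  by_contra hi
  rw [dem_of_not_asc h.invol hi] at hl
  omega

lemma asc_braid (h : Nice y) {i j : ℤ} (hij : |i - j| = 1) (h1 : y i < y (i + 1))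
    (h2 : dem i y j < dem i y (j + 1))
    (h3 : dem j (dem i y) i < dem j (dem i y) (i + 1)) :
    y j < y (j + 1) ∧ dem j y i < dem j y (i + 1) ∧
      dem i (dem j y) j < dem i (dem j y) (j + 1) := by
  obtain ⟨n1, l1⟩ := h.dem_asc h1
  obtain ⟨n2, l2⟩ := n1.dem_asc h2
  obtain ⟨n3, l3⟩ := n2.dem_asc h3
  rw [dem_braid hij] at l3
  obtain ⟨m1, k1⟩ := nice_dem h j
  obtain ⟨m2, k2⟩ := nice_dem m1 i
  obtain ⟨m3, k3⟩ := nice_dem m2 j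
  exact ⟨h.asc_of_invLen (by omega), m1.asc_of_invLen (by omega), m2.asc_of_invLen (by omega)⟩

lemma adjacent_of_abs {i j : ℤ} (hij : |i - j| = 1) : j = i + 1 ∨ i = j + 1 := by
  rcases abs_eq (by norm_num : (0 : ℤ) ≤ 1) |>.1 hij with h | h <;> omega

lemma braid_mid (hy : Invol y) {i j : ℤ} (hij : |i - j| = 1) (h1 : y i < y (i + 1))
    (h3 : dem j (dem i y) i < dem j (dem i y) (i + 1)) : ¬ Comm (dem i y) j := by
  intro hc
  rw [dem_of_comm (hy.dem i) hc] at h3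
  simp only [Equiv.Perm.mul_apply, Comm] at h3 hc
  have c1 := y.injective.eq_iff (a := i) (b := j)
  have c2 := y.injective.eq_iff (a := i) (b := j + 1)
  have c3 := y.injective.eq_iff (a := i + 1) (b := j)
  have c4 := y.injective.eq_iff (a := i + 1) (b := j + 1)
  have c5 := hy.eq_iff i i
  have c6 := hy.eq_iff (i + 1) (i + 1)
  have c7 := hy.eq_iff i (i + 1)
  have c8 := hy.eq_iff i j
  have c9 := hy.eq_iff i (j + 1)
  have c10 := hy.eq_iff (i + 1) j
  have c11 := hy.eq_iff (i + 1) (j + 1)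
  rcases adjacent_of_abs hij with rfl | rfl
  · have s1 : sPerm i i = i + 1 := by simp [sPerm_apply]
    have s2 : sPerm i (i + 1) = i := by simp [sPerm_apply]
    have s3 : sPerm i (i + 1 + 1) = i + 1 + 1 := by simp [sPerm_apply]; omega
    have s4 : sPerm (i + 1) i = i := by simp [sPerm_apply]; omega
    have s5 : sPerm (i + 1) (i + 1) = i + 1 + 1 := by simp [sPerm_apply]
    rw [s4, s5] at h3
    rw [dem_apply hy, dem_apply hy] at *
    rw [s2, s3] at hc
    rw [s1, s3] at h3
    simp only [sPerm_apply] at hc h3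
    grind
  · have s1 : sPerm (j + 1) (j + 1) = j + 1 + 1 := by simp [sPerm_apply]
    have s2 : sPerm (j + 1) (j + 1 + 1) = j + 1 := by simp [sPerm_apply]
    have s3 : sPerm j (j + 1 + 1) = j + 1 + 1 := by simp [sPerm_apply]; omega
    have s4 : sPerm (j + 1) j = j := by simp [sPerm_apply]; omega
    have s5 : sPerm j (j + 1) = j := by simp [sPerm_apply]
    rw [s5, s3] at h3
    rw [dem_apply hy, dem_apply hy] at *
    rw [s4, s1] at hc
    rw [s4, s2] at h3
    simp only [sPerm_apply] at hc h3
    grind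

lemma braid_transport (hy : Invol y) {i j : ℤ} (hij : |i - j| = 1) (h1 : y i < y (i + 1))
    (hc1 : ¬ Comm y i) (h2 : dem i y j < dem i y (j + 1)) (hc2 : ¬ Comm (dem i y) j) :
    Comm (dem j (dem i y)) i ↔ Comm y j := by
  have e : ∀ i m, sPerm i (sPerm i m) = m := fun i m => by
    rw [← Equiv.Perm.mul_apply, sPerm_mul_self]; rfl
  rw [dem_of_conj (hy.dem i) h2 hc2, dem_of_conj hy h1 hc1]
  have t1 : sPerm i (sPerm j i) = j := by
    rcases adjacent_of_abs hij with rfl | rfl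
    · have s4 : sPerm (i + 1) i = i := by simp [sPerm_apply]; omega
      rw [s4]; simp [sPerm_apply]
    · have s5 : sPerm j (j + 1) = j := by simp [sPerm_apply]
      rw [s5]; simp [sPerm_apply]; omega
  have t2 : sPerm i (sPerm j (i + 1)) = j + 1 := by
    rcases adjacent_of_abs hij with rfl | rfl
    · have s4 : sPerm (i + 1) (i + 1) = i + 1 + 1 := by simp [sPerm_apply]
      rw [s4]; simp [sPerm_apply]; omega
    · have s5 : sPerm j (j + 1 + 1) = j + 1 + 1 := by simp [sPerm_apply]; omega
      rw [s5]; simp [sPerm_apply]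
  have t3 : ∀ a b, sPerm j (sPerm i a) = b ↔ a = sPerm i (sPerm j b) := by
    intro a b
    constructor
    · rintro rfl; rw [e, e]
    · rintro rfl; rw [e, e]
  simp only [Comm, Equiv.Perm.mul_apply, t1, t2, t3]

lemma comm_first_third (hy : Invol y) {i j : ℤ} (hij : |i - j| = 1) (hc1 : Comm y i)
    (h2 : dem i y j < dem i y (j + 1)) (hc2 : ¬ Comm (dem i y) j) :
    ¬ Comm (dem j (dem i y)) i := by
  rw [dem_of_conj (hy.dem i) h2 hc2, dem_of_comm hy hc1]
  rintro ⟨k1, k2⟩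
  simp only [Equiv.Perm.mul_apply] at k1 k2
  obtain ⟨g1, g2⟩ := hc1
  rcases adjacent_of_abs hij with rfl | rfl
  · have s1 : sPerm i i = i + 1 := by simp [sPerm_apply]
    have s4 : sPerm (i + 1) i = i := by simp [sPerm_apply]; omega
    have s5 : sPerm (i + 1) (i + 1) = i + 1 + 1 := by simp [sPerm_apply]
    rw [s4, s1, g2, s5] at k1
    omega
  · have s2 : sPerm (j + 1) (j + 1 + 1) = j + 1 := by simp [sPerm_apply]
    have s3 : sPerm j (j + 1 + 1) = j + 1 + 1 := by simp [sPerm_apply]; omega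
    have s5 : sPerm j (j + 1) = j := by simp [sPerm_apply]
    rw [s3, s2, g1, s5] at k2
    omega

lemma not_comm_both (hy : Invol y) {i j : ℤ} (hij : |i - j| = 1)
    (h3 : dem j (dem i y) i < dem j (dem i y) (i + 1)) : ¬ (Comm y i ∧ Comm y j) := by
  rintro ⟨hc, hd1, hd2⟩
  obtain ⟨hc1, hc2⟩ := hc
  have d : ∀ k, dem i y k = y (sPerm i k) := fun k => by
    rw [dem_of_comm hy ⟨hc1, hc2⟩]; rfl
  rw [dem_apply (hy.dem i), dem_apply (hy.dem i)] at h3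
  simp only [d] at h3
  rcases adjacent_of_abs hij with rfl | rfl
  · have s1 : sPerm i i = i + 1 := by simp [sPerm_apply]
    have s2 : sPerm i (i + 1) = i := by simp [sPerm_apply]
    have s3 : sPerm i (i + 1 + 1) = i + 1 + 1 := by simp [sPerm_apply]; omega
    have s4 : sPerm (i + 1) i = i := by simp [sPerm_apply]; omega
    have s5 : sPerm (i + 1) (i + 1) = i + 1 + 1 := by simp [sPerm_apply]
    have s6 : sPerm (i + 1) (i + 1 + 1) = i + 1 := by simp [sPerm_apply]
    simp only [s1, s2, s3, s4, s5, s6, hc1, hc2, hd2] at h3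
    grind
  · have s1 : sPerm (j + 1) (j + 1) = j + 1 + 1 := by simp [sPerm_apply]
    have s2 : sPerm (j + 1) (j + 1 + 1) = j + 1 := by simp [sPerm_apply]
    have s3 : sPerm j (j + 1 + 1) = j + 1 + 1 := by simp [sPerm_apply]; omega
    have s4 : sPerm (j + 1) j = j := by simp [sPerm_apply]; omega
    have s5 : sPerm j (j + 1) = j := by simp [sPerm_apply]
    have s6 : sPerm j j = j + 1 := by simp [sPerm_apply]
    simp only [s1, s2, s3, s4, s5, s6, hc1, hc2, hd1] at h3
    grind

/-- How commutations move through a braid relation. -/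
lemma comm_braid (h : Nice y) {i j : ℤ} (hij : |i - j| = 1) (h1 : y i < y (i + 1))
    (h2 : dem i y j < dem i y (j + 1))
    (h3 : dem j (dem i y) i < dem j (dem i y) (i + 1)) :
    (Comm y i ↔ Comm (dem i (dem j y)) j) ∧ (Comm (dem j (dem i y)) i ↔ Comm y j) := by
  obtain ⟨k1, k2, k3⟩ := asc_braid h hij h1 h2 h3
  have hji : |j - i| = 1 := by rw [abs_sub_comm]; exact hij
  have m1 := braid_mid h.invol hij h1 h3
  have m2 := braid_mid h.invol hji k1 k3
  have n := not_comm_both h.invol hij h3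
  by_cases c1 : Comm y i
  · have c2 : ¬ Comm y j := fun c2 => n ⟨c1, c2⟩
    exact ⟨(braid_transport h.invol hji k1 c2 k2 m2).symm,
      iff_of_false (comm_first_third h.invol hij c1 h2 m1) c2⟩
  · have t := braid_transport h.invol hij h1 c1 h2 m1
    refine ⟨?_, t⟩
    by_cases c2 : Comm y j
    · exact iff_of_false c1 (comm_first_third h.invol hji c2 k2 m2)
    · exact (braid_transport h.invol hji k1 c2 k2 m2).symm

end local_lemmas

lemma unprimeWord_append (a b : PWord) : unprimeWord (a ++ b) = unprimeWord a ++ unprimeWord b := by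
  simp [unprimeWord]

lemma unprimeWord_cons (x : Letter) (b : PWord) : unprimeWord (x :: b) = x.ceil :: unprimeWord b :=
  rfl

lemma Val.nice {y : Equiv.Perm ℤ} {a : PWord} (hy : Nice y) (h : Val y a) :
    Nice (act y (unprimeWord a)) := (h.invLen hy).1

/-- The local relations satisfied by sets of primed involution words. -/
structure Good (P : PWord → Prop) : Prop where
  far : ∀ {a b : PWord} {x w : Letter}, 2 ≤ |x.ceil - w.ceil| →
    P (a ++ x :: w :: b) → P (a ++ w :: x :: b)
  braid : ∀ {a b : PWord} {X Y : ℤ} {p s : Bool}, |X - Y| = 1 →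
    P (a ++ ⟨X, p⟩ :: ⟨Y, false⟩ :: ⟨X, s⟩ :: b) → P (a ++ ⟨Y, s⟩ :: ⟨X, false⟩ :: ⟨Y, p⟩ :: b)
  ne : ∀ {a b : PWord} {x w : Letter}, P (a ++ x :: w :: b) → x.ceil ≠ w.ceil
  mid : ∀ {a b : PWord} {x w v : Letter}, x.ceil = v.ceil → |x.ceil - w.ceil| = 1 →
    P (a ++ x :: w :: v :: b) → w.primed = false

lemma Good.reverse {P : PWord → Prop} (h : Good P) : Good (fun a => P a.reverse) where
  far := by
    intro a b x w hxw hP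
    simp only [List.reverse_append, List.reverse_cons, List.append_assoc,
      List.nil_append, List.cons_append] at hP ⊢
    exact h.far (by rwa [abs_sub_comm]) hP
  braid := by
    intro a b X Y p s hXY hP
    simp only [List.reverse_append, List.reverse_cons, List.append_assoc,
      List.nil_append, List.cons_append] at hP ⊢
    exact h.braid hXY hP
  ne := by
    intro a b x w hP
    simp only [List.reverse_append, List.reverse_cons, List.append_assoc,
      List.nil_append, List.cons_append] at hP
    exact (h.ne hP).symm
  mid := by
    intro a b x w v hxv hxw hP
    simp only [List.reverse_append, List.reverse_cons, List.append_assoc,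
      List.nil_append, List.cons_append] at hP
    exact h.mid hxv.symm (hxv ▸ hxw) hP

lemma good_RinvPlus (z : Equiv.Perm ℤ) : Good (· ∈ RinvPlus z) where
  far := by
    intro a b x w hxw hP
    simp only [mem_RinvPlus, val_append, unprimeWord_append, act_append, unprimeWord_cons,
      act_cons, Val] at hP ⊢
    obtain ⟨⟨v1, h1, h2, h3, h4, h5⟩, h6⟩ := hP
    have hy := (v1.nice nice_one).invol
    obtain ⟨k1, k2⟩ := asc_far hy hxw h1 h3
    rw [dem_far (by rwa [abs_sub_comm])] at h5 h6
    exact ⟨⟨v1, k1, fun hp => (comm_far hy hxw).1 (h4 hp), k2,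
      fun hp => (comm_far hy (by rwa [abs_sub_comm])).2 (h2 hp), h5⟩, h6⟩
  braid := by
    intro a b X Y p s hXY hP
    simp only [mem_RinvPlus, val_append, unprimeWord_append, act_append, unprimeWord_cons,
      act_cons, Val] at hP ⊢
    obtain ⟨⟨v1, h1, h2, h3, h4, h5, h7, h8⟩, h6⟩ := hP
    have hy := v1.nice nice_one
    obtain ⟨k1, k2, k3⟩ := asc_braid hy hXY h1 h3 h5
    obtain ⟨c1, c2⟩ := comm_braid hy hXY h1 h3 h5
    rw [dem_braid hXY] at h8 h6
    exact ⟨⟨v1, k1, fun hp => c2.1 (h7 hp), k2, by simp, k3, fun hp => c1.1 (h2 hp), h8⟩, h6⟩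
  ne := by
    intro a b x w hP hxw
    simp only [mem_RinvPlus, val_append, Val] at hP
    obtain ⟨⟨v1, h1, h2, h3, h4⟩, h6⟩ := hP
    rw [← hxw] at h3
    exact dem_self_not_asc (v1.nice nice_one).invol _ h3
  mid := by
    intro a b x w v hxv hxw hP
    simp only [mem_RinvPlus, val_append, Val, ← hxv] at hP
    obtain ⟨⟨v1, h1, h2, h3, h4, h5, h7⟩, h6⟩ := hP
    by_contra hw
    exact braid_mid (v1.nice nice_one).invol hxw h1 h5 (h4 (by simpa using hw))

/-! ### Relations at the beginning of a word -/

lemma comm_one (i : ℤ) : Comm 1 i := ⟨rfl, rfl⟩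

lemma dem_one_eq (i : ℤ) : dem i 1 = sPerm i := by
  rw [dem_of_comm invol_one (comm_one i), one_mul]

/-- Toggling the prime of the first letter. -/
lemma RinvPlus.toggle {z : Equiv.Perm ℤ} {c : ℤ} {p q : Bool} {b : PWord}
    (h : (⟨c, p⟩ : Letter) :: b ∈ RinvPlus z) : (⟨c, q⟩ : Letter) :: b ∈ RinvPlus z := by
  rw [mem_RinvPlus] at h ⊢
  obtain ⟨⟨h1, h2, h3⟩, h4⟩ := h
  exact ⟨⟨h1, fun _ => comm_one c, h3⟩, h4⟩

lemma dem_dem_one_adj {i j : ℤ} (hij : |i - j| = 1) : dem i (dem j 1) = dem j (dem i 1) := by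
  have e : ∀ i, dem (i + 1) (dem i 1) = dem i (dem (i + 1) 1) := by
    intro i
    have hc1 : dem i 1 i < dem i 1 (i + 1 + 1) := by
      rw [dem_one_eq]; simp [sPerm_apply]; grind
    have i1 : Invol (dem i 1) := invol_one.dem i
    have i2 : Invol (dem (i + 1) 1) := invol_one.dem (i + 1)
    ext k
    rw [dem_apply i1, dem_apply i2]
    simp only [dem_one_eq]
    simp only [sPerm_apply]
    grind
  rcases adjacent_of_abs hij with rfl | rfl
  · exact (e i).symm
  · exact e j

lemma RinvPlus.swap_first {z : Equiv.Perm ℤ} {d w : ℤ} {p q : Bool} {b : PWord}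
    (h : (⟨d, q⟩ : Letter) :: ⟨w, p⟩ :: b ∈ RinvPlus z) :
    (⟨w, q⟩ : Letter) :: ⟨d, p⟩ :: b ∈ RinvPlus z := by
  have hne : d ≠ w := (good_RinvPlus z).ne (a := []) h
  by_cases hfar : 2 ≤ |d - w|
  · have h' := (good_RinvPlus z).far (a := []) (x := ⟨d, q⟩) (w := ⟨w, p⟩) hfar h
    rw [List.nil_append, mem_RinvPlus] at h'
    rw [mem_RinvPlus] at h ⊢
    obtain ⟨⟨h1, h2, h3, h4, h5⟩, h6⟩ := h'
    obtain ⟨⟨k1, k2, k3, k4, k5⟩, k6⟩ := h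
    exact ⟨⟨h1, fun _ => comm_one w, h3,
      fun _ => (comm_far invol_one (by rwa [abs_sub_comm])).2 (comm_one d), h5⟩, h6⟩
  · have hadj : |d - w| = 1 := by
      have h0 : 0 < |d - w| := abs_pos.2 (sub_ne_zero.2 hne)
      omega
    rw [mem_RinvPlus] at h ⊢
    simp only [Val, unprimeWord_cons, act_cons] at h ⊢
    obtain ⟨⟨k1, k2, k3, k4, k5⟩, k6⟩ := h
    have hadj' : |w - d| = 1 := by rwa [abs_sub_comm]
    rw [dem_dem_one_adj hadj'] at k5 k6
    have hp : p ≠ true := by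
      intro hp
      have := k4 hp
      simp only [Comm, dem_one_eq, sPerm_apply] at this
      rcases adjacent_of_abs hadj with rfl | rfl <;> grind
    refine ⟨⟨by simp, fun _ => comm_one w, ?_, fun h => absurd h hp, k5⟩, k6⟩
    rw [dem_one_eq]
    simp only [sPerm_apply]
    rcases adjacent_of_abs hadj with rfl | rfl <;> grind

/-- The word `m, m+1, m` is not reduced at the beginning of a word. -/
lemma RinvPlus.not_palindrome {z : Equiv.Perm ℤ} {x w v : Letter} {b : PWord}
    (hxv : x.ceil = v.ceil) (hxw : |x.ceil - w.ceil| = 1) : x :: w :: v :: b ∉ RinvPlus z := by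
  intro h
  rw [mem_RinvPlus] at h
  simp only [Val, ← hxv] at h
  obtain ⟨⟨k1, k2, k3, k4, k5, -⟩, -⟩ := h
  rw [dem_dem_one_adj (by rwa [abs_sub_comm])] at k5
  exact dem_self_not_asc (invol_one.dem _) _ k5

/-- A relation for words beginning with `m, m+2, m+1, m`. -/
lemma RinvPlus.front_braid {z : Equiv.Perm ℤ} {m : ℤ} {s : Bool} {b : PWord} :
    (⟨m, false⟩ : Letter) :: ⟨m + 2, false⟩ :: ⟨m + 1, false⟩ :: ⟨m, s⟩ :: b ∈ RinvPlus z ↔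
    (⟨m, false⟩ : Letter) :: ⟨m + 1, s⟩ :: ⟨m + 2, false⟩ :: ⟨m + 1, false⟩ :: b ∈ RinvPlus z := by
  have G := good_RinvPlus z
  constructor
  · intro h
    have h := G.far (a := []) (by norm_num) h
    have h := G.braid (a := [⟨m + 2, false⟩]) (X := m) (Y := m + 1) (by norm_num) h
    have h := RinvPlus.swap_first h
    have h := G.far (a := [⟨m + 1, false⟩]) (by norm_num) h
    have h := RinvPlus.swap_first h
    have hs := G.mid (a := [⟨m, false⟩]) (by rfl) (by norm_num) h
    dsimp at hs
    subst hs
    exact h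
  · intro h
    have h := RinvPlus.swap_first h
    have h := G.far (a := [⟨m + 1, false⟩]) (by norm_num) h
    have h := RinvPlus.swap_first h
    have hs := G.mid (a := [⟨m + 2, false⟩]) (by rfl) (by norm_num) h
    dsimp at hs
    subst hs
    have h := G.braid (a := [⟨m + 2, false⟩]) (X := m + 1) (Y := m) (by norm_num) h
    exact G.far (a := []) (by norm_num) h

/-! ### Finiteness -/

lemma finite_RinvPlus_length (n : ℕ) (z : Equiv.Perm ℤ) :
    {a | a ∈ RinvPlus z ∧ a.length = n}.Finite := by
  induction n generalizing z with
  | zero =>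
    refine (Set.finite_singleton []).subset ?_
    rintro a ⟨-, ha⟩
    simpa using ha
  | succ n ih =>
    by_cases hz : (movedSet z).Finite
    · let I : Set ℤ := movedSet z ∪ (fun x => x - 1) '' movedSet z
      have hI : I.Finite := hz.union (hz.image _)
      have hfin : (⋃ i ∈ I, ⋃ y ∈ ({sPerm i * z * sPerm i, z * sPerm i} : Set (Equiv.Perm ℤ)),
          (fun q : PWord × Bool => q.1 ++ [⟨i, q.2⟩]) ''
            ({a | a ∈ RinvPlus y ∧ a.length = n} ×ˢ Set.univ)).Finite := by
        refine hI.biUnion fun i _ => Set.Finite.biUnion (by simp) fun y _ => ?_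
        exact ((ih y).prod Set.finite_univ).image _
      refine hfin.subset ?_
      rintro a ⟨ha, hl⟩
      obtain ⟨b, x, rfl⟩ : ∃ b x, a = b ++ [x] :=
        ⟨a.dropLast, a.getLast (List.ne_nil_of_length_eq_add_one hl),
          (List.dropLast_append_getLast _).symm⟩
      have hb : b.length = n := by simpa using hl
      rw [mem_RinvPlus, val_append, unprimeWord_append, act_append] at ha
      obtain ⟨⟨v1, h1, -⟩, h4⟩ := ha
      set y := act 1 (unprimeWord b) with hy
      have hyi : Invol y := (v1.nice nice_one).invol
      change dem x.ceil y = z at h4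
      have hd := dem_self_not_asc hyi x.ceil
      rw [h4] at hd
      simp only [Set.mem_iUnion]
      refine ⟨x.ceil, ?_, y, ?_, (b, x.primed), ⟨⟨?_, hb⟩, trivial⟩, rfl⟩
      · by_contra hn
        simp only [I, movedSet, Set.mem_union, Set.mem_ofPred_eq, Set.mem_image, not_or,
          not_not, not_exists, not_and] at hn
        have := hn.2 (x.ceil + 1)
        rw [hn.1] at hd
        have h7 : z (x.ceil + 1) = x.ceil + 1 := by
          by_contra h8
          exact this h8 (by ring)
        omega
      · have e := sPerm_mul_self x.ceil
        by_cases hc : Comm y x.ceil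
        · rw [dem_of_comm hyi hc] at h4
          right
          rw [← h4, mul_assoc, e, mul_one]
          rfl
        · rw [dem_of_conj hyi h1 hc] at h4
          left
          rw [← h4]
          simp only [mul_assoc]
          rw [e, mul_one, ← mul_assoc, e, one_mul]
      · rw [mem_RinvPlus]
        exact ⟨v1, hy.symm⟩
    · refine Set.Finite.subset Set.finite_empty ?_
      rintro a ⟨ha, -⟩
      rw [mem_RinvPlus] at ha
      exact hz (ha.2 ▸ (ha.1.nice nice_one).finMoved)

lemma finite_RinvPlus (z : Equiv.Perm ℤ) : (RinvPlus z).Finite := by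
  refine (finite_RinvPlus_length (invLen z / 4) z).subset fun a ha => ⟨ha, ?_⟩
  have := length_of_mem_RinvPlus ha
  omega

/-! ### Words read off from labelled boxes -/

def Far (x y : Letter) : Prop := 2 ≤ |x.ceil - y.ceil|

lemma Far.symm {x y : Letter} (h : Far x y) : Far y x := by
  unfold Far at *; rwa [abs_sub_comm]

lemma far_of_le {x y : Letter} (h : x.ceil + 2 ≤ y.ceil) : Far x y := by
  unfold Far; rw [le_abs]; right; omega

section words

variable {P : PWord → Prop}

lemma Good.commute_one (hP : Good P) (x : Letter) (Y : PWord) (a b : PWord)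
    (h : ∀ y ∈ Y, Far x y) (H : P (a ++ x :: (Y ++ b))) : P (a ++ (Y ++ x :: b)) := by
  induction Y generalizing a with
  | nil => simpa using H
  | cons y Y ih =>
    have h1 := hP.far (h y (by simp)) (by simpa using H)
    have h2 := ih (a ++ [y]) (fun z hz => h z (by simp [hz])) (by simpa using h1)
    simpa using h2

lemma Good.commute_block (hP : Good P) (X Y : PWord) (a b : PWord)
    (h : ∀ x ∈ X, ∀ y ∈ Y, Far x y) (H : P (a ++ (X ++ (Y ++ b)))) :
    P (a ++ (Y ++ (X ++ b))) := by
  induction X generalizing a with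
  | nil => simpa using H
  | cons x X ih =>
    have h1 := ih (a ++ [x]) (fun z hz => h z (by simp [hz])) (by simpa using H)
    have h2 := hP.commute_one x Y a (X ++ b) (h x (by simp)) (by simpa using h1)
    simpa using h2

lemma Good.reorder (hP : Good P) {ι : Type*} (g : ι → PWord) (l' l : List ι) (pre : PWord)
    (hp : l.Perm l') (h : ∀ x y, [x, y].Sublist l → [y, x].Sublist l' → ∀ u ∈ g x, ∀ v ∈ g y, Far u v)
    (H : P (pre ++ l.flatMap g)) : P (pre ++ l'.flatMap g) := by
  induction l' generalizing l pre with
  | nil => simpa [List.perm_nil.1 hp] using H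
  | cons y t ih =>
    obtain ⟨A, B, rfl⟩ := List.append_of_mem (hp.symm.subset (List.mem_cons_self))
    have hp' : (A ++ B).Perm t := (List.perm_middle.symm.trans hp).cons_inv
    simp only [List.flatMap_append, List.flatMap_cons] at H ⊢
    have h1 := hP.commute_block _ _ _ _ (fun u hu v hv => by
      obtain ⟨x, hx, hux⟩ := List.mem_flatMap.1 hu
      refine h x y ?_ ?_ u hux v hv
      · exact List.Sublist.append (List.singleton_sublist.2 hx)
          (List.singleton_sublist.2 (List.mem_cons_self (l := B)))
      · exact List.Sublist.cons_cons _ (List.singleton_sublist.2 (hp'.subset (by simp [hx])))) H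
    rw [← List.append_assoc]
    refine ih (A ++ B) (pre ++ g y) hp' ?_ (by simpa using h1)
    intro x z hx hz
    refine h x z (hx.trans ?_) (hz.trans (List.sublist_cons_self _ _))
    exact List.Sublist.append (List.Sublist.refl _) (List.sublist_cons_self _ _)

abbrev Box := ℕ × ℕ

abbrev Key := ℤ ×ₗ ℤ

def extKey (κ : Box → Key) (k : Key) : Option (Box × Letter) → Key
  | none => k
  | some x => κ x.1

def extWord (X : PWord) : Option (Box × Letter) → PWord
  | none => X
  | some x => [x.2]

/-- `Word P G κ k X`: the predicate `P` holds for the word obtained by reading the labelled boxes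
of `G` in the order of their keys, inserting the word `X` at the key `k`. -/
def Word (P : PWord → Prop) (G : Set (Box × Letter)) (κ : Box → Key) (k : Key) (X : PWord) :
    Prop :=
  ∃ l : List (Option (Box × Letter)), l.Pairwise (fun a b => extKey κ k a < extKey κ k b) ∧
    (∀ o, o ∈ l ↔ (o = none ∨ ∃ x ∈ G, o = some x)) ∧ P (l.flatMap (extWord X))

variable {G : Set (Box × Letter)} {κ κ' : Box → Key} {k k' : Key} {X : PWord}

lemma nodup_of_pairwise_lt {α β : Type*} [Preorder β] {f : α → β} {l : List α}
    (h : l.Pairwise (fun a b => f a < f b)) : l.Nodup :=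
  h.imp fun hab => by rintro rfl; exact lt_irrefl _ hab

lemma rel_of_pair_sublist {α : Type*} {R : α → α → Prop} {l : List α} {x y : α}
    (h : l.Pairwise R) (hs : [x, y].Sublist l) : R x y := by
  have := h.sublist hs
  simpa using this

lemma Word.move (hP : Good P) (h : Word P G κ k X) (κ' : Box → Key) (k' : Key)
    (hinj : ∀ x ∈ G, ∀ y ∈ G, κ' x.1 = κ' y.1 → x = y) (hk' : ∀ x ∈ G, κ' x.1 ≠ k')
    (hbox : ∀ x ∈ G, ∀ y ∈ G, κ x.1 < κ y.1 → κ' y.1 < κ' x.1 → Far x.2 y.2)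
    (hX : ∀ x ∈ G, (κ x.1 < k ∧ k' < κ' x.1 ∨ k < κ x.1 ∧ κ' x.1 < k') → ∀ u ∈ X, Far x.2 u) :
    Word P G κ' k' X := by
  obtain ⟨l, h1, h2, h3⟩ := h
  let r : Option (Box × Letter) → Option (Box × Letter) → Prop :=
    fun a b => extKey κ' k' a ≤ extKey κ' k' b
  have : DecidableRel r := fun a b => inferInstanceAs (Decidable (_ ≤ _))
  have : Std.Total r := ⟨fun a b => le_total _ _⟩
  have : IsTrans _ r := ⟨fun a b c hab hbc => le_trans (α := Key) hab hbc⟩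
  have hperm := List.perm_insertionSort r l
  have hs := List.pairwise_insertionSort r l
  have hnd : (l.insertionSort r).Nodup := hperm.symm.nodup (nodup_of_pairwise_lt h1)
  have hmem : ∀ o, o ∈ l.insertionSort r ↔ (o = none ∨ ∃ x ∈ G, o = some x) := fun o => by
    rw [← h2, hperm.mem_iff]
  have hlt : (l.insertionSort r).Pairwise (fun a b => extKey κ' k' a < extKey κ' k' b) := by
    refine (hs.and hnd).imp_of_mem ?_
    rintro a b ha hb ⟨hab, hne⟩
    refine lt_of_le_of_ne hab fun he => hne ?_
    rcases (hmem a).1 ha with rfl | ⟨x, hx, rfl⟩ <;> rcases (hmem b).1 hb with rfl | ⟨y, hy, rfl⟩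
    · rfl
    · exact absurd he.symm (hk' y hy)
    · exact absurd he (hk' x hx)
    · rw [hinj x hx y hy he]
  refine ⟨l.insertionSort r, hlt, hmem, ?_⟩
  refine hP.reorder (extWord X) _ l [] hperm.symm ?_ h3
  intro a b hab hba
  have l1 := rel_of_pair_sublist h1 hab
  have l2 := rel_of_pair_sublist hlt hba
  have ha := (h2 a).1 (hab.subset (by simp))
  have hb := (h2 b).1 (hab.subset (by simp))
  rcases ha with rfl | ⟨x, hx, rfl⟩ <;> rcases hb with rfl | ⟨y, hy, rfl⟩
  · exact absurd l1 (lt_irrefl _)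
  · intro u hu v hv
    simp only [extWord, List.mem_singleton] at hu hv
    subst hv
    exact (hX y hy (Or.inr ⟨l1, l2⟩) u hu).symm
  · intro u hu v hv
    simp only [extWord, List.mem_singleton] at hu hv
    subst hu
    exact hX x hx (Or.inl ⟨l1, l2⟩) v hv
  · intro u hu v hv
    simp only [extWord, List.mem_singleton] at hu hv
    subst hu hv
    exact hbox x hx y hy l1 l2

lemma Word.exists_split (h : Word P G κ k X) : ∃ A B : List (Box × Letter),
    A.Pairwise (fun a b => κ a.1 < κ b.1) ∧ B.Pairwise (fun a b => κ a.1 < κ b.1) ∧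
    (∀ a ∈ A, κ a.1 < k) ∧ (∀ b ∈ B, k < κ b.1) ∧ (∀ x, x ∈ G ↔ x ∈ A ∨ x ∈ B) ∧
    P (A.map Prod.snd ++ (X ++ B.map Prod.snd)) := by
  obtain ⟨l, h1, h2, h3⟩ := h
  obtain ⟨A', B', rfl⟩ := List.append_of_mem ((h2 none).2 (Or.inl rfl))
  have hnd := nodup_of_pairwise_lt h1
  rw [List.pairwise_append, List.pairwise_cons] at h1
  obtain ⟨hA, ⟨hkB, hB⟩, hAB⟩ := h1
  have key : ∀ C : List (Option (Box × Letter)), none ∉ C →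
      ∃ D : List (Box × Letter), C = D.map some := by
    intro C hC
    induction C with
    | nil => exact ⟨[], rfl⟩
    | cons c C ih =>
      simp only [List.mem_cons, not_or] at hC
      obtain ⟨D, rfl⟩ := ih hC.2
      obtain ⟨d, rfl⟩ := Option.ne_none_iff_exists'.1 (Ne.symm hC.1)
      exact ⟨d :: D, rfl⟩
  obtain ⟨A, rfl⟩ := key A' fun hn => lt_irrefl _ (hAB none hn none (by simp))
  obtain ⟨B, rfl⟩ := key B' fun hn => lt_irrefl _ (hkB none hn)
  refine ⟨A, B, by simpa [List.pairwise_map, extKey] using hA, by simpa [List.pairwise_map, extKey] using hB, fun a ha => ?_, fun b hb => ?_,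
    fun x => ?_, ?_⟩
  · exact hAB (some a) (List.mem_map_of_mem ha) none (by simp)
  · exact hkB (some b) (List.mem_map_of_mem hb)
  · have := h2 (some x)
    simpa using this.symm
  · simpa [List.flatMap_append, List.flatMap_cons, extWord, List.flatMap_map,
      ← List.map_eq_flatMap] using h3

lemma word_of_split {A B : List (Box × Letter)}
    (hA : A.Pairwise (fun a b => κ a.1 < κ b.1)) (hB : B.Pairwise (fun a b => κ a.1 < κ b.1))
    (hAk : ∀ a ∈ A, κ a.1 < k) (hkB : ∀ b ∈ B, k < κ b.1) (hG : ∀ x, x ∈ G ↔ x ∈ A ∨ x ∈ B)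
    (H : P (A.map Prod.snd ++ (X ++ B.map Prod.snd))) : Word P G κ k X := by
  refine ⟨A.map some ++ none :: B.map some, ?_, ?_, ?_⟩
  · rw [List.pairwise_append, List.pairwise_cons, List.pairwise_map, List.pairwise_map]
    refine ⟨hA, ⟨?_, hB⟩, ?_⟩
    · intro b hb
      obtain ⟨b, hb', rfl⟩ := List.mem_map.1 hb
      exact hkB b hb'
    · intro a ha b hb
      obtain ⟨a, ha', rfl⟩ := List.mem_map.1 ha
      rcases List.mem_cons.1 hb with rfl | hb
      · exact hAk a ha'
      · obtain ⟨b, hb', rfl⟩ := List.mem_map.1 hb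
        exact (hAk a ha').trans (hkB b hb')
  · intro o
    cases o with
    | none => simp
    | some x => simp [hG]
  · simpa [List.flatMap_append, List.flatMap_cons, extWord, List.flatMap_map,
      ← List.map_eq_flatMap] using H

lemma Word.mono {X' : PWord} (h : Word P G κ k X)
    (H : ∀ a b, P (a ++ (X ++ b)) → P (a ++ (X' ++ b))) : Word P G κ k X' := by
  obtain ⟨A, B, h1, h2, h3, h4, h5, h6⟩ := h.exists_split
  exact word_of_split h1 h2 h3 h4 h5 (H _ _ h6)

lemma word_emit_right {p : Box} {x : Letter} (hn : (p, x) ∉ G) (hk : k < κ p)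
    (hG : ∀ y ∈ G, k < κ y.1 → κ p < κ y.1) :
    Word P (insert (p, x) G) κ k X ↔ Word P G κ k (X ++ [x]) := by
  constructor
  · intro h
    obtain ⟨A, B, h1, h2, h3, h4, h5, h6⟩ := h.exists_split
    have hB : (p, x) ∈ B := by
      rcases (h5 (p, x)).1 (by simp) with h | h
      · exact absurd (h3 _ h) hk.asymm
      · exact h
    obtain ⟨C, D, rfl⟩ := List.append_of_mem hB
    rw [List.pairwise_append, List.pairwise_cons] at h2
    obtain ⟨-, ⟨g1, g2⟩, g3⟩ := h2
    have hC : C = [] := by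
      rw [List.eq_nil_iff_forall_not_mem]
      intro c hc
      have c1 := g3 c hc (p, x) (by simp)
      have c2 := h4 c (by simp [hc])
      have c3 : c ∈ insert (p, x) G := (h5 c).2 (Or.inr (by simp [hc]))
      rcases c3 with rfl | c3
      · exact lt_irrefl _ c1
      · exact absurd (hG c c3 c2) c1.asymm
    subst hC
    refine word_of_split h1 g2 h3 (fun b hb => h4 b (by simp [hb])) (fun y => ?_)
      (by simpa using h6)
    have := h5 y
    by_cases hy : y = (p, x)
    · subst hy
      refine iff_of_false hn ?_
      rintro (h | h)
      · exact absurd (h3 _ h) hk.asymm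
      · exact lt_irrefl _ (g1 _ h)
    · simpa [hy] using this
  · intro h
    obtain ⟨A, B, h1, h2, h3, h4, h5, h6⟩ := h.exists_split
    refine word_of_split (B := (p, x) :: B) h1 (List.pairwise_cons.2 ⟨fun b hb => ?_, h2⟩) h3 ?_
      (fun y => ?_) (by simpa using h6)
    · exact hG b ((h5 b).2 (Or.inr hb)) (h4 b hb)
    · intro b hb
      rcases List.mem_cons.1 hb with rfl | hb
      · exact hk
      · exact h4 b hb
    · simp only [Set.mem_insert_iff, h5, List.mem_cons]
      tauto

lemma word_reverse (hr : ∀ x ∈ G, ∀ y ∈ G, κ x.1 < κ y.1 → κ' y.1 < κ' x.1)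
    (hl : ∀ x ∈ G, κ x.1 < k → k' < κ' x.1) (hg : ∀ x ∈ G, k < κ x.1 → κ' x.1 < k')
    (h : Word P G κ k X) : Word (fun a => P a.reverse) G κ' k' X.reverse := by
  obtain ⟨A, B, h1, h2, h3, h4, h5, h6⟩ := h.exists_split
  refine word_of_split (A := B.reverse) (B := A.reverse) ?_ ?_ ?_ ?_ ?_ ?_
  · rw [List.pairwise_reverse]
    exact h2.imp_of_mem fun {a b} ha hb hab =>
      hr a ((h5 a).2 (Or.inr ha)) b ((h5 b).2 (Or.inr hb)) hab
  · rw [List.pairwise_reverse]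
    exact h1.imp_of_mem fun {a b} ha hb hab =>
      hr a ((h5 a).2 (Or.inl ha)) b ((h5 b).2 (Or.inl hb)) hab
  · intro a ha
    rw [List.mem_reverse] at ha
    exact hg a ((h5 a).2 (Or.inr ha)) (h4 a ha)
  · intro a ha
    rw [List.mem_reverse] at ha
    exact hl a ((h5 a).2 (Or.inl ha)) (h3 a ha)
  · intro x
    simp only [List.mem_reverse, h5]
    tauto
  · simpa [List.map_reverse] using h6

lemma word_emit_left {p : Box} {x : Letter} (hn : (p, x) ∉ G) (hk : κ p < k)
    (hG : ∀ y ∈ G, κ y.1 < k → κ y.1 < κ p) :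
    Word P (insert (p, x) G) κ k X ↔ Word P G κ k (x :: X) := by
  have neg_lt : ∀ a b : Key, a < b →
      (toLex (-(ofLex b).1, -(ofLex b).2) : Key) < toLex (-(ofLex a).1, -(ofLex a).2) := by
    intro a b hab
    rw [Prod.Lex.lt_iff] at hab ⊢
    simp only [ofLex_toLex]
    omega
  let N : Key → Key := fun a => toLex (-(ofLex a).1, -(ofLex a).2)
  have hNN : ∀ a, N (N a) = a := fun a => by simp [N]
  have hN : ∀ a b : Key, N a < N b ↔ b < a := by
    refine fun a b => ⟨fun h => ?_, fun h => neg_lt _ _ h⟩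
    have := neg_lt _ _ h
    change N (N b) < N (N a) at this
    rwa [hNN, hNN] at this
  have key : ∀ (P : PWord → Prop) (G : Set (Box × Letter)) (X : PWord),
      Word P G κ k X ↔ Word (fun a => P a.reverse) G (fun q => N (κ q)) (N k) X.reverse := by
    intro P G X
    constructor
    · exact word_reverse (fun x _ y _ h => (hN _ _).2 h) (fun x _ h => (hN _ _).2 h)
        (fun x _ h => (hN _ _).2 h)
    · intro h
      have := word_reverse (κ' := κ) (k' := k) (fun x _ y _ h => (hN _ _).1 h)
        (fun x _ h => (hN _ _).1 h) (fun x _ h => (hN _ _).1 h) h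
      simpa using this
  rw [key, key P G (x :: X), word_emit_right hn ((hN _ _).2 hk)
    (fun y hy h => (hN _ _).2 (hG y hy ((hN _ _).1 h)))]
  simp

lemma word_swap {κ : Box → Key} :
    Word P G κ k X ↔ Word P {x | (x.1.swap, x.2) ∈ G} (fun p => κ p.swap) k X := by
  have key : ∀ (G : Set (Box × Letter)) (κ : Box → Key), Word P G κ k X →
      Word P {x | (x.1.swap, x.2) ∈ G} (fun p => κ p.swap) k X := by
    intro G κ h
    obtain ⟨A, B, h1, h2, h3, h4, h5, h6⟩ := h.exists_split
    let s : Box × Letter → Box × Letter := fun x => (x.1.swap, x.2)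
    have hs : ∀ x, s (s x) = x := fun x => by simp [s]
    refine word_of_split (A := A.map s) (B := B.map s) ?_ ?_ ?_ ?_ ?_ ?_
    · rw [List.pairwise_map]; simpa [s] using h1
    · rw [List.pairwise_map]; simpa [s] using h2
    · intro a ha
      obtain ⟨a, ha', rfl⟩ := List.mem_map.1 ha
      simpa [s] using h3 a ha'
    · intro a ha
      obtain ⟨a, ha', rfl⟩ := List.mem_map.1 ha
      simpa [s] using h4 a ha'
    · intro x
      have e : ∀ L : List (Box × Letter), x ∈ L.map s ↔ s x ∈ L := by
        intro L
        rw [List.mem_map]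
        exact ⟨by rintro ⟨a, ha, rfl⟩; rwa [hs], fun h => ⟨s x, h, hs x⟩⟩
      rw [e, e]
      exact h5 (s x)
    · simpa [s, Function.comp_def] using h6
  refine ⟨key G κ, fun h => ?_⟩
  simpa using key _ _ h

end words

/-! ### Inserting a letter into a line of an increasing array -/

abbrev Tab := ℕ → ℕ → Option Letter

def graph (F : Tab) : Set (Box × Letter) := {x | F x.1.1 x.1.2 = some x.2}

/-- Change the value of `F` at `(i, j)`. -/
def upd (F : Tab) (i j : ℕ) (x : Option Letter) : Tab :=
  fun a b => if a = i ∧ b = j then x else F a b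

lemma upd_self (F : Tab) (i j : ℕ) (x : Option Letter) : upd F i j x i j = x := by simp [upd]

lemma upd_of_ne {F : Tab} {i j a b : ℕ} {x : Option Letter} (h : ¬ (a = i ∧ b = j)) :
    upd F i j x a b = F a b := by rw [upd, if_neg h]

lemma upd_upd (F : Tab) (i j : ℕ) (x y : Option Letter) : upd (upd F i j x) i j y = upd F i j y := by
  funext a b; simp only [upd]; split_ifs <;> rfl

lemma upd_eq_self {F : Tab} {i j : ℕ} {x : Option Letter} (h : F i j = x) : upd F i j x = F := by
  funext a b; simp only [upd]; split_ifs with h'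
  · rw [h'.1, h'.2, h]
  · rfl

def rowKey (p : Box) : Key := toLex (2 * (p.1 : ℤ), -2 * (p.2 : ℤ))

/-- The threshold before line `i`. -/
def thr (i : ℕ) : Key := toLex (2 * (i : ℤ) - 1, 0)

/-- The threshold just before the box `(i, j)`. -/
def kb (i j : ℕ) : Key := toLex (2 * (i : ℤ), -2 * (j : ℤ) - 1)

/-- The threshold just after the box `(i, j)`. -/
def ka (i j : ℕ) : Key := toLex (2 * (i : ℤ), -2 * (j : ℤ) + 1)

lemma ka_succ (i j : ℕ) : ka i (j + 1) = kb i j := by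
  unfold ka kb; congr 2; push_cast; ring

lemma key_lt {a b c d : ℤ} : (toLex (a, b) : Key) < toLex (c, d) ↔ a < c ∨ a = c ∧ b < d := by
  rw [Prod.Lex.lt_iff]; rfl

lemma key_eq {a b c d : ℤ} : (toLex (a, b) : Key) = toLex (c, d) ↔ a = c ∧ b = d := by
  rw [toLex_inj, Prod.mk.injEq]

def Inc (F : Tab) : Prop := ∀ i j i' j' x y, F i j = some x → F i' j' = some y → i ≤ i' → j ≤ j' →
  ¬ (i = i' ∧ j = j') → x.ceil < y.ceil

def Conv (F : Tab) : Prop := ∀ i j j' j'', F i j ≠ none → F i j'' ≠ none → j ≤ j' → j' ≤ j'' →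
  F i j' ≠ none

section line

variable {P : PWord → Prop} {F : Tab} {i j : ℕ} {k k' : Key} {X : PWord}

lemma mem_graph {p : Box} {x : Letter} : (p, x) ∈ graph F ↔ F p.1 p.2 = some x := Iff.rfl

lemma graph_eq_insert {x : Letter} (h : F i j = some x) :
    graph F = insert ((i, j), x) (graph (upd F i j none)) := by
  ext ⟨⟨a, b⟩, y⟩
  simp only [mem_graph, Set.mem_insert_iff, Prod.mk.injEq, upd]
  split_ifs with hab
  · obtain ⟨rfl, rfl⟩ := hab
    simp [h, eq_comm]
  · simp [hab]

lemma word_kb (x : Letter) (h : F i j = some x) :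
    Word P (graph F) rowKey (kb i j) X ↔
      Word P (graph (upd F i j none)) rowKey (kb i j) (X ++ [x]) := by
  rw [graph_eq_insert h]
  refine word_emit_right (by simp [mem_graph, upd]) ?_ ?_
  · exact key_lt.2 (Or.inr ⟨rfl, by dsimp only; omega⟩)
  · rintro ⟨⟨a, b⟩, y⟩ hy hlt
    simp only [mem_graph] at hy
    have hne : ¬ (a = i ∧ b = j) := fun hab => by simp [upd, hab] at hy
    simp only [kb, rowKey, key_lt] at hlt ⊢
    omega

lemma word_ka (x : Letter) (h : F i j = some x) :
    Word P (graph F) rowKey (ka i j) X ↔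
      Word P (graph (upd F i j none)) rowKey (ka i j) (x :: X) := by
  rw [graph_eq_insert h]
  refine word_emit_left (by simp [mem_graph, upd]) ?_ ?_
  · exact key_lt.2 (Or.inr ⟨rfl, by dsimp only; omega⟩)
  · rintro ⟨⟨a, b⟩, y⟩ hy hlt
    simp only [mem_graph] at hy
    have hne : ¬ (a = i ∧ b = j) := fun hab => by simp [upd, hab] at hy
    simp only [ka, rowKey, key_lt] at hlt ⊢
    omega

lemma Word.moveThr (hP : Good P) (h : Word P (graph F) rowKey k X) (k' : Key)
    (hne : ∀ a b x, F a b = some x → rowKey (a, b) ≠ k')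
    (hfar : ∀ a b x, F a b = some x → (rowKey (a, b) < k ∧ k' < rowKey (a, b) ∨
      k < rowKey (a, b) ∧ rowKey (a, b) < k') → ∀ u ∈ X, Far x u) :
    Word P (graph F) rowKey k' X := by
  refine h.move hP rowKey k' ?_ ?_ ?_ ?_
  · rintro ⟨⟨a, b⟩, x⟩ hx ⟨⟨c, d⟩, y⟩ hy hxy
    simp only [rowKey, key_eq] at hxy
    obtain rfl : a = c := by omega
    obtain rfl : b = d := by omega
    rw [mem_graph] at hx hy
    rw [hx] at hy
    rw [Option.some.inj hy]
  · rintro ⟨⟨a, b⟩, x⟩ hx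
    exact hne a b x hx
  · intro x _ y _ h1 h2
    exact absurd h1 h2.asymm
  · rintro ⟨⟨a, b⟩, x⟩ hx h'
    exact hfar a b x hx h'

lemma word_thr_kb (hP : Good P) (h : ∀ j' y, j < j' → F i j' = some y → ∀ u ∈ X, Far y u) :
    Word P (graph F) rowKey (thr i) X ↔ Word P (graph F) rowKey (kb i j) X := by
  constructor <;> intro hw <;> refine hw.moveThr hP _ ?_ ?_ <;> intro a b x hx
  · simp only [kb, rowKey, ne_eq, key_eq]; omega
  · intro hlt
    simp only [kb, thr, rowKey, key_lt] at hlt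
    obtain rfl : a = i := by omega
    exact h b x (by omega) hx
  · simp only [thr, rowKey, ne_eq, key_eq]; omega
  · intro hlt
    simp only [kb, thr, rowKey, key_lt] at hlt
    obtain rfl : a = i := by omega
    exact h b x (by omega) hx

lemma word_ka_thr (hP : Good P) (h : ∀ j' y, j' < j → F i j' = some y → ∀ u ∈ X, Far y u) :
    Word P (graph F) rowKey (ka i j) X ↔ Word P (graph F) rowKey (thr (i + 1)) X := by
  constructor <;> intro hw <;> refine hw.moveThr hP _ ?_ ?_ <;> intro a b x hx
  · simp only [thr, rowKey, ne_eq, key_eq]; omega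
  · intro hlt
    simp only [ka, thr, rowKey, key_lt] at hlt
    obtain rfl : a = i := by omega
    exact h b x (by omega) hx
  · simp only [ka, rowKey, ne_eq, key_eq]; omega
  · intro hlt
    simp only [ka, thr, rowKey, key_lt] at hlt
    obtain rfl : a = i := by omega
    exact h b x (by omega) hx

lemma word_kb_ka (hP : Good P) (h : F i j = none) :
    Word P (graph F) rowKey (kb i j) X ↔ Word P (graph F) rowKey (ka i j) X := by
  constructor <;> intro hw <;> refine hw.moveThr hP _ ?_ ?_ <;> intro a b x hx
  · simp only [ka, rowKey, ne_eq, key_eq]; omega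
  · intro hlt
    simp only [ka, kb, rowKey, key_lt] at hlt
    obtain rfl : a = i := by omega
    obtain rfl : b = j := by omega
    simp [h] at hx
  · simp only [kb, rowKey, ne_eq, key_eq]; omega
  · intro hlt
    simp only [ka, kb, rowKey, key_lt] at hlt
    obtain rfl : a = i := by omega
    obtain rfl : b = j := by omega
    simp [h] at hx

/-- The plain bump of an entry in line `i`. -/
structure BumpA (F : Tab) (i j : ℕ) (w : Letter) (F' : Tab) (m : Letter) : Prop where
  entry : F i j = some m
  lt : w.ceil < m.ceil
  before : ∀ j' y, j' < j → F i j' = some y → y.ceil < w.ceil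
  after : ∀ j' y, j < j' → F i j' = some y → m.ceil < y.ceil
  eq : F' = upd F i j (some w)

/-- The bump at an entry with the same value as the inserted letter. -/
structure BumpC (F : Tab) (i j : ℕ) (w : Letter) (p : Bool) (F' : Tab) (m : Letter) : Prop where
  entry : F i j = some ⟨w.ceil, p⟩
  next : F i (j + 1) = some ⟨w.ceil + 1, false⟩
  before : ∀ j' y, j' < j → F i j' = some y → y.ceil < w.ceil
  after : ∀ j' y, j + 1 < j' → F i j' = some y → w.ceil + 1 < y.ceil
  eq : F' = upd (upd F i j (some ⟨w.ceil, false⟩)) i (j + 1) (some ⟨w.ceil + 1, p⟩)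
  out : m = ⟨w.ceil + 1, w.primed⟩

lemma BumpA.word {w m : Letter} {F' : Tab} (hP : Good P) (h : BumpA F i j w F' m) :
    Word P (graph F) rowKey (thr i) [w] ↔ Word P (graph F') rowKey (thr (i + 1)) [m] := by
  obtain ⟨h1, h2, h3, h4, rfl⟩ := h
  rw [word_thr_kb (j := j) hP, word_kb m h1, word_kb_ka hP (upd_self _ _ _ _),
    ← word_ka_thr (j := j) hP, word_ka w (upd_self _ _ _ _), upd_upd]
  · rfl
  · intro j' y hj hy u hu
    rw [List.mem_singleton.1 hu]
    rw [upd_of_ne (by omega)] at hy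
    have := h3 j' y hj hy
    exact far_of_le (by omega)
  · intro j' y hj hy u hu
    rw [List.mem_singleton.1 hu]
    have := h4 j' y hj hy
    exact (far_of_le (by omega)).symm

lemma BumpC.word {w m : Letter} {p : Bool} {F' : Tab} (hP : Good P) (h : BumpC F i j w p F' m) :
    Word P (graph F) rowKey (thr i) [w] ↔ Word P (graph F') rowKey (thr (i + 1)) [m] := by
  obtain ⟨h1, h2, h3, h4, rfl, rfl⟩ := h
  set F0 := upd (upd F i (j + 1) none) i j none with hF0
  have e1 : upd F i (j + 1) none i j = some ⟨w.ceil, p⟩ := by rw [upd_of_ne (by omega), h1]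
  have e2 : F0 i j = none := upd_self _ _ _ _
  set F' := upd (upd F i j (some ⟨w.ceil, false⟩)) i (j + 1) (some ⟨w.ceil + 1, p⟩) with hF'
  have e3 : F' i j = some ⟨w.ceil, false⟩ := by rw [hF', upd_of_ne (by omega), upd_self]
  have e4 : upd F' i j none i (j + 1) = some ⟨w.ceil + 1, p⟩ := by
    rw [upd_of_ne (by omega), hF', upd_self]
  have e5 : upd (upd F' i j none) i (j + 1) none = F0 := by
    funext a b
    simp only [hF', hF0, upd]
    split_ifs <;> rfl
  have e6 : upd F i (j + 1) none i (j + 1) = none := upd_self _ _ _ _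
  have e7 : F0 i (j + 1) = none := by rw [hF0, upd_of_ne (by omega), upd_self]
  have e8 : upd F' i j none i j = none := upd_self _ _ _ _
  have braid : ∀ k, Word P (graph F0) rowKey k
      ([w] ++ [⟨w.ceil + 1, false⟩] ++ [⟨w.ceil, p⟩]) ↔ Word P (graph F0) rowKey k
        [⟨w.ceil + 1, p⟩, ⟨w.ceil, false⟩, ⟨w.ceil + 1, w.primed⟩] := fun k =>
    ⟨fun h => h.mono fun a b H => hP.braid (by norm_num) H,
      fun h => h.mono fun a b H => hP.braid (by norm_num) H⟩
  rw [word_thr_kb (j := j + 1) hP, word_kb _ h2, word_kb_ka hP e6, ka_succ, word_kb _ e1,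
    braid, ← ka_succ, ← e5, ← word_ka _ e4, ka_succ, word_kb_ka hP e8, ← word_ka _ e3,
    word_ka_thr hP]
  · intro j' y hj hy u hu
    rw [List.mem_singleton.1 hu]
    rw [hF', upd_of_ne (by omega), upd_of_ne (by omega)] at hy
    have := h3 j' y hj hy
    exact far_of_le (by dsimp; omega)
  · intro j' y hj hy u hu
    rw [List.mem_singleton.1 hu]
    have := h4 j' y hj hy
    exact (far_of_le (by omega)).symm

/-- If the letter inserted in a line already occurs there, then its successor is the next entry. -/
lemma next_of_mem_line (hP : Good P) (hI : Inc F) (hC : Conv F) {w x : Letter}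
    (hw : Word P (graph F) rowKey (thr i) [w]) (hx : F i j = some x) (hxw : x.ceil = w.ceil) :
    F i (j + 1) = some ⟨w.ceil + 1, false⟩ := by
  by_cases hy : ∃ y, F i (j + 1) = some y ∧ y.ceil = w.ceil + 1
  · obtain ⟨y, hy, hyw⟩ := hy
    rw [word_thr_kb (j := j + 1) hP, word_kb _ hy, word_kb_ka hP (upd_self _ _ _ _), ka_succ,
      word_kb x (by rw [upd_of_ne (by omega), hx])] at hw
    · obtain ⟨A, B, -, -, -, -, -, h6⟩ := hw.exists_split
      have := hP.mid (by exact hxw.symm) (by rw [hyw]; norm_num) h6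
      rw [hy, ← hyw, ← this]
    · intro j' z hj hz u hu
      rw [List.mem_singleton.1 hu]
      have := hI _ _ _ _ _ _ hy hz le_rfl hj.le (by omega)
      exact (far_of_le (by omega)).symm
  · rw [word_thr_kb (j := j) hP, word_kb _ hx] at hw
    · obtain ⟨A, B, -, -, -, -, -, h6⟩ := hw.exists_split
      exact absurd hxw.symm (hP.ne h6)
    · intro j' z hj hz u hu
      rw [List.mem_singleton.1 hu]
      obtain ⟨y, hy'⟩ := Option.ne_none_iff_exists'.1
        (hC i j (j + 1) j' (by simp [hx]) (by simp [hz]) (by omega) hj)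
      have h1 := hI _ _ _ _ _ _ hx hy' le_rfl (by omega) (by omega)
      have h2 : y.ceil ≠ w.ceil + 1 := fun h => hy ⟨y, hy', h⟩
      rcases Nat.eq_or_lt_of_le (Nat.succ_le_of_lt hj) with rfl | hj'
      · rw [hy'] at hz
        obtain rfl := Option.some.inj hz
        exact (far_of_le (by omega)).symm
      · have h3 := hI _ _ _ _ _ _ hy' hz le_rfl (by omega) (by omega)
        exact (far_of_le (by omega)).symm

/-- If the letter bumped out of a line still occurs there, then its predecessor is the entry
before it. -/
lemma prev_of_mem_line (hP : Good P) (hI : Inc F) (hC : Conv F) {m x : Letter}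
    (hw : Word P (graph F) rowKey (thr (i + 1)) [m]) (hx : F i j = some x)
    (hxm : x.ceil = m.ceil) :
    ∃ j0, j = j0 + 1 ∧ F i j0 = some ⟨m.ceil - 1, false⟩ := by
  by_cases hy : ∃ j0 y, j = j0 + 1 ∧ F i j0 = some y ∧ y.ceil = m.ceil - 1
  · obtain ⟨j0, y, rfl, hy, hym⟩ := hy
    refine ⟨j0, rfl, ?_⟩
    rw [← word_ka_thr (j := j0) hP, word_ka _ hy, ← word_kb_ka hP (upd_self _ _ _ _), ← ka_succ,
      word_ka x (by rw [upd_of_ne (by omega), hx])] at hw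
    · obtain ⟨A, B, -, -, -, -, -, h6⟩ := hw.exists_split
      have := hP.mid (by exact hxm) (by rw [hym, hxm]; norm_num) h6
      rw [hy, ← hym, ← this]
    · intro j' z hj hz u hu
      rw [List.mem_singleton.1 hu]
      have := hI _ _ _ _ _ _ hz hy le_rfl hj.le (by omega)
      exact far_of_le (by omega)
  · rw [← word_ka_thr (j := j) hP, word_ka _ hx] at hw
    · obtain ⟨A, B, -, -, -, -, -, h6⟩ := hw.exists_split
      exact absurd hxm (hP.ne h6)
    · intro j' z hj hz u hu
      rw [List.mem_singleton.1 hu]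
      obtain ⟨j0, rfl⟩ : ∃ j0, j = j0 + 1 := ⟨j - 1, by omega⟩
      obtain ⟨y, hy'⟩ := Option.ne_none_iff_exists'.1
        (hC i j' j0 (j0 + 1) (by simp [hz]) (by simp [hx]) (by omega) (by omega))
      have h1 := hI _ _ _ _ _ _ hy' hx le_rfl (by omega) (by omega)
      have h2 : y.ceil ≠ m.ceil - 1 := fun h => hy ⟨j0, y, rfl, hy', h⟩
      rcases Nat.eq_or_lt_of_le (Nat.le_of_lt_succ hj) with rfl | hj'
      · rw [hy'] at hz
        obtain rfl := Option.some.inj hz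
        exact far_of_le (by omega)
      · have h3 := hI _ _ _ _ _ _ hz hy' le_rfl (by omega) (by omega)
        exact far_of_le (by omega)

end line

/-! ### Insertion states -/

def tr (E : Tab) : Tab := fun c r => E r c

/-- The array whose lines are the rows (`f = false`) or the columns (`f = true`) of `E`. -/
def lines (f : Bool) (E : Tab) : Tab := if f then tr E else E

lemma lines_lines (f : Bool) (E : Tab) : lines f (lines f E) = E := by cases f <;> rfl

/-- The box in position `j` of line `i`. -/
def bx (f : Bool) (i j : ℕ) : Box := if f then (j, i) else (i, j)

lemma lines_apply (f : Bool) (E : Tab) (i j : ℕ) : lines f E i j = E (bx f i j).1 (bx f i j).2 := by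
  cases f <;> rfl

lemma lines_upd (f : Bool) (E : Tab) (i j : ℕ) (x : Option Letter) :
    lines f (upd E i j x) = upd (lines f E) (bx f i j).1 (bx f i j).2 x := by
  cases f
  · rfl
  · funext a b
    simp only [lines, tr, upd, bx, if_true, and_comm]

lemma lines_upd_lines (f : Bool) (E : Tab) (i j : ℕ) (x : Option Letter) :
    lines f (upd (lines f E) i j x) = upd E (bx f i j).1 (bx f i j).2 x := by
  rw [lines_upd, lines_lines]

structure Ok (E : Tab) : Prop where
  dom : ∀ r c, E r c ≠ none → r ≤ c
  row : ∀ r c c', r ≤ c' → c' ≤ c → E r c ≠ none → E r c' ≠ none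
  col : ∀ r r' c, r' ≤ r → E r c ≠ none → E r' c ≠ none
  inc : Inc E
  diag : ∀ r x, E r r = some x → x.primed = false

lemma Inc.tr {E : Tab} (h : Inc E) : Inc (tr E) := fun i j i' j' x y hx hy hi hj hne =>
  h j i j' i' x y hx hy hj hi (by omega)

lemma Inc.lines {E : Tab} (h : Inc E) (f : Bool) : Inc (OEG.lines f E) := by
  cases f
  · exact h
  · exact h.tr

lemma Ok.conv {E : Tab} (h : Ok E) (f : Bool) : Conv (lines f E) := by
  intro i j j' j'' h1 h2 h3 h4
  cases f
  · exact h.row _ _ _ ((h.dom _ _ h1).trans h3) h4 h2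
  · exact h.col _ _ _ h4 h2

lemma Inc.upd {F : Tab} (h : Inc F) {i j : ℕ} {w : Letter}
    (lo : ∀ i' j' y, i' ≤ i → j' ≤ j → ¬ (i' = i ∧ j' = j) → F i' j' = some y → y.ceil < w.ceil)
    (hi : ∀ i' j' y, i ≤ i' → j ≤ j' → ¬ (i' = i ∧ j' = j) → F i' j' = some y → w.ceil < y.ceil) :
    Inc (upd F i j (some w)) := by
  intro a b a' b' x y hx hy ha hb hne
  simp only [OEG.upd] at hx hy
  split_ifs at hx hy with h1 h2 h2
  · omega
  · rw [← Option.some.inj hx]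
    exact hi a' b' y (by omega) (by omega) h2 hy
  · rw [← Option.some.inj hy]
    exact lo a b x (by omega) (by omega) h1 hx
  · exact h a b a' b' x y hx hy ha hb hne

lemma Ok.upd {E : Tab} (h : Ok E) {r c : ℕ} {w : Letter} (he : E r c ≠ none)
    (hi : Inc (upd E r c (some w))) (hd : r = c → w.primed = false) :
    Ok (upd E r c (some w)) := by
  have key : ∀ a b, OEG.upd E r c (some w) a b ≠ none ↔ E a b ≠ none := by
    intro a b
    simp only [OEG.upd]
    split_ifs with h1
    · simp [h1.1, h1.2, he]
    · rfl
  refine ⟨fun a b => ?_, fun a b b' => ?_, fun a a' b => ?_, hi, ?_⟩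
  · rw [key]; exact h.dom a b
  · rw [key, key]; exact h.row a b b'
  · rw [key, key]; exact h.col a a' b
  · intro a x hx
    simp only [OEG.upd] at hx
    split_ifs at hx with h1
    · rw [← Option.some.inj hx]
      exact hd (by omega)
    · exact h.diag a x hx

/-- The predicate on words when reading by rows or by columns. -/
def lp (f : Bool) (P : PWord → Prop) : PWord → Prop := fun a => P (if f then a else a.reverse)

lemma Good.lp {P : PWord → Prop} (hP : Good P) (f : Bool) : Good (lp f P) := by
  cases f
  · exact hP.reverse
  · exact hP

def LWord (P : PWord → Prop) (f : Bool) (E : Tab) (i : ℕ) (w : Letter) : Prop :=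
  Word (lp f P) (graph (lines f E)) rowKey (thr i) [w]

structure PrevAt (f : Bool) (E : Tab) (i b : ℕ) (x w : Letter) : Prop where
  entry : lines f E i b = some x
  lt : x.ceil < w.ceil
  le : ∀ y, lines f E (i + 1) b = some y → w.ceil ≤ y.ceil
  row : f = false → i + 1 ≤ b
  prime : f = true → b = i → ∀ y, lines f E (i + 1) b = some y → y.ceil = w.ceil →
    y.primed = false

def Prev (f : Bool) (E : Tab) : ℕ → Letter → Prop
  | 0, _ => f = false
  | i + 1, w => ∃ b x, PrevAt f E i b x w

structure Valid (P : PWord → Prop) (f : Bool) (E : Tab) (i : ℕ) (w : Letter) : Prop where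
  ok : Ok E
  word : LWord P f E i w
  prev : Prev f E i w

inductive Step : Bool → Tab → ℕ → Letter → Bool → Tab → Letter → Prop
  | bump {f : Bool} {E : Tab} {i j : ℕ} {w : Letter} {F' : Tab} {m : Letter}
      (hj : f = false → j ≠ i) (h : BumpA (lines f E) i j w F' m) : Step f E i w f (lines f F') m
  | switch {f : Bool} {E : Tab} {i j : ℕ} {w : Letter} {p : Bool} {F' : Tab} {m : Letter}
      (hj : f = false → j ≠ i) (h : BumpC (lines f E) i j w p F' m) : Step f E i w f (lines f F') m
  | diag {E : Tab} {r : ℕ} {w d : Letter} (hd : E r r = some d) (h : w.ceil < d.ceil) :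
      Step false E r w true (upd E r r (some w.unprime)) ⟨d.ceil, w.primed⟩
  | diagEq {E : Tab} {r : ℕ} {w : Letter} (h1 : E r r = some ⟨w.ceil, false⟩)
      (h2 : E r (r + 1) = some ⟨w.ceil + 1, false⟩)
      (h3 : E (r + 1) (r + 1) = some ⟨w.ceil + 2, false⟩) :
      Step false E r w true E ⟨w.ceil + 1, w.primed⟩

lemma PrevAt.pos_le {E : Tab} {f : Bool} {i b j : ℕ} {x w : Letter} (hE : Ok E)
    (h : PrevAt f E i b x w)
    (hb : ∀ j' y, j' < j → lines f E (i + 1) j' = some y → y.ceil < w.ceil)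
    (hj : ∃ j', j ≤ j' + 1 ∧ lines f E (i + 1) j' ≠ none) : j ≤ b := by
  by_contra hlt
  obtain ⟨j', hj', hne⟩ := hj
  have : lines f E (i + 1) b ≠ none := by
    cases f
    · exact hE.row _ _ _ (h.row rfl) (by omega) hne
    · exact hE.col _ _ _ (by omega) hne
  obtain ⟨y, hy⟩ := Option.ne_none_iff_exists'.1 this
  have h1 := hb b y (by omega) hy
  have h2 := h.le y hy
  omega

lemma Prev.below' {E : Tab} {f : Bool} {i j : ℕ} {w : Letter} (hE : Ok E) (h : Prev f E i w)
    (hb : ∀ j' y, j' < j → lines f E i j' = some y → y.ceil < w.ceil)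
    (hj : ∀ i0 b x, i = i0 + 1 → PrevAt f E i0 b x w → j ≤ b) (i' j' : ℕ) (y : Letter)
    (hi' : i' ≤ i) (hj' : j' ≤ j) (hne : ¬ (i' = i ∧ j' = j)) (hy : lines f E i' j' = some y) :
    y.ceil < w.ceil := by
  rcases Nat.eq_or_lt_of_le hi' with rfl | hlt
  · exact hb j' y (by omega) hy
  · obtain ⟨i0, rfl⟩ : ∃ i0, i = i0 + 1 := ⟨i - 1, by omega⟩
    obtain ⟨b, x, h⟩ := h
    have hjb := hj i0 b x rfl h
    by_cases hs : i' = i0 ∧ j' = b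
    · rw [hs.1, hs.2, h.entry] at hy
      rw [← Option.some.inj hy]
      exact h.lt
    · exact (hE.inc.lines f _ _ _ _ _ _ hy h.entry (by omega) (by omega) hs).trans h.lt

lemma Prev.below {E : Tab} {f : Bool} {i j : ℕ} {w : Letter} (hE : Ok E) (h : Prev f E i w)
    (hb : ∀ j' y, j' < j → lines f E i j' = some y → y.ceil < w.ceil)
    (hj : ∃ j', j ≤ j' + 1 ∧ lines f E i j' ≠ none) (i' j' : ℕ) (y : Letter) (hi' : i' ≤ i)
    (hj' : j' ≤ j) (hne : ¬ (i' = i ∧ j' = j)) (hy : lines f E i' j' = some y) :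
    y.ceil < w.ceil :=
  h.below' hE hb (fun _ _ _ hi h0 => by subst hi; exact h0.pos_le hE hb hj) _ _ _ hi' hj' hne hy

lemma bx_diag {f : Bool} {i j : ℕ} : (bx f i j).1 = (bx f i j).2 ↔ i = j := by
  cases f
  · exact Iff.rfl
  · exact eq_comm

/-- In a column insertion the bumped position lies strictly below the diagonal box. -/
lemma Prev.col_lt {E : Tab} {i j : ℕ} {w : Letter} (hE : Ok E) (h : Prev true E i w)
    (hb : ∀ j' y, j' < j → lines true E i j' = some y → y.ceil < w.ceil)
    (hj : ∃ j', j ≤ j' + 1 ∧ lines true E i j' ≠ none) : j < i := by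
  cases i with
  | zero => cases h
  | succ i =>
    obtain ⟨b, x, h⟩ := h
    have h1 := h.pos_le hE hb hj
    have h2 : b ≤ i := hE.dom b i (by rw [show E b i = some x from h.entry]; simp)
    omega

variable {P : PWord → Prop} {E E' : Tab} {f f' : Bool} {i j : ℕ} {w m : Letter}

lemma Valid.bumpA {F' : Tab} (hP : Good P) (hV : Valid P f E i w) (hj : f = false → j ≠ i)
    (h : BumpA (lines f E) i j w F' m) : Valid P f (lines f F') (i + 1) m := by
  have hne : lines f E i j ≠ none := by rw [h.entry]; simp
  have hji : j ≠ i := by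
    cases f
    · exact hj rfl
    · exact (hV.prev.col_lt hV.ok h.before ⟨j, by omega, hne⟩).ne
  have e : lines f F' = upd E (bx f i j).1 (bx f i j).2 (some w) := by rw [h.eq, lines_upd_lines]
  have hF : Inc F' := by
    rw [h.eq]
    refine (hV.ok.inc.lines f).upd ?_ ?_
    · exact hV.prev.below hV.ok h.before ⟨j, by omega, hne⟩
    · intro i' j' y hi hj hn hy
      exact h.lt.trans (hV.ok.inc.lines f _ _ _ _ _ _ h.entry hy hi hj (by omega))
  refine ⟨?_, ?_, j, w, ?_⟩
  · rw [e]
    refine hV.ok.upd ?_ ?_ ?_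
    · rw [← lines_apply f E i j]; exact hne
    · rw [← e]; exact hF.lines f
    · intro hd; exact absurd (bx_diag.1 hd).symm hji
  · unfold LWord
    rw [lines_lines]
    exact (h.word (hP.lp f)).1 hV.word
  · refine ⟨?_, h.lt, ?_, ?_, ?_⟩
    · rw [lines_lines, h.eq, upd_self]
    · intro y hy
      rw [lines_lines, h.eq, upd_of_ne (by omega)] at hy
      exact (hV.ok.inc.lines f _ _ _ _ _ _ h.entry hy (by omega) le_rfl (by omega)).le
    · intro hf
      subst hf
      have := hV.ok.dom i j hne
      omega
    · intro _ hd; exact absurd hd hji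

lemma Valid.bumpC {F' : Tab} {p : Bool} (hP : Good P) (hV : Valid P f E i w)
    (hj : f = false → j ≠ i) (h : BumpC (lines f E) i j w p F' m) :
    Valid P f (lines f F') (i + 1) m := by
  have hne : lines f E i j ≠ none := by rw [h.entry]; simp
  have hne' : lines f E i (j + 1) ≠ none := by rw [h.next]; simp
  have hm : m.ceil = w.ceil + 1 := by rw [h.out]
  have hji : j ≠ i := by
    cases f
    · exact hj rfl
    · exact (hV.prev.col_lt hV.ok h.before ⟨j, by omega, hne⟩).ne
  have hp : j + 1 = i → p = false := by
    intro hji1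
    cases f
    · have := hV.ok.dom i j hne
      omega
    · have h1 := hV.prev
      subst hji1
      obtain ⟨b, x, h1⟩ := h1
      have h2 := h1.pos_le hV.ok h.before ⟨j, by omega, hne⟩
      have h3 : b ≤ j := hV.ok.dom b j (by rw [show E b j = some x from h1.entry]; simp)
      obtain rfl : b = j := by omega
      exact h1.prime rfl rfl _ h.entry rfl
  have e : lines f F' = upd (upd E (bx f i j).1 (bx f i j).2 (some ⟨w.ceil, false⟩))
      (bx f i (j + 1)).1 (bx f i (j + 1)).2 (some ⟨w.ceil + 1, p⟩) := by
    rw [h.eq, lines_upd, lines_upd_lines]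
  have hI := hV.ok.inc.lines f
  have hF1 : Inc (upd (lines f E) i j (some ⟨w.ceil, false⟩)) := by
    refine hI.upd ?_ ?_
    · intro i' j' y hi' hj' hn hy
      have h' := hI _ _ _ _ _ _ hy h.entry hi' hj' hn
      exact h'
    · intro i' j' y hi' hj' hn hy
      have h' := hI _ _ _ _ _ _ h.entry hy hi' hj' (by omega)
      exact h'
  have hn1 : upd (lines f E) i j (some ⟨w.ceil, false⟩) i (j + 1) = some ⟨w.ceil + 1, false⟩ := by
    rw [upd_of_ne (by omega), h.next]
  have hF : Inc F' := by
    rw [h.eq]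
    refine hF1.upd ?_ ?_
    · intro i' j' y hi' hj' hn hy
      have h' := hF1 _ _ _ _ _ _ hy hn1 hi' hj' hn
      exact h'
    · intro i' j' y hi' hj' hn hy
      have h' := hF1 _ _ _ _ _ _ hn1 hy hi' hj' (by omega)
      exact h'
  refine ⟨?_, ?_, j, ⟨w.ceil, false⟩, ?_⟩
  · rw [e]
    have e1 : Ok (upd E (bx f i j).1 (bx f i j).2 (some ⟨w.ceil, false⟩)) := by
      refine hV.ok.upd (by rw [← lines_apply f E i j]; exact hne) ?_ fun _ => rfl
      rw [← lines_upd_lines]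
      exact hF1.lines f
    refine e1.upd ?_ ?_ ?_
    · have e2 := hn1
      rw [← lines_lines f (OEG.upd _ _ _ _), lines_upd_lines, lines_apply] at e2
      rw [e2]; simp
    · rw [← e]; exact hF.lines f
    · intro hd; exact hp (bx_diag.1 hd).symm
  · unfold LWord
    rw [lines_lines]
    exact (h.word (hP.lp f)).1 hV.word
  · refine ⟨?_, by simp [hm], ?_, ?_, ?_⟩
    · rw [lines_lines, h.eq, upd_of_ne (by omega), upd_self]
    · intro y hy
      rw [lines_lines, h.eq, upd_of_ne (by omega), upd_of_ne (by omega)] at hy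
      have := hI _ _ _ _ _ _ h.entry hy (by omega) le_rfl (by omega)
      simp only at this
      omega
    · intro hf
      subst hf
      have := hV.ok.dom i j hne
      omega
    · intro _ hd; exact absurd hd hji

/-! ### The passage from rows to columns -/

section convert

variable {P : PWord → Prop} {G : Set (Box × Letter)} {κ κ' : Box → Key} {k k' : Key} {X : PWord}

lemma Word.move_iff (hP : Good P) (hG : ∀ p x y, (p, x) ∈ G → (p, y) ∈ G → x = y)
    (hκ : Function.Injective κ) (hκ' : Function.Injective κ') (hk : ∀ p, κ p ≠ k)
    (hk' : ∀ p, κ' p ≠ k')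
    (hbox : ∀ x ∈ G, ∀ y ∈ G, κ x.1 < κ y.1 → κ' y.1 < κ' x.1 → Far x.2 y.2)
    (hX : ∀ x ∈ G, (κ x.1 < k ∧ k' < κ' x.1 ∨ k < κ x.1 ∧ κ' x.1 < k') → ∀ u ∈ X, Far x.2 u) :
    Word P G κ k X ↔ Word P G κ' k' X := by
  have hinj : ∀ x ∈ G, ∀ y ∈ G, x.1 = y.1 → x = y := by
    rintro ⟨p, x⟩ hx ⟨q, y⟩ hy (rfl : p = q)
    rw [hG p x y hx hy]
  constructor <;> intro h
  · exact h.move hP κ' k' (fun x hx y hy e => hinj x hx y hy (hκ' e)) (fun x _ => hk' _) hbox hX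
  · refine h.move hP κ k (fun x hx y hy e => hinj x hx y hy (hκ e)) (fun x _ => hk _) ?_ ?_
    · intro x hx y hy h1 h2
      exact (hbox y hy x hx h2 h1).symm
    · intro x hx h1
      exact hX x hx (h1.imp (fun h => ⟨h.2, h.1⟩) (fun h => ⟨h.2, h.1⟩) |>.symm)

lemma exists_of_word (h : Word P G κ k X) (hmin : ∀ x ∈ G, k < κ x.1) : ∃ b, P (X ++ b) := by
  obtain ⟨A, B, h1, h2, h3, h4, h5, h6⟩ := h.exists_split
  have hA : A = [] := by
    rw [List.eq_nil_iff_forall_not_mem]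
    intro x hx
    exact (h3 x hx).asymm (hmin x ((h5 x).2 (Or.inl hx)))
  subst hA
  exact ⟨_, h6⟩

lemma word_front {X' : PWord} (h : Word P G κ k X) (hmin : ∀ x ∈ G, k < κ x.1)
    (hmin' : ∀ x ∈ G, k' < κ x.1) (H : ∀ b, P (X ++ b) → P (X' ++ b)) : Word P G κ k' X' := by
  obtain ⟨A, B, h1, h2, h3, h4, h5, h6⟩ := h.exists_split
  have hA : A = [] := by
    rw [List.eq_nil_iff_forall_not_mem]
    intro x hx
    exact (h3 x hx).asymm (hmin x ((h5 x).2 (Or.inl hx)))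
  subst hA
  exact word_of_split h1 h2 (by simp) (fun b hb => hmin' b ((h5 b).2 (Or.inr hb))) h5 (H _ h6)

variable {E E' : Tab}

lemma far_of_strict (hE : Ok E) {r c r' c' : ℕ} {x y : Letter} (hx : E r c = some x)
    (hy : E r' c' = some y) (hr : r < r') (hc : c < c') : Far x y := by
  obtain ⟨u, hu⟩ := Option.ne_none_iff_exists'.1 (hE.col r' r c' hr.le (by simp [hy]))
  have h1 := hE.inc _ _ _ _ _ _ hx hu le_rfl hc.le (by omega)
  have h2 := hE.inc _ _ _ _ _ _ hu hy hr.le le_rfl (by omega)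
  exact far_of_le (by omega)

lemma move_ok (hP : Good P) (hE : Ok E) (hκ : Function.Injective κ) (hκ' : Function.Injective κ')
    (hk : ∀ p, κ p ≠ k) (hk' : ∀ p, κ' p ≠ k')
    (hflip : ∀ p q : Box, p.1 ≤ p.2 → q.1 ≤ q.2 → κ p < κ q → κ' q < κ' p →
      (p.1 < q.1 ∧ p.2 < q.2 ∨ q.1 < p.1 ∧ q.2 < p.2) ∨
        ∀ x y, E p.1 p.2 = some x → E q.1 q.2 = some y → Far x y)
    (hX : ∀ r c x, r ≤ c → E r c = some x →
      (κ (r, c) < k ∧ k' < κ' (r, c) ∨ k < κ (r, c) ∧ κ' (r, c) < k') → ∀ u ∈ X, Far x u) :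
    Word P (graph E) κ k X ↔ Word P (graph E) κ' k' X := by
  refine Word.move_iff hP ?_ hκ hκ' hk hk' ?_ ?_
  · intro p x y hx hy
    rw [mem_graph] at hx hy
    rw [hx] at hy
    exact Option.some.inj hy
  · rintro ⟨⟨a, b⟩, x⟩ hx ⟨⟨a', b'⟩, y⟩ hy h1 h2
    rw [mem_graph] at hx hy
    rcases hflip _ _ (hE.dom _ _ (by rw [hx]; simp)) (hE.dom _ _ (by rw [hy]; simp)) h1 h2
      with (h | h) | h
    · exact far_of_strict hE hx hy h.1 h.2
    · exact (far_of_strict hE hy hx h.1 h.2).symm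
    · exact h x y hx hy
  · rintro ⟨⟨a, b⟩, x⟩ hx h
    exact hX a b x (hE.dom _ _ (by rw [mem_graph.1 hx]; simp)) hx h

/-- The order of boxes in the row reading word. -/
def rowOrd (p : Box) : Key := toLex (-2 * (p.1 : ℤ), 2 * (p.2 : ℤ))

/-- The order of boxes in the column reading word. -/
def colOrd (p : Box) : Key := toLex (2 * (p.2 : ℤ), -2 * (p.1 : ℤ))

def rthr (r : ℕ) : Key := toLex (-2 * (r : ℤ) + 1, 0)

lemma rowOrd_injective : Function.Injective rowOrd := by
  rintro ⟨a, b⟩ ⟨c, d⟩ h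
  simp only [rowOrd, key_eq] at h
  rw [Prod.mk.injEq]; omega

lemma colOrd_injective : Function.Injective colOrd := by
  rintro ⟨a, b⟩ ⟨c, d⟩ h
  simp only [colOrd, key_eq] at h
  rw [Prod.mk.injEq]; omega

lemma lp_false (P : PWord → Prop) : lp false P = fun a => P a.reverse := rfl

lemma word_rows {i : ℕ} :
    Word (lp false P) (graph E) rowKey (thr i) X ↔
      Word P (graph E) rowOrd (rthr i) X.reverse := by
  constructor
  · intro h
    have := word_reverse (P := lp false P) (κ' := rowOrd) (k' := rthr i) ?_ ?_ ?_ h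
    · simpa [lp] using this
    all_goals
      rintro ⟨⟨a, b⟩, x⟩ _
      first
        | rintro ⟨⟨c, d⟩, y⟩ _ h
        | intro h
      simp only [rowKey, rowOrd, thr, rthr, key_lt] at h ⊢
      omega
  · intro h
    have := word_reverse (P := P) (κ' := rowKey) (k' := thr i) ?_ ?_ ?_ h
    · rw [lp_false]; simpa using this
    all_goals
      rintro ⟨⟨a, b⟩, x⟩ _
      first
        | rintro ⟨⟨c, d⟩, y⟩ _ h
        | intro h
      simp only [rowKey, rowOrd, thr, rthr, key_lt] at h ⊢
      omega

lemma word_cols {k : Key} :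
    Word P (graph (tr E)) rowKey k X ↔ Word P (graph E) colOrd k X := by
  rw [word_swap]; rfl

lemma lword_false {i : ℕ} {w : Letter} :
    LWord P false E i w ↔ Word P (graph E) rowOrd (rthr i) [w] := word_rows

lemma lword_true {i : ℕ} {w : Letter} :
    LWord P true E i w ↔ Word P (graph E) colOrd (thr i) [w] := word_cols

/-- The row and column reading words are equivalent. -/
lemma word_rows_cols (hP : Good P) (hE : Ok E) (hk : ∀ p, rowOrd p ≠ k)
    (hk' : ∀ p, colOrd p ≠ k') :
    Word P (graph E) rowOrd k [] ↔ Word P (graph E) colOrd k' [] := by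
  refine move_ok hP hE rowOrd_injective colOrd_injective hk hk' ?_ ?_
  · rintro ⟨a, b⟩ ⟨c, d⟩ hp hq h1 h2
    simp only [rowOrd, colOrd, key_lt] at h1 h2 hp hq ⊢
    left
    omega
  · intro r c x _ _ _ u hu; simp at hu

end convert

/-- Column order, except that the box `(r, r)` comes first. -/
def diagOrd (r : ℕ) (p : Box) : Key := if p = (r, r) then toLex (-8, 0) else colOrd p

/-- Column order, except that `(r, r)`, `(r + 1, r + 1)`, `(r, r + 1)` come first. -/
def cornerOrd (r : ℕ) (p : Box) : Key :=
  if p = (r, r) then toLex (-8, 0) else if p = (r + 1, r + 1) then toLex (-6, 0)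
  else if p = (r, r + 1) then toLex (-4, 0) else colOrd p

/-- Column order, except that `(r, r)`, `(r, r + 1)` come first. -/
def edgeOrd (r : ℕ) (p : Box) : Key :=
  if p = (r, r) then toLex (-8, 0) else if p = (r, r + 1) then toLex (-6, 0) else colOrd p

/-- Column order, except that `(r + 1, r + 1)`, `(r, r + 1)` come first. -/
def edgeOrd' (r : ℕ) (p : Box) : Key :=
  if p = (r + 1, r + 1) then toLex (-6, 0) else if p = (r, r + 1) then toLex (-4, 0) else colOrd p

lemma diagOrd_injective (r : ℕ) : Function.Injective (diagOrd r) := by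
  rintro ⟨a, b⟩ ⟨c, d⟩ h
  simp only [diagOrd, colOrd, Prod.mk.injEq] at h ⊢
  split_ifs at h <;> simp only [key_eq] at h <;> omega

lemma cornerOrd_injective (r : ℕ) : Function.Injective (cornerOrd r) := by
  rintro ⟨a, b⟩ ⟨c, d⟩ h
  simp only [cornerOrd, colOrd, Prod.mk.injEq] at h ⊢
  split_ifs at h <;> simp only [key_eq] at h <;> omega

lemma edgeOrd_injective (r : ℕ) : Function.Injective (edgeOrd r) := by
  rintro ⟨a, b⟩ ⟨c, d⟩ h
  simp only [edgeOrd, colOrd, Prod.mk.injEq] at h ⊢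
  split_ifs at h <;> simp only [key_eq] at h <;> omega

lemma edgeOrd'_injective (r : ℕ) : Function.Injective (edgeOrd' r) := by
  rintro ⟨a, b⟩ ⟨c, d⟩ h
  simp only [edgeOrd', colOrd, Prod.mk.injEq] at h ⊢
  split_ifs at h <;> simp only [key_eq] at h <;> omega

lemma colOrd_ne_thr (i : ℕ) (p : Box) : colOrd p ≠ thr i := by
  simp only [colOrd, thr, ne_eq, key_eq]; omega

lemma rowOrd_ne_rthr (i : ℕ) (p : Box) : rowOrd p ≠ rthr i := by
  simp only [rowOrd, rthr, ne_eq, key_eq]; omega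

section

variable {z : Equiv.Perm ℤ} {E : Tab} {r : ℕ} {w d : Letter}

lemma lword_diag (hE : Ok E) (hd : E r r = some d) (hwd : w.ceil < d.ceil)
    (hE' : Ok (upd E r r (some w.unprime))) :
    LWord (· ∈ RinvPlus z) false E r w ↔
      LWord (· ∈ RinvPlus z) true (upd E r r (some w.unprime)) (r + 1) ⟨d.ceil, w.primed⟩ := by
  have hP := good_RinvPlus z
  have hdp := hE.diag r d hd
  set E' := upd E r r (some w.unprime) with hE'def
  have hd' : E' r r = some w.unprime := upd_self _ _ _ _
  have hE0 : upd E' r r none = upd E r r none := upd_upd _ _ _ _ _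
  have k7 : ∀ p, diagOrd r p ≠ toLex (-7, 0) := by
    rintro ⟨a, b⟩
    simp only [diagOrd, colOrd]
    split_ifs <;> simp only [ne_eq, key_eq] <;> omega
  have e1 : Word (· ∈ RinvPlus z) (graph E) rowOrd (rthr r) [w] ↔
      Word (· ∈ RinvPlus z) (graph E) (diagOrd r) (toLex (-7, 0)) [w] := by
    refine move_ok hP hE rowOrd_injective (diagOrd_injective r) (rowOrd_ne_rthr r) k7 ?_ ?_
    · rintro ⟨a, b⟩ ⟨a', b'⟩ hp hq h1 h2
      simp only [rowOrd, colOrd, diagOrd, Prod.mk.injEq] at h1 h2 hp hq ⊢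
      left
      split_ifs at h2 <;> simp only [key_lt] at h1 h2 <;> omega
    · intro a b x hab hx h u hu
      rw [List.mem_singleton.1 hu]
      have hs : r ≤ a ∧ ¬ (a = r ∧ b = r) := by
        simp only [rowOrd, colOrd, diagOrd, Prod.mk.injEq, rthr] at h
        split_ifs at h <;> simp only [key_lt] at h <;> omega
      have := hE.inc _ _ _ _ _ _ hd hx hs.1 (by omega) (by omega)
      exact (far_of_le (by omega)).symm
  have e2 : Word (· ∈ RinvPlus z) (graph E') (diagOrd r) (toLex (-7, 0)) [⟨d.ceil, w.primed⟩] ↔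
      Word (· ∈ RinvPlus z) (graph E') colOrd (thr (r + 1)) [⟨d.ceil, w.primed⟩] := by
    refine move_ok hP hE' (diagOrd_injective r) colOrd_injective k7 (colOrd_ne_thr _) ?_ ?_
    · rintro ⟨a, b⟩ ⟨a', b'⟩ hp hq h1 h2
      simp only [colOrd, diagOrd, Prod.mk.injEq] at h1 h2 hp hq ⊢
      left
      split_ifs at h1 <;> simp only [key_lt] at h1 h2 <;> omega
    · intro a b x hab hx h u hu
      rw [List.mem_singleton.1 hu]
      have hs : b ≤ r ∧ ¬ (a = r ∧ b = r) := by
        simp only [colOrd, diagOrd, Prod.mk.injEq, thr] at h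
        split_ifs at h <;> simp only [key_lt] at h <;> omega
      have h3 := hE'.inc _ _ _ _ _ _ hx hd' (by omega) (by omega) (by omega)
      simp only [Letter.unprime] at h3
      exact far_of_le (by dsimp only; omega)
  have emit : ∀ (F : Tab) (x : Letter) (X : PWord), F r r = some x →
      (Word (· ∈ RinvPlus z) (graph F) (diagOrd r) (toLex (-7, 0)) X ↔
        Word (· ∈ RinvPlus z) (graph (upd F r r none)) (diagOrd r) (toLex (-7, 0)) (x :: X)) := by
    intro F x X hx
    rw [graph_eq_insert hx]
    refine word_emit_left (by simp [mem_graph, upd]) ?_ ?_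
    · simp only [diagOrd, if_true, key_lt]; omega
    · rintro ⟨⟨a, b⟩, y⟩ hy hlt
      have hne : ¬ (a = r ∧ b = r) := fun hab => by simp [mem_graph, upd, hab] at hy
      simp only [diagOrd, Prod.mk.injEq, hne, if_false, colOrd, key_lt] at hlt ⊢
      omega
  have hmin : ∀ x ∈ graph (upd E r r none), (toLex (-7, 0) : Key) < diagOrd r x.1 := by
    rintro ⟨⟨a, b⟩, y⟩ hy
    have hne : ¬ (a = r ∧ b = r) := fun hab => by simp [mem_graph, upd, hab] at hy
    simp only [diagOrd, Prod.mk.injEq, hne, if_false, colOrd, key_lt]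
    omega
  rw [lword_false, lword_true, e1, ← e2, emit E d _ hd, emit E' _ _ hd', hE0]
  have hdd : d = ⟨d.ceil, false⟩ := by rw [← hdp]
  constructor <;> intro h
  · refine word_front h hmin hmin fun b hb => ?_
    rw [hdd] at hb
    exact RinvPlus.swap_first hb
  · refine word_front h hmin hmin fun b hb => ?_
    rw [hdd]
    exact RinvPlus.swap_first hb

lemma lword_diagEq (hE : Ok E) (h1 : E r r = some ⟨w.ceil, false⟩)
    (h2 : E r (r + 1) = some ⟨w.ceil + 1, false⟩)
    (h3 : E (r + 1) (r + 1) = some ⟨w.ceil + 2, false⟩) :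
    LWord (· ∈ RinvPlus z) false E r w ↔
      LWord (· ∈ RinvPlus z) true E (r + 1) ⟨w.ceil + 1, w.primed⟩ := by
  have hP := good_RinvPlus z
  have k3 : ∀ p, cornerOrd r p ≠ toLex (-3, 0) := by
    rintro ⟨a, b⟩
    simp only [cornerOrd, colOrd]
    split_ifs <;> simp only [ne_eq, key_eq] <;> omega
  have k7 : ∀ p, cornerOrd r p ≠ toLex (-7, 0) := by
    rintro ⟨a, b⟩
    simp only [cornerOrd, colOrd]
    split_ifs <;> simp only [ne_eq, key_eq] <;> omega
  have e1 : Word (· ∈ RinvPlus z) (graph E) rowOrd (rthr r) [w] ↔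
      Word (· ∈ RinvPlus z) (graph E) (cornerOrd r) (toLex (-3, 0)) [w] := by
    refine move_ok hP hE rowOrd_injective (cornerOrd_injective r) (rowOrd_ne_rthr r) k3 ?_ ?_
    · rintro ⟨a, b⟩ ⟨a', b'⟩ hp hq h1 h2
      simp only [rowOrd, colOrd, cornerOrd, Prod.mk.injEq] at h1 h2 hp hq ⊢
      left
      split_ifs at h2 <;> simp only [key_lt] at h1 h2 <;> omega
    · intro a b x hab hx h u hu
      rw [List.mem_singleton.1 hu]
      have hs : r ≤ a ∧ r + 1 ≤ b ∧ ¬ (a = r ∧ b = r + 1) := by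
        simp only [rowOrd, colOrd, cornerOrd, Prod.mk.injEq, rthr] at h
        split_ifs at h <;> simp only [key_lt] at h <;> omega
      have := hE.inc _ _ _ _ _ _ h2 hx hs.1 (by omega) (by omega)
      dsimp only at this
      exact (far_of_le (by omega)).symm
  have e2 : Word (· ∈ RinvPlus z) (graph E) (cornerOrd r) (toLex (-7, 0))
      [⟨w.ceil + 1, w.primed⟩] ↔
      Word (· ∈ RinvPlus z) (graph E) colOrd (thr (r + 1)) [⟨w.ceil + 1, w.primed⟩] := by
    refine move_ok hP hE (cornerOrd_injective r) colOrd_injective k7 (colOrd_ne_thr _) ?_ ?_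
    · rintro ⟨a, b⟩ ⟨a', b'⟩ hp hq h1 h2
      simp only [colOrd, cornerOrd, Prod.mk.injEq] at h1 h2 hp hq ⊢
      left
      split_ifs at h1 <;> simp only [key_lt] at h1 h2 <;> omega
    · intro a b x hab hx h u hu
      rw [List.mem_singleton.1 hu]
      have hs : b ≤ r ∧ ¬ (a = r ∧ b = r) := by
        simp only [colOrd, cornerOrd, Prod.mk.injEq, thr] at h
        split_ifs at h <;> simp only [key_lt] at h <;> omega
      have h3 := hE.inc _ _ _ _ _ _ hx h1 (by omega) (by omega) (by omega)
      dsimp only at h3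
      exact far_of_le (by dsimp only; omega)
  have n1 : upd E r (r + 1) none (r + 1) (r + 1) = some ⟨w.ceil + 2, false⟩ := by
    rw [upd_of_ne (by omega), h3]
  have n2 : upd (upd E r (r + 1) none) (r + 1) (r + 1) none r r = some ⟨w.ceil, false⟩ := by
    rw [upd_of_ne (by omega), upd_of_ne (by omega), h1]
  set E0 := upd (upd (upd E r (r + 1) none) (r + 1) (r + 1) none) r r none with hE0
  have emit3 : Word (· ∈ RinvPlus z) (graph E) (cornerOrd r) (toLex (-3, 0)) [w] ↔
      Word (· ∈ RinvPlus z) (graph E0) (cornerOrd r) (toLex (-3, 0))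
        [⟨w.ceil, false⟩, ⟨w.ceil + 2, false⟩, ⟨w.ceil + 1, false⟩, w] := by
    rw [graph_eq_insert h2, word_emit_left, graph_eq_insert n1, word_emit_left,
      graph_eq_insert n2, word_emit_left]
    all_goals first
      | simp [mem_graph, upd]; done
      | (simp only [cornerOrd, Prod.mk.injEq]; split_ifs <;> simp only [key_lt] <;> omega)
      | skip
    all_goals
      rintro ⟨⟨a, b⟩, y⟩ hy hlt
      simp only [mem_graph, upd] at hy
      split_ifs at hy
      all_goals
        simp only [cornerOrd, Prod.mk.injEq, colOrd] at hlt ⊢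
        split_ifs at hlt ⊢ <;> simp only [key_lt] at hlt ⊢ <;> omega
  have n4 : upd E r r none (r + 1) (r + 1) = some ⟨w.ceil + 2, false⟩ := by
    rw [upd_of_ne (by omega), h3]
  have n5 : upd (upd E r r none) (r + 1) (r + 1) none r (r + 1) = some ⟨w.ceil + 1, false⟩ := by
    rw [upd_of_ne (by omega), upd_of_ne (by omega), h2]
  have hE0' : E0 = upd (upd (upd E r r none) (r + 1) (r + 1) none) r (r + 1) none := by
    funext a b
    simp only [hE0, upd]
    split_ifs <;> rfl
  have emit7 : Word (· ∈ RinvPlus z) (graph E) (cornerOrd r) (toLex (-7, 0))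
        [⟨w.ceil + 1, w.primed⟩] ↔
      Word (· ∈ RinvPlus z) (graph E0) (cornerOrd r) (toLex (-7, 0))
        [⟨w.ceil, false⟩, ⟨w.ceil + 1, w.primed⟩, ⟨w.ceil + 2, false⟩, ⟨w.ceil + 1, false⟩] := by
    rw [hE0', graph_eq_insert h1, word_emit_left, graph_eq_insert n4, word_emit_right,
      graph_eq_insert n5, word_emit_right]
    · rfl
    all_goals first
      | simp [mem_graph, upd]; done
      | (simp only [cornerOrd, Prod.mk.injEq]; split_ifs <;> simp only [key_lt] <;> omega)
      | skip
    all_goals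
      rintro ⟨⟨a, b⟩, y⟩ hy hlt
      simp only [mem_graph, upd] at hy
      split_ifs at hy
      all_goals
        simp only [cornerOrd, Prod.mk.injEq, colOrd] at hlt ⊢
        split_ifs at hlt ⊢ <;> simp only [key_lt] at hlt ⊢ <;> omega
  have hmin : ∀ x ∈ graph E0, (toLex (-3, 0) : Key) < cornerOrd r x.1 := by
    rintro ⟨⟨a, b⟩, y⟩ hy
    simp only [mem_graph, hE0, upd] at hy
    split_ifs at hy
    simp only [cornerOrd, Prod.mk.injEq, colOrd]
    split_ifs <;> simp only [key_lt] <;> omega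
  have hmin7 : ∀ x ∈ graph E0, (toLex (-7, 0) : Key) < cornerOrd r x.1 := by
    rintro ⟨⟨a, b⟩, y⟩ hy
    simp only [mem_graph, hE0, upd] at hy
    split_ifs at hy
    simp only [cornerOrd, Prod.mk.injEq, colOrd]
    split_ifs <;> simp only [key_lt] <;> omega
  rw [lword_false, lword_true, e1, ← e2, emit3, emit7]
  constructor <;> intro h
  · exact word_front h hmin hmin7 fun b hb => RinvPlus.front_braid.1 hb
  · exact word_front h hmin7 hmin fun b hb => RinvPlus.front_braid.2 hb

lemma corner_of_lword (hE : Ok E) (h1 : E r r = some ⟨w.ceil, false⟩)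
    (h2 : E r (r + 1) = some ⟨w.ceil + 1, false⟩) (h : LWord (· ∈ RinvPlus z) false E r w) :
    E (r + 1) (r + 1) = some ⟨w.ceil + 2, false⟩ := by
  by_contra h3
  have hP := good_RinvPlus z
  have big : ∀ a b x, r + 1 ≤ a → E a b = some x → w.ceil + 3 ≤ x.ceil := by
    intro a b x ha hx
    have hab := hE.dom a b (by rw [hx]; simp)
    obtain ⟨y, hy⟩ := Option.ne_none_iff_exists'.1
      (hE.col a (r + 1) b ha (by rw [hx]; simp))
    obtain ⟨u, hu⟩ := Option.ne_none_iff_exists'.1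
      (hE.row (r + 1) b (r + 1) le_rfl (by omega) (by rw [hy]; simp))
    have l1 := hE.inc _ _ _ _ _ _ h2 hu (by omega) le_rfl (by omega)
    dsimp only at l1
    have l2 : u.ceil ≠ w.ceil + 2 := by
      intro hc
      apply h3
      rw [hu, ← hc, ← hE.diag _ _ hu]
    by_cases he : a = r + 1 ∧ b = r + 1
    · rw [he.1, he.2, hu] at hx
      obtain rfl := Option.some.inj hx
      omega
    · have l3 := hE.inc _ _ _ _ _ _ hu hx ha (by omega) (by omega)
      omega
  have k5 : ∀ p, edgeOrd r p ≠ toLex (-5, 0) := by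
    rintro ⟨a, b⟩
    simp only [edgeOrd, colOrd]
    split_ifs <;> simp only [ne_eq, key_eq] <;> omega
  rw [lword_false, move_ok (κ' := edgeOrd r) (k' := toLex (-5, 0)) hP hE rowOrd_injective
    (edgeOrd_injective r) (rowOrd_ne_rthr r) k5] at h
  · have n1 : upd E r (r + 1) none r r = some ⟨w.ceil, false⟩ := by rw [upd_of_ne (by omega), h1]
    rw [graph_eq_insert h2, word_emit_left, graph_eq_insert n1, word_emit_left] at h
    · obtain ⟨b, hb⟩ := exists_of_word h (by
        rintro ⟨⟨a, b⟩, y⟩ hy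
        simp only [mem_graph, upd] at hy
        split_ifs at hy
        simp only [edgeOrd, Prod.mk.injEq, colOrd]
        split_ifs
        simp only [key_lt]
        omega)
      exact RinvPlus.not_palindrome (by rfl) (by norm_num) hb
    all_goals first
      | simp [mem_graph, upd]; done
      | (simp only [edgeOrd, Prod.mk.injEq]; split_ifs <;> simp only [key_lt] <;> omega)
      | skip
    all_goals
      rintro ⟨⟨a, b⟩, y⟩ hy hlt
      simp only [mem_graph, upd] at hy
      split_ifs at hy
      all_goals
        simp only [edgeOrd, Prod.mk.injEq, colOrd] at hlt ⊢
        split_ifs at hlt ⊢ <;> simp only [key_lt] at hlt ⊢ <;> omega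
  · rintro ⟨a, b⟩ ⟨a', b'⟩ hp hq k1 k2
    by_cases hc : a' = r ∧ b' = r + 1 ∧ r + 1 ≤ a
    · right
      intro x y hx hy
      have := big a b x hc.2.2 hx
      dsimp only at hy
      rw [hc.1, hc.2.1, h2] at hy
      rw [← Option.some.inj hy]
      exact (far_of_le (by dsimp only; omega)).symm
    · left
      simp only [rowOrd, colOrd, edgeOrd, Prod.mk.injEq] at k1 k2 hp hq ⊢
      split_ifs at k2 <;> simp only [key_lt] at k1 k2 <;> omega
  · intro a b x hab hx hs u hu
    rw [List.mem_singleton.1 hu]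
    have hs : r ≤ a ∧ r + 1 ≤ b ∧ ¬ (a = r ∧ b = r + 1) := by
      simp only [rowOrd, colOrd, edgeOrd, Prod.mk.injEq, rthr] at hs
      split_ifs at hs <;> simp only [key_lt] at hs <;> omega
    have := hE.inc _ _ _ _ _ _ h2 hx hs.1 (by omega) (by omega)
    dsimp only at this
    exact (far_of_le (by omega)).symm

lemma diag_of_lword {m x D : Letter} (hE : Ok E) (h1 : E r r = some D) (hD : D.ceil < m.ceil)
    (h2 : E r (r + 1) = some x) (hx : x.ceil = m.ceil)
    (h3 : E (r + 1) (r + 1) = some ⟨m.ceil + 1, false⟩)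
    (h : LWord (· ∈ RinvPlus z) true E (r + 1) m) : D.ceil = m.ceil - 1 := by
  by_contra hne
  have hP := good_RinvPlus z
  have small : ∀ a b y, b ≤ r → E a b = some y → y.ceil + 2 ≤ m.ceil := by
    intro a b y hb hy
    have hab := hE.dom a b (by rw [hy]; simp)
    by_cases he : a = r ∧ b = r
    · rw [he.1, he.2, h1] at hy
      obtain rfl := Option.some.inj hy
      omega
    · have := hE.inc _ _ _ _ _ _ hy h1 (by omega) hb he
      omega
  have k7 : ∀ p, edgeOrd' r p ≠ toLex (-7, 0) := by
    rintro ⟨a, b⟩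
    simp only [edgeOrd', colOrd]
    split_ifs <;> simp only [ne_eq, key_eq] <;> omega
  rw [lword_true, move_ok (κ' := edgeOrd' r) (k' := toLex (-7, 0)) hP hE colOrd_injective
    (edgeOrd'_injective r) (colOrd_ne_thr _) k7] at h
  · have n1 : upd E (r + 1) (r + 1) none r (r + 1) = some x := by rw [upd_of_ne (by omega), h2]
    rw [graph_eq_insert h3, word_emit_right, graph_eq_insert n1, word_emit_right] at h
    · obtain ⟨b, hb⟩ := exists_of_word h (by
        rintro ⟨⟨a, b⟩, y⟩ hy
        simp only [mem_graph, upd] at hy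
        split_ifs at hy
        simp only [edgeOrd', Prod.mk.injEq, colOrd]
        split_ifs
        simp only [key_lt]
        omega)
      exact RinvPlus.not_palindrome hx.symm (by norm_num) hb
    all_goals first
      | simp [mem_graph, upd]; done
      | (simp only [edgeOrd', Prod.mk.injEq]; split_ifs <;> simp only [key_lt] <;> omega)
      | skip
    all_goals
      rintro ⟨⟨a, b⟩, y⟩ hy hlt
      simp only [mem_graph, upd] at hy
      split_ifs at hy
      all_goals
        simp only [edgeOrd', Prod.mk.injEq, colOrd] at hlt ⊢
        split_ifs at hlt ⊢ <;> simp only [key_lt] at hlt ⊢ <;> omega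
  · rintro ⟨a, b⟩ ⟨a', b'⟩ hp hq k1 k2
    by_cases hc : a' = r ∧ b' = r + 1 ∧ a = r ∧ b = r
    · right
      intro u y hu hy
      have := small a b u hc.2.2.2.le hu
      dsimp only at hy
      rw [hc.1, hc.2.1, h2] at hy
      rw [← Option.some.inj hy]
      exact far_of_le (by omega)
    · left
      simp only [colOrd, edgeOrd', Prod.mk.injEq] at k1 k2 hp hq ⊢
      split_ifs at k2 <;> simp only [key_lt] at k1 k2 <;> omega
  · intro a b y hab hy hs u hu
    rw [List.mem_singleton.1 hu]
    have hs : b ≤ r := by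
      simp only [colOrd, edgeOrd', Prod.mk.injEq, thr] at hs
      split_ifs at hs <;> simp only [key_lt] at hs <;> omega
    have := small a b y hs hy
    exact far_of_le (by omega)

end

section

variable {z : Equiv.Perm ℤ} {E E' : Tab} {f f' : Bool} {i : ℕ} {w m : Letter}

lemma Valid.step (hV : Valid (· ∈ RinvPlus z) f E i w) (h : Step f E i w f' E' m) :
    Valid (· ∈ RinvPlus z) f' E' (i + 1) m := by
  have hP := good_RinvPlus z
  cases h with
  | bump hj h => exact hV.bumpA hP hj h
  | switch hj h => exact hV.bumpC hP hj h
  | @diag _ _ _ d hd h =>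
    have hdd : E i i ≠ none := by rw [hd]; simp
    have hI : Inc (upd E i i (some w.unprime)) := by
      refine hV.ok.inc.upd ?_ ?_
      · refine hV.prev.below hV.ok ?_ ⟨i, by omega, hdd⟩
        intro j' y hj' hy
        have := hV.ok.dom i j' (by rw [show E i j' = some y from hy]; simp)
        omega
      · intro i' j' y hi hj hn hy
        exact h.trans (hV.ok.inc _ _ _ _ _ _ hd hy hi hj (by omega))
    have hE' : Ok (upd E i i (some w.unprime)) := hV.ok.upd hdd hI fun _ => rfl
    have hr : ∀ y, upd E i i (some w.unprime) i (i + 1) = some y → d.ceil < y.ceil := by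
      intro y hy
      rw [upd_of_ne (by omega)] at hy
      exact hV.ok.inc _ _ _ _ _ _ hd hy le_rfl (by omega) (by omega)
    refine ⟨hE', (lword_diag hV.ok hd h hE').1 hV.word, i, w.unprime, ?_, h, ?_, by simp, ?_⟩
    · exact upd_self _ _ _ _
    · intro y hy
      exact (hr y hy).le
    · intro _ _ y hy hc
      exact absurd hc (hr y hy).ne'
  | @diagEq _ _ _ h1 h2 h3 =>
    have hr : ∀ y, lines true E (i + 1) i = some y → y = ⟨w.ceil + 1, false⟩ := by
      intro y hy
      have : E i (i + 1) = some y := hy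
      rw [h2] at this
      exact (Option.some.inj this).symm
    refine ⟨hV.ok, (lword_diagEq hV.ok h1 h2 h3).1 hV.word, i, ⟨w.ceil, false⟩, h1, ?_, ?_,
      by simp, ?_⟩
    · simp
    · intro y hy
      rw [hr y hy]
    · intro _ _ y hy _
      rw [hr y hy]

lemma Valid.progress (hV : Valid (· ∈ RinvPlus z) f E i w) :
    (∃ f' E' m, Step f E i w f' E' m) ∨ ∀ j y, lines f E i j = some y → y.ceil < w.ceil := by
  have hP := good_RinvPlus z
  rw [or_iff_not_imp_right]
  intro hex
  push Not at hex
  have hex' : ∃ j, ∃ y, lines f E i j = some y ∧ w.ceil ≤ y.ceil := hex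
  classical
  obtain ⟨j, ⟨y, hy, hwy⟩, hmin⟩ : ∃ j, (∃ y, lines f E i j = some y ∧ w.ceil ≤ y.ceil) ∧
      ∀ j' < j, ¬ ∃ y, lines f E i j' = some y ∧ w.ceil ≤ y.ceil :=
    ⟨Nat.find hex', Nat.find_spec hex', fun j' h => Nat.find_min hex' h⟩
  have before : ∀ j' y, j' < j → lines f E i j' = some y → y.ceil < w.ceil := by
    intro j' y' hj' hy'
    by_contra hc
    exact hmin j' hj' ⟨y', hy', not_lt.1 hc⟩
  have hI := hV.ok.inc.lines f
  rcases hwy.eq_or_lt with heq | hlt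
  · have hn := next_of_mem_line (hP.lp f) hI (hV.ok.conv f) hV.word hy heq.symm
    have hy' : lines f E i j = some ⟨w.ceil, y.primed⟩ := by rw [hy, heq]
    by_cases hd : f = false ∧ j = i
    · obtain ⟨rfl, rfl⟩ := hd
      have h1 : E j j = some ⟨w.ceil, false⟩ := by
        rw [show E j j = _ from hy', ← hV.ok.diag _ _ hy]
      exact ⟨_, _, _, Step.diagEq h1 hn (corner_of_lword hV.ok h1 hn hV.word)⟩
    · refine ⟨_, _, _, Step.switch (j := j) (fun h => fun h' => hd ⟨h, h'⟩)
        ⟨hy', hn, before, ?_, rfl, rfl⟩⟩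
      intro j' y' hj' hy'
      have := hI _ _ _ _ _ _ hn hy' le_rfl hj'.le (by omega)
      exact this
  · by_cases hd : f = false ∧ j = i
    · obtain ⟨rfl, rfl⟩ := hd
      exact ⟨_, _, _, Step.diag hy hlt⟩
    · refine ⟨_, _, _, Step.bump (j := j) (fun h => fun h' => hd ⟨h, h'⟩)
        ⟨hy, hlt, before, ?_, rfl⟩⟩
      intro j' y' hj' hy'
      exact hI _ _ _ _ _ _ hy hy' le_rfl hj'.le (by omega)

/-- The letter written when the insertion ends in position `j` of line `i`. -/
def lastLetter (f : Bool) (i j : ℕ) (w : Letter) : Letter :=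
  if f = false ∧ j = i then w.unprime else w

/-- The insertion ends in position `j` of line `i`, with direction flag `g`. -/
structure Fin (f : Bool) (E : Tab) (i : ℕ) (w : Letter) (U : Tab) (p : Box) (g : Bool) (j : ℕ) :
    Prop where
  empty : lines f E i j = none
  small : ∀ j' y, lines f E i j' = some y → y.ceil < w.ceil
  first : j = (if f then 0 else i) ∨ ∃ j0, j = j0 + 1 ∧ lines f E i j0 ≠ none
  eq : U = upd E (bx f i j).1 (bx f i j).2 (some (lastLetter f i j w))
  box : p = bx f i j
  flag : g = (f || (decide (j = i) && w.primed))

structure Corner (U : Tab) (p : Box) : Prop where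
  mem : U p.1 p.2 ≠ none
  right : U p.1 (p.2 + 1) = none
  up : U (p.1 + 1) p.2 = none

def FWord (z : Equiv.Perm ℤ) (U : Tab) : Prop :=
  Word (· ∈ RinvPlus z) (graph U) rowOrd (rthr 0) []

lemma fword_rows {U : Tab} (hU : Ok U) (i : ℕ) :
    FWord z U ↔ Word (· ∈ RinvPlus z) (graph U) rowOrd (rthr i) [] := by
  refine move_ok (good_RinvPlus z) hU rowOrd_injective rowOrd_injective (rowOrd_ne_rthr _)
    (rowOrd_ne_rthr _) ?_ ?_
  · intro p q _ _ h1 h2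
    exact absurd h1 h2.asymm
  · intro _ _ _ _ _ _ u hu
    simp at hu

lemma fword_cols {U : Tab} (hU : Ok U) (i : ℕ) :
    FWord z U ↔ Word (· ∈ RinvPlus z) (graph U) colOrd (thr i) [] :=
  word_rows_cols (good_RinvPlus z) hU (rowOrd_ne_rthr _) (colOrd_ne_thr _)

lemma upd_none_upd {F : Tab} {a b : ℕ} {x : Option Letter} (h : F a b = none) :
    upd (upd F a b x) a b none = F := by
  rw [upd_upd, upd_eq_self h]

/-- Appending a letter to a row. -/
lemma fword_append_row {j : ℕ} (hU : Ok (upd E i j (some (lastLetter false i j w))))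
    (hE : ∀ j', j ≤ j' → E i j' = none) (hd : ∀ a b, i < a → j = i → E a b = none)
    (hdom : ∀ b, b < i → E i b = none) :
    LWord (· ∈ RinvPlus z) false E i w ↔
      FWord z (upd E i j (some (lastLetter false i j w))) := by
  rw [lword_false, fword_rows hU i, graph_eq_insert (upd_self _ _ _ _), upd_none_upd (hE j le_rfl),
    word_emit_left]
  · unfold lastLetter
    split_ifs with h
    · have hmin : ∀ x ∈ graph E, rthr i < rowOrd x.1 := by
        rintro ⟨⟨a, b⟩, y⟩ hy
        rw [mem_graph] at hy
        have : a < i := by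
          by_contra hc
          rcases (not_lt.1 hc).eq_or_lt with rfl | hc
          · rcases lt_or_ge b i with hb | hb
            · rw [hdom b hb] at hy; simp at hy
            · rw [hE b (by omega)] at hy; simp at hy
          · rw [hd a b hc h.2] at hy; simp at hy
        simp only [rthr, rowOrd, key_lt]; omega
      constructor <;> intro hw
      · exact word_front hw hmin hmin fun b hb => RinvPlus.toggle hb
      · exact word_front hw hmin hmin fun b hb => RinvPlus.toggle hb
    · rfl
  · simp [mem_graph, hE j le_rfl]
  · simp only [rthr, rowOrd, key_lt]; omega
  · rintro ⟨⟨a, b⟩, y⟩ hy hlt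
    rw [mem_graph] at hy
    have : a = i → b < j := by
      rintro rfl
      by_contra hc
      rw [hE b (by omega)] at hy; simp at hy
    simp only [rthr, rowOrd, key_lt] at hlt ⊢
    omega

/-- Appending a letter to a column. -/
lemma fword_append_col {j : ℕ} (hU : Ok (upd E j i (some w)))
    (hE : ∀ j', j ≤ j' → E j' i = none) :
    LWord (· ∈ RinvPlus z) true E i w ↔ FWord z (upd E j i (some w)) := by
  rw [lword_true, fword_cols hU i, graph_eq_insert (upd_self _ _ _ _), upd_none_upd (hE j le_rfl),
    word_emit_right]
  · rfl
  · simp [mem_graph, hE j le_rfl]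
  · simp only [thr, colOrd, key_lt]; omega
  · rintro ⟨⟨a, b⟩, y⟩ hy hlt
    rw [mem_graph] at hy
    have : b = i → a < j := by
      rintro rfl
      by_contra hc
      rw [hE a (by omega)] at hy; simp at hy
    simp only [thr, colOrd, key_lt] at hlt ⊢
    omega

lemma Ok.add {r c : ℕ} {x : Letter} (hE : Ok E) (hrc : r ≤ c)
    (hrow : c = r ∨ ∃ c0, c = c0 + 1 ∧ E r c0 ≠ none)
    (hcol : r = 0 ∨ ∃ r0, r = r0 + 1 ∧ E r0 c ≠ none) (hI : Inc (OEG.upd E r c (some x)))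
    (hd : r = c → x.primed = false) : Ok (OEG.upd E r c (some x)) := by
  have key : ∀ a b, OEG.upd E r c (some x) a b ≠ none ↔ (a = r ∧ b = c) ∨ E a b ≠ none := by
    intro a b
    simp only [OEG.upd]
    split_ifs with h1
    · simp [h1]
    · simp [h1]
  refine ⟨fun a b => ?_, fun a b b' h1 h2 => ?_, fun a a' b h1 => ?_, hI, ?_⟩
  · rw [key]
    rintro (⟨rfl, rfl⟩ | h)
    · exact hrc
    · exact hE.dom _ _ h
  · rw [key, key]
    rintro (⟨rfl, rfl⟩ | h)
    · rcases h2.eq_or_lt with rfl | h2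
      · exact Or.inl ⟨rfl, rfl⟩
      · right
        rcases hrow with rfl | ⟨c0, rfl, h3⟩
        · omega
        · exact hE.row _ _ _ h1 (by omega) h3
    · exact Or.inr (hE.row _ _ _ h1 h2 h)
  · rw [key, key]
    rintro (⟨rfl, rfl⟩ | h)
    · rcases h1.eq_or_lt with rfl | h1
      · exact Or.inl ⟨rfl, rfl⟩
      · right
        rcases hcol with rfl | ⟨c0, rfl, h3⟩
        · omega
        · exact hE.col _ _ _ (by omega) h3
    · exact Or.inr (hE.col _ _ _ h1 h)
  · intro a y hy
    simp only [OEG.upd] at hy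
    split_ifs at hy with h1
    · rw [← Option.some.inj hy]
      exact hd (by omega)
    · exact hE.diag a y hy

lemma lastLetter_ceil {j : ℕ} : (lastLetter f i j w).ceil = w.ceil := by
  unfold lastLetter; split_ifs <;> rfl

lemma Fin.pos_le {U : Tab} {p : Box} {g : Bool} {j i0 b : ℕ} {x : Letter}
    (hE : Ok E) (hF : Fin f E (i0 + 1) w U p g j) (h : PrevAt f E i0 b x w) : j ≤ b := by
  rcases hF.first with hj | ⟨j0, rfl, hj0⟩
  · cases f
    · exact hj.le.trans (h.row rfl)
    · rw [hj]; exact Nat.zero_le _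
  · exact h.pos_le hE (fun j' y _ hy => hF.small j' y hy) ⟨j0, le_rfl, hj0⟩

lemma Fin.row_le {U : Tab} {p : Box} {g : Bool} {j : ℕ} (hE : Ok E)
    (hF : Fin false E i w U p g j) : i ≤ j := by
  rcases hF.first with hj | ⟨j0, rfl, hj0⟩
  · exact hj.ge
  · exact (hE.dom _ _ hj0).trans (by omega)

lemma Fin.after {U : Tab} {p : Box} {g : Bool} {j : ℕ} (hE : Ok E)
    (hF : Fin f E i w U p g j) (j' : ℕ) (hj : j ≤ j') : lines f E i j' = none := by
  by_contra h
  cases f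
  · exact hE.row _ _ _ (hF.row_le hE) hj h hF.empty
  · exact hE.col _ _ _ hj h hF.empty

lemma Fin.pos_lt {U : Tab} {p : Box} {g : Bool} {j : ℕ} (hE : Ok E) (hp : Prev true E i w)
    (hF : Fin true E i w U p g j) : j < i := by
  cases i with
  | zero => cases hp
  | succ i =>
    obtain ⟨b, x, h⟩ := hp
    have h1 := hF.pos_le hE h
    have h2 : b ≤ i := hE.dom b i (by rw [show E b i = some x from h.entry]; simp)
    omega

lemma Fin.beyond {U : Tab} {p : Box} {g : Bool} {j : ℕ} (hE : Ok E) (hp : Prev f E i w)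
    (hF : Fin f E i w U p g j) (i' j' : ℕ) (hi : i ≤ i') (hj : j ≤ j') :
    lines f E i' j' = none := by
  by_contra h
  cases f
  · exact hE.col _ _ _ hi h (hF.after hE j' hj)
  · have hji := hF.pos_lt hE hp
    exact hE.row _ _ _ hji.le hi (hE.col _ _ _ hj h) hF.empty

lemma Fin.result {U : Tab} {p : Box} {g : Bool} {j : ℕ}
    (hV : Valid (· ∈ RinvPlus z) f E i w) (hF : Fin f E i w U p g j) :
    Ok U ∧ FWord z U ∧ Corner U p ∧ E p.1 p.2 = none ∧ p.1 ≤ p.2 := by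
  have hE := hV.ok
  have hI : Inc (upd (lines f E) i j (some (lastLetter f i j w))) := by
    refine (hE.inc.lines f).upd ?_ ?_
    · rw [lastLetter_ceil]
      refine hV.prev.below' hE (fun j' y _ hy => hF.small j' y hy) ?_
      rintro i0 b x rfl h
      exact hF.pos_le hE h
    · intro i' j' y hi hj hn hy
      rw [hF.beyond hE hV.prev i' j' hi hj] at hy
      simp at hy
  have hU : upd E (bx f i j).1 (bx f i j).2 (some (lastLetter f i j w)) = U := hF.eq.symm
  have hI' : Inc U := by
    rw [← hU, ← lines_upd_lines]
    exact hI.lines f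
  have hne : E p.1 p.2 = none := by
    rw [hF.box, ← lines_apply f E i j]; exact hF.empty
  have hd : (bx f i j).1 = (bx f i j).2 → (lastLetter f i j w).primed = false := by
    intro h
    have hij := bx_diag.1 h
    cases f
    · simp [lastLetter, hij, Letter.unprime]
    · have := hF.pos_lt hE hV.prev
      omega
  have hOk : Ok U ∧ p.1 ≤ p.2 := by
    rw [← hU] at hI' ⊢
    rw [hF.box]
    cases f
    · have hij := hF.row_le hE
      refine ⟨hE.add hij ?_ ?_ hI' hd, hij⟩
      · rcases hF.first with h | h
        · exact Or.inl h
        · exact Or.inr h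
      · have hp := hV.prev
        cases i with
        | zero => exact Or.inl rfl
        | succ i0 =>
          obtain ⟨b, x, h⟩ := hp
          have h1 := hF.pos_le hE h
          refine Or.inr ⟨i0, rfl, hE.row i0 b j (by omega) h1 ?_⟩
          rw [show E i0 b = some x from h.entry]; simp
    · have hij := hF.pos_lt hE hV.prev
      refine ⟨hE.add hij.le ?_ ?_ hI' hd, hij.le⟩
      · have hp := hV.prev
        cases i with
        | zero => cases hp
        | succ i0 =>
          obtain ⟨b, x, h⟩ := hp
          have h1 := hF.pos_le hE h
          refine Or.inr ⟨i0, rfl, hE.col b j i0 h1 ?_⟩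
          rw [show E b i0 = some x from h.entry]; simp
      · rcases hF.first with h | h
        · exact Or.inl h
        · exact Or.inr h
  refine ⟨hOk.1, ?_, ⟨?_, ?_, ?_⟩, hne, hOk.2⟩
  · have hw := hV.word
    have hOk1 := hOk.1
    rw [← hU] at hOk1 ⊢
    cases f
    · refine (fword_append_row hOk1 (hF.after hE) ?_ ?_).1 hw
      · intro a b hia hji
        replace hia : i < a := hia
        replace hji : j = i := hji
        by_contra hc
        have := hE.dom _ _ hc
        exact hE.col _ _ _ hia.le hc (hF.after hE b (by omega))
      · intro b hb
        by_contra hc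
        exact absurd (hE.dom _ _ hc) (by omega)
    · have e : lastLetter true i j w = w := rfl
      rw [e] at hOk1 ⊢
      exact (fword_append_col hOk1 (hF.after hE)).1 hw
  · rw [hF.box, ← hU, upd_self]; simp
  · rw [hF.box, ← hU, upd_of_ne (by omega)]
    cases f
    · exact hF.beyond hE hV.prev i (j + 1) le_rfl (by omega)
    · exact hF.beyond hE hV.prev (i + 1) j (by omega) le_rfl
  · rw [hF.box, ← hU, upd_of_ne (by omega)]
    cases f
    · exact hF.beyond hE hV.prev (i + 1) j (by omega) le_rfl
    · exact hF.beyond hE hV.prev i (j + 1) le_rfl (by omega)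

lemma Fin.exists {n : ℕ} (hn : lines f E i n = none)
    (hin : i ≤ n) (hsmall : ∀ j y, lines f E i j = some y → y.ceil < w.ceil) :
    ∃ U p g j, Fin f E i w U p g j := by
  classical
  have hex : ∃ j, (if f then 0 else i) ≤ j ∧ lines f E i j = none :=
    ⟨n, by split_ifs <;> omega, hn⟩
  refine ⟨_, _, _, Nat.find hex, ⟨(Nat.find_spec hex).2, hsmall, ?_, rfl, rfl, rfl⟩⟩
  have h1 := (Nat.find_spec hex).1
  rcases h1.eq_or_lt with h | h
  · exact Or.inl h.symm
  · refine Or.inr ⟨Nat.find hex - 1, by omega, fun hc => ?_⟩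
    exact Nat.find_min hex (m := Nat.find hex - 1) (by omega) ⟨by omega, hc⟩

end

section

variable {z : Equiv.Perm ℤ} {E E' : Tab} {f f' : Bool} {i : ℕ} {w m : Letter}

/-! ### Reversing an insertion step -/

/-- The last entry of a line that is smaller than a given letter. -/
lemma exists_last_lt {E : Tab} (hE : Ok E) (hfin : ∃ n, lines f E i n = none ∧ i ≤ n) {b : ℕ}
    {x : Letter} (hb : lines f E i b = some x) (hx : x.ceil < m.ceil) :
    ∃ j y, b ≤ j ∧ lines f E i j = some y ∧ y.ceil < m.ceil ∧
      ∀ j' y', j < j' → lines f E i j' = some y' → m.ceil ≤ y'.ceil := by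
  classical
  obtain ⟨n, hn, hin⟩ := hfin
  have hlt : ∀ j, lines f E i j ≠ none → j < n := by
    intro j hj
    by_contra hc
    cases f
    · exact hE.row _ _ _ hin (not_lt.1 hc) hj hn
    · exact hE.col _ _ _ (not_lt.1 hc) hj hn
  let S := (Finset.range n).filter fun j => ∃ y, lines f E i j = some y ∧ y.ceil < m.ceil
  have hbS : b ∈ S := by
    simp only [S, Finset.mem_filter, Finset.mem_range]
    exact ⟨hlt b (by rw [hb]; simp), x, hb, hx⟩
  have hj := S.max'_mem ⟨b, hbS⟩
  simp only [S, Finset.mem_filter, Finset.mem_range] at hj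
  obtain ⟨hjn, y, hy, hym⟩ := hj
  refine ⟨S.max' ⟨b, hbS⟩, y, S.le_max' b hbS, hy, hym, ?_⟩
  intro j' y' _ hy'
  by_contra hc
  have : j' ∈ S := by
    simp only [S, Finset.mem_filter, Finset.mem_range]
    exact ⟨hlt j' (by rw [hy']; simp), y', hy', not_le.1 hc⟩
  have := S.le_max' j' this
  omega

/-- The predecessor data for a letter removed from position `j` of a line. -/
lemma prev_of_lines (hE : Ok E) {F : Tab} {j : ℕ} (hne : lines f E i j ≠ none)
    (hji : f = true → j < i) (hij : f = false → i ≤ j)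
    (hw : ∀ y, lines f E i j = some y → w.ceil = y.ceil)
    (hF : ∀ i' j', i' < i → lines f F i' j' = lines f E i' j')
    (hFw : ∀ y, lines f F i j = some y → w.ceil ≤ y.ceil)
    (hprime : f = true → j + 1 = i → ∀ y, lines f F i j = some y → y.ceil = w.ceil →
      y.primed = false) : Prev f F i w := by
  cases i with
  | zero =>
    cases f
    · rfl
    · exact absurd (hji rfl) (by omega)
  | succ i0 =>
    have h0 : lines f E i0 j ≠ none := by
      cases f
      · exact hE.col _ _ _ (by omega) hne
      · have h1 : j < i0 + 1 := hji rfl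
        exact hE.row _ _ _ (by omega) (by omega) hne
    obtain ⟨x, hx⟩ := Option.ne_none_iff_exists'.1 h0
    obtain ⟨y, hy⟩ := Option.ne_none_iff_exists'.1 hne
    refine ⟨j, x, ?_, ?_, hFw, hij, ?_⟩
    · rw [hF _ _ (by omega), hx]
    · rw [hw y hy]
      exact hE.inc.lines f _ _ _ _ _ _ hx hy (by omega) le_rfl (by omega)
    · rintro rfl hj
      exact hprime rfl (by omega)

lemma Valid.back_line (hV : Valid (· ∈ RinvPlus z) f E' (i + 1) m) {j b : ℕ} {x y : Letter}
    (hb : PrevAt f E' i b x m) (hbj : b ≤ j) (hy : lines f E' i j = some y)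
    (hym : y.ceil < m.ceil)
    (hlast : ∀ j' y', j < j' → lines f E' i j' = some y' → m.ceil ≤ y'.ceil)
    (hji : f = true → j < i) :
    ∃ E w, Valid (· ∈ RinvPlus z) f E i w ∧ Step f E i w f E' m := by
  have hP := good_RinvPlus z
  have hI := hV.ok.inc.lines f
  have hC := hV.ok.conv f
  have hij : f = false → i < j := fun hf => by have := hb.row hf; omega
  have hne : lines f E' i j ≠ none := by rw [hy]; simp
  by_cases hex : ∃ k v, lines f E' i k = some v ∧ v.ceil = m.ceil
  · obtain ⟨k, v, hk, hv⟩ := hex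
    obtain ⟨j0, rfl, hj0⟩ := prev_of_mem_line (hP.lp f) hI hC hV.word hk hv
    obtain rfl : j = j0 := by
      have h1 : ¬ j < j0 := fun h => by
        have h2 := hlast j0 _ h hj0
        simp at h2
      have h2 : ¬ j0 + 1 < j := fun h => by
        have := hI _ _ _ _ _ _ hk hy le_rfl h.le (by omega)
        omega
      have h3 : j ≠ j0 + 1 := by
        rintro rfl
        rw [hk] at hy
        have := Option.some.inj hy
        subst this
        omega
      omega
    set F := upd (upd (lines f E') i j (some ⟨m.ceil - 1, v.primed⟩)) i (j + 1)
      (some ⟨m.ceil, false⟩) with hF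
    have hFj : F i j = some ⟨m.ceil - 1, v.primed⟩ := by
      rw [hF, upd_of_ne (by omega), upd_self]
    have hFj1 : F i (j + 1) = some ⟨m.ceil, false⟩ := upd_self _ _ _ _
    have hFo : ∀ a b, ¬ (a = i ∧ b = j) → ¬ (a = i ∧ b = j + 1) → F a b = lines f E' a b := by
      intro a b h1 h2
      rw [hF, upd_of_ne h2, upd_of_ne h1]
    have hB : BumpC (lines f (lines f F)) i j ⟨m.ceil - 1, m.primed⟩ v.primed (lines f E') m := by
      rw [lines_lines]
      refine ⟨hFj, by simp [hFj1], ?_, ?_, ?_, by simp⟩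
      · intro j' y' hj' hy'
        rw [hFo _ _ (by omega) (by omega)] at hy'
        have := hI _ _ _ _ _ _ hy' hj0 le_rfl hj'.le (by omega)
        exact this
      · intro j' y' hj' hy'
        rw [hFo _ _ (by omega) (by omega)] at hy'
        have := hI _ _ _ _ _ _ hk hy' le_rfl hj'.le (by omega)
        simp only
        omega
      · funext a b
        by_cases h2 : a = i ∧ b = j + 1
        · obtain ⟨rfl, rfl⟩ := h2
          rw [upd_self, hk]
          simp [← hv]
        · by_cases h1 : a = i ∧ b = j
          · obtain ⟨rfl, rfl⟩ := h1
            rw [upd_of_ne (by omega), upd_self, hj0]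
          · rw [upd_of_ne h2, upd_of_ne h1, hFo _ _ h1 h2]
    have hF1 : Inc (upd (lines f E') i j (some ⟨m.ceil - 1, v.primed⟩)) := by
      refine hI.upd ?_ ?_
      · intro i' j' y' hi' hj' hn hy'
        have := hI _ _ _ _ _ _ hy' hj0 hi' hj' hn
        exact this
      · intro i' j' y' hi' hj' hn hy'
        have := hI _ _ _ _ _ _ hj0 hy' hi' hj' (by omega)
        exact this
    have hk1 : upd (lines f E') i j (some ⟨m.ceil - 1, v.primed⟩) i (j + 1) = some v := by
      rw [upd_of_ne (by omega), hk]
    have hFI : Inc F := by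
      refine hF1.upd ?_ ?_
      · intro i' j' y' hi' hj' hn hy'
        have := hF1 _ _ _ _ _ _ hy' hk1 hi' hj' hn
        simp only; omega
      · intro i' j' y' hi' hj' hn hy'
        have := hF1 _ _ _ _ _ _ hk1 hy' hi' hj' (by omega)
        simp only; omega
    have e : lines f F = upd (upd E' (bx f i j).1 (bx f i j).2 (some ⟨m.ceil - 1, v.primed⟩))
        (bx f i (j + 1)).1 (bx f i (j + 1)).2 (some ⟨m.ceil, false⟩) := by
      rw [hF, lines_upd, lines_upd_lines]
    have hOk : Ok (lines f F) := by
      rw [e]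
      have e1 : Ok (upd E' (bx f i j).1 (bx f i j).2 (some ⟨m.ceil - 1, v.primed⟩)) := by
        refine hV.ok.upd (by rw [← lines_apply f E' i j]; exact hne) ?_ fun hd => ?_
        · rw [← lines_upd_lines]
          exact hF1.lines f
        · have := bx_diag.1 hd
          cases f
          · have := hij rfl; omega
          · have := hji rfl; omega
      refine e1.upd ?_ ?_ fun _ => rfl
      · have e2 := hk1
        rw [← lines_lines f (OEG.upd _ _ _ _), lines_upd_lines, lines_apply] at e2
        rw [e2]; simp
      · rw [← e]; exact hFI.lines f
    refine ⟨lines f F, ⟨m.ceil - 1, m.primed⟩, ⟨hOk, ?_, ?_⟩, ?_⟩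
    · exact (hB.word (hP.lp f)).2 hV.word
    · refine prev_of_lines hV.ok hne hji (fun hf => (hij hf).le) ?_ ?_ ?_ ?_
      · intro y' hy'
        rw [hj0] at hy'
        rw [← Option.some.inj hy']
      · intro i' j' hi'
        rw [lines_lines, hFo _ _ (by omega) (by omega)]
      · intro y' hy'
        rw [lines_lines, hFj] at hy'
        rw [← Option.some.inj hy']
      · intro hf hj y' hy' _
        rw [lines_lines, hFj] at hy'
        rw [← Option.some.inj hy']
        subst hf
        rw [hj] at hk
        show v.primed = false
        exact hV.ok.diag i v hk
    · have := Step.switch (f := f) (fun hf => (hij hf).ne') hB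
      rwa [lines_lines] at this
  · push Not at hex
    have hlast' : ∀ j' y', j < j' → lines f E' i j' = some y' → m.ceil < y'.ceil := by
      intro j' y' hj' hy'
      have := hlast j' y' hj' hy'
      have := hex j' y' hy'
      omega
    set F := upd (lines f E') i j (some m) with hF
    have hB : BumpA (lines f (lines f F)) i j y (lines f E') m := by
      rw [lines_lines]
      refine ⟨upd_self _ _ _ _, hym, ?_, ?_, ?_⟩
      · intro j' y' hj' hy'
        rw [hF, upd_of_ne (by omega)] at hy'
        exact hI _ _ _ _ _ _ hy' hy le_rfl hj'.le (by omega)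
      · intro j' y' hj' hy'
        rw [hF, upd_of_ne (by omega)] at hy'
        exact hlast' j' y' hj' hy'
      · rw [hF, upd_upd, upd_eq_self hy]
    have hnext : ∀ y', lines f E' (i + 1) j = some y' → m.ceil < y'.ceil := by
      intro y' hy'
      have hne' : lines f E' (i + 1) j ≠ none := by rw [hy']; simp
      rcases hbj.eq_or_lt with rfl | hlt
      · refine (hb.le y' hy').lt_of_ne fun heq => ?_
        have h1 := next_of_mem_line (hP.lp f) hI hC hV.word hy' heq.symm
        have h2 : lines f E' i (b + 1) ≠ none := by
          cases f
          · refine hV.ok.col _ _ _ (Nat.le_succ i) ?_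
            rw [show E' (i + 1) (b + 1) = _ from h1]; simp
          · have := hji rfl
            refine hV.ok.row _ _ _ (by omega) (Nat.le_succ i) ?_
            rw [show E' (b + 1) (i + 1) = _ from h1]; simp
        obtain ⟨v, hv⟩ := Option.ne_none_iff_exists'.1 h2
        have h3 := hlast' _ v (by omega) hv
        have h4 := hI _ _ _ _ _ _ hv h1 (by omega) le_rfl (by omega)
        simp only at h4
        omega
      · have h2 : lines f E' (i + 1) b ≠ none := by
          cases f
          · exact hV.ok.row _ _ _ (hb.row rfl) hlt.le hne'
          · exact hV.ok.col _ _ _ hlt.le hne'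
        obtain ⟨v, hv⟩ := Option.ne_none_iff_exists'.1 h2
        have h3 := hb.le v hv
        have h4 := hI _ _ _ _ _ _ hv hy' le_rfl hlt.le (by omega)
        omega
    have hFI : Inc F := by
      refine hI.upd ?_ ?_
      · intro i' j' y' hi' hj' hn hy'
        exact (hI _ _ _ _ _ _ hy' hy hi' hj' hn).trans hym
      · intro i' j' y' hi' hj' hn hy'
        rcases hi'.eq_or_lt with rfl | hi'
        · exact hlast' j' y' (by omega) hy'
        · have hne' : lines f E' i' j' ≠ none := by rw [hy']; simp
          have h2 : lines f E' (i + 1) j ≠ none := by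
            cases f
            · have := hV.ok.dom _ _ hne'
              have := hb.row rfl
              exact hV.ok.row _ _ _ (by omega) hj' (hV.ok.col _ _ _ hi' hne')
            · have := hji rfl
              exact hV.ok.row _ _ _ (by omega) hi' (hV.ok.col _ _ _ hj' hne')
          obtain ⟨v, hv⟩ := Option.ne_none_iff_exists'.1 h2
          have h3 := hnext v hv
          by_cases hs : i' = i + 1 ∧ j' = j
          · obtain ⟨rfl, rfl⟩ := hs
            rw [hv] at hy'
            rwa [← Option.some.inj hy']
          · exact h3.trans (hI _ _ _ _ _ _ hv hy' hi' hj' (by omega))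
    have hOk : Ok (lines f F) := by
      have e : lines f F = upd E' (bx f i j).1 (bx f i j).2 (some m) := by
        rw [hF, lines_upd_lines]
      rw [e]
      refine hV.ok.upd (by rw [← lines_apply f E' i j]; exact hne) ?_ fun hd => ?_
      · rw [← e]
        exact hFI.lines f
      · have := bx_diag.1 hd
        cases f
        · have := hij rfl; omega
        · have := hji rfl; omega
    refine ⟨lines f F, y, ⟨hOk, ?_, ?_⟩, ?_⟩
    · exact (hB.word (hP.lp f)).2 hV.word
    · refine prev_of_lines hV.ok hne hji (fun hf => (hij hf).le) ?_ ?_ ?_ ?_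
      · intro y' hy'
        rw [hy] at hy'
        rw [← Option.some.inj hy']
      · intro i' j' hi'
        rw [lines_lines, hF, upd_of_ne (by omega)]
      · intro y' hy'
        rw [lines_lines, hF, upd_self] at hy'
        rw [← Option.some.inj hy']
        exact hym.le
      · intro hf hj y' hy' hc
        rw [lines_lines, hF, upd_self] at hy'
        rw [← Option.some.inj hy'] at hc
        omega
    · have := Step.bump (f := f) (fun hf => (hij hf).ne') hB
      rwa [lines_lines] at this

lemma Valid.back_diag (hV : Valid (· ∈ RinvPlus z) true E' (i + 1) m) {b : ℕ} {x D : Letter}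
    (hb : PrevAt true E' i b x m) (hD : E' i i = some D) (hDm : D.ceil < m.ceil) :
    ∃ E w, Valid (· ∈ RinvPlus z) false E i w ∧ Step false E i w true E' m := by
  have hP := good_RinvPlus z
  have hE := hV.ok
  have hDp := hE.diag _ _ hD
  have hbi : b ≤ i := hE.dom b i (by rw [show E' b i = some x from hb.entry]; simp)
  have hprev : ∀ F : Tab, (∀ a c, a < i → F a c = E' a c) →
      (∀ y, F i i = some y → D.ceil ≤ y.ceil) → ∀ p, Prev false F i ⟨D.ceil, p⟩ := by
    intro F hF hy p
    cases i with
    | zero => rfl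
    | succ i0 =>
      obtain ⟨u, hu⟩ := Option.ne_none_iff_exists'.1
        (hE.col (i0 + 1) i0 (i0 + 1) (by omega) (by rw [hD]; simp))
      refine ⟨i0 + 1, u, ?_, ?_, hy, fun _ => le_rfl, by simp⟩
      · exact (hF _ _ (by omega)).trans hu
      · have h5 : u.ceil < D.ceil :=
          hE.inc i0 (i0 + 1) (i0 + 1) (i0 + 1) _ _ hu hD (by omega) le_rfl (by omega)
        exact h5
  have hrow : ∀ y, E' i (i + 1) = some y → m.ceil ≤ y.ceil ∧ (y.ceil = m.ceil → b = i) := by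
    intro y hy
    obtain ⟨v, hv⟩ := Option.ne_none_iff_exists'.1
      (hE.col i b (i + 1) hbi (by rw [hy]; simp))
    have h1 := hb.le v hv
    rcases hbi.eq_or_lt with rfl | hlt
    · rw [hy] at hv
      rw [Option.some.inj hv]
      exact ⟨h1, fun _ => rfl⟩
    · have := hE.inc _ _ _ _ _ _ hv hy hbi le_rfl (by omega)
      exact ⟨by omega, by omega⟩
  by_cases hex : ∃ y, E' i (i + 1) = some y ∧ y.ceil = m.ceil
  · obtain ⟨y, hy, hym⟩ := hex
    obtain rfl := (hrow y hy).2 hym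
    have hyp := hb.prime rfl rfl y hy hym
    have h3 : E' (b + 1) (b + 1) = some ⟨m.ceil + 1, false⟩ :=
      next_of_mem_line (hP.lp true) (hE.inc.lines true) (hE.conv true) hV.word
        (show lines true E' (b + 1) b = some y from hy) hym
    have h4 := diag_of_lword hE hD hDm hy hym h3 hV.word
    have h1 : E' b b = some ⟨(⟨m.ceil - 1, m.primed⟩ : Letter).ceil, false⟩ := by
      rw [hD, ← h4, ← hDp]
    have h2 : E' b (b + 1) = some ⟨(⟨m.ceil - 1, m.primed⟩ : Letter).ceil + 1, false⟩ := by
      rw [hy, ← hyp]; simp [← hym]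
    have h3' : E' (b + 1) (b + 1) = some ⟨(⟨m.ceil - 1, m.primed⟩ : Letter).ceil + 2, false⟩ := by
      rw [h3]; congr 2; simp only; omega
    have hm : (⟨(⟨m.ceil - 1, m.primed⟩ : Letter).ceil + 1,
      (⟨m.ceil - 1, m.primed⟩ : Letter).primed⟩ : Letter) = m := by simp
    refine ⟨E', ⟨m.ceil - 1, m.primed⟩, ⟨hE, ?_, ?_⟩, ?_⟩
    · rw [lword_diagEq hE h1 h2 h3', hm]
      exact hV.word
    · rw [← h4]
      refine hprev E' (fun _ _ _ => rfl) ?_ _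
      intro v hv
      rw [hD] at hv
      rw [← Option.some.inj hv]
    · have := Step.diagEq h1 h2 h3'
      rwa [hm] at this
  · push Not at hex
    set E := upd E' i i (some ⟨m.ceil, false⟩) with hEdef
    have hEd : E i i = some ⟨m.ceil, false⟩ := upd_self _ _ _ _
    have hback : upd E i i (some (⟨D.ceil, m.primed⟩ : Letter).unprime) = E' := by
      rw [hEdef, upd_upd]
      refine upd_eq_self ?_
      rw [hD]
      exact congrArg some (show D = ⟨D.ceil, false⟩ by rw [← hDp])
    have hEI : Inc E := by
      refine hE.inc.upd ?_ ?_
      · intro i' j' y' hi' hj' hn hy'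
        exact (hE.inc _ _ _ _ _ _ hy' hD hi' hj' hn).trans hDm
      · intro i' j' y' hi' hj' hn hy'
        have hne' : E' i' j' ≠ none := by rw [hy']; simp
        have hdom := hE.dom _ _ hne'
        obtain ⟨v, hv⟩ := Option.ne_none_iff_exists'.1
          (hE.row i j' (i + 1) (by omega) (by omega) (hE.col _ _ _ hi' hne'))
        have h1 := (hrow v hv).1
        have h2 := hex v hv
        by_cases hs : i' = i ∧ j' = i + 1
        · obtain ⟨rfl, rfl⟩ := hs
          rw [hv] at hy'
          rw [← Option.some.inj hy']
          simp only; omega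
        · have := hE.inc _ _ _ _ _ _ hv hy' hi' (by omega) (by omega)
          simp only; omega
    have hEOk : Ok E := hE.upd (by rw [hD]; simp) hEI fun _ => rfl
    have hlt : (⟨D.ceil, m.primed⟩ : Letter).ceil < (⟨m.ceil, false⟩ : Letter).ceil := hDm
    refine ⟨E, ⟨D.ceil, m.primed⟩, ⟨hEOk, ?_, ?_⟩, ?_⟩
    · rw [lword_diag hEOk hEd hlt (by rw [hback]; exact hE), hback]
      exact hV.word
    · refine hprev E ?_ ?_ _
      · intro a c ha
        rw [hEdef, upd_of_ne (by omega)]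
      · intro y hy
        rw [hEd] at hy
        rw [← Option.some.inj hy]
        exact hDm.le
    · have := Step.diag hEd hlt
      rwa [hback] at this

lemma Valid.back (hV : Valid (· ∈ RinvPlus z) f' E' (i + 1) m)
    (hfin : ∃ n, lines f' E' i n = none ∧ i ≤ n) :
    ∃ f E w, Valid (· ∈ RinvPlus z) f E i w ∧ Step f E i w f' E' m := by
  obtain ⟨b, x, hb⟩ := hV.prev
  obtain ⟨j, y, hbj, hy, hym, hlast⟩ := exists_last_lt hV.ok hfin hb.entry hb.lt
  by_cases hji : f' = true → j < i
  · exact ⟨f', hV.back_line hb hbj hy hym hlast hji⟩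
  · push Not at hji
    obtain ⟨rfl, hij⟩ := hji
    obtain rfl : j = i := le_antisymm (hV.ok.dom j i (by
      rw [show E' j i = some y from hy]; simp)) hij
    exact ⟨false, hV.back_diag hb hy hym⟩

end

section

variable {z : Equiv.Perm ℤ} {E E' E1 E2 U : Tab} {f f' f1 f2 g : Bool} {i j : ℕ} {p : Box}
  {w w1 w2 m : Letter}

/-! ### Uniqueness of predecessors -/

lemma Step.inv (h : Step f E i w f' E' m) :
    (f' = f ∧ ∃ j, (f = false → j ≠ i) ∧ BumpA (lines f E) i j w (lines f E') m) ∨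
    (f' = f ∧ ∃ j p, (f = false → j ≠ i) ∧ BumpC (lines f E) i j w p (lines f E') m) ∨
    (f = false ∧ f' = true ∧ ∃ d, E i i = some d ∧ w.ceil < d.ceil ∧
      E' = upd E i i (some w.unprime) ∧ m = ⟨d.ceil, w.primed⟩) ∨
    (f = false ∧ f' = true ∧ E i i = some ⟨w.ceil, false⟩ ∧
      E i (i + 1) = some ⟨w.ceil + 1, false⟩ ∧ E' = E ∧ m = ⟨w.ceil + 1, w.primed⟩) := by
  cases h with
  | @bump _ _ _ j _ _ _ hj h => exact Or.inl ⟨rfl, j, hj, by rwa [lines_lines]⟩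
  | @switch _ _ _ j _ p _ _ hj h => exact Or.inr (Or.inl ⟨rfl, j, p, hj, by rwa [lines_lines]⟩)
  | @diag _ _ _ d hd h => exact Or.inr (Or.inr (Or.inl ⟨rfl, rfl, d, hd, h, rfl, rfl⟩))
  | diagEq h1 h2 h3 => exact Or.inr (Or.inr (Or.inr ⟨rfl, rfl, h1, h2, rfl, rfl⟩))

lemma lines_inj {E1 E2 : Tab} (h : lines f E1 = lines f E2) : E1 = E2 := by
  rw [← lines_lines f E1, h, lines_lines]

lemma BumpA.line {F G : Tab} (h : BumpA F i j w G m) (hI : Inc G) (j' : ℕ) (y : Letter)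
    (hy : G i j' = some y) : (j' ≤ j → y.ceil < m.ceil) ∧ (j < j' → m.ceil < y.ceil) := by
  have hw : G i j = some w := by rw [h.eq, upd_self]
  constructor
  · intro hj
    rcases hj.eq_or_lt with rfl | hj
    · rw [hw] at hy
      rw [← Option.some.inj hy]; exact h.lt
    · exact (hI _ _ _ _ _ _ hy hw le_rfl hj.le (by omega)).trans h.lt
  · intro hj
    refine h.after j' y hj ?_
    rw [← hy, h.eq, upd_of_ne (by omega)]

lemma BumpA.unique {F1 F2 G : Tab} {j1 j2 : ℕ} (hI : Inc G) (h1 : BumpA F1 i j1 w1 G m)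
    (h2 : BumpA F2 i j2 w2 G m) : F1 = F2 ∧ w1 = w2 := by
  have e1 : G i j1 = some w1 := by rw [h1.eq, upd_self]
  have e2 : G i j2 = some w2 := by rw [h2.eq, upd_self]
  obtain rfl : j1 = j2 := by
    have a1 := (h1.line hI _ _ e2).2
    have a2 := (h2.line hI _ _ e1).2
    have := h1.lt
    have := h2.lt
    by_contra hne
    rcases Nat.lt_or_gt_of_ne hne with h | h
    · have := a1 h; omega
    · have := a2 h; omega
  refine ⟨?_, Option.some.inj (e1.symm.trans e2)⟩
  rw [← upd_eq_self h1.entry, ← upd_eq_self h2.entry, ← upd_upd F1 i j1 (some w1),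
    ← upd_upd F2 i j1 (some w2), ← h1.eq, ← h2.eq]

lemma BumpC.line {F G : Tab} {p : Bool} (h : BumpC F i j w p G m) :
    G i j = some ⟨m.ceil - 1, false⟩ ∧ G i (j + 1) = some ⟨m.ceil, p⟩ := by
  have := h.out
  constructor
  · rw [h.eq, upd_of_ne (by omega), upd_self, this]; simp
  · rw [h.eq, upd_self, this]

lemma BumpC.unique {F1 F2 G : Tab} {j1 j2 : ℕ} {p1 p2 : Bool} (hI : Inc G)
    (h1 : BumpC F1 i j1 w1 p1 G m) (h2 : BumpC F2 i j2 w2 p2 G m) : F1 = F2 ∧ w1 = w2 := by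
  have e1 := h1.line.2
  have e2 := h2.line.2
  obtain rfl : j1 = j2 := by
    by_contra hne
    rcases Nat.lt_or_gt_of_ne hne with h | h
    · have := hI _ _ _ _ _ _ e1 e2 le_rfl (by omega) (by omega)
      simp at this
    · have := hI _ _ _ _ _ _ e2 e1 le_rfl (by omega) (by omega)
      simp at this
  rw [e1] at e2
  have hp : p1 = p2 := by simpa using e2
  have hw : w1 = w2 := by
    have o1 := h1.out
    have o2 := h2.out
    rw [o1] at o2
    cases w1; cases w2
    simpa using o2
  subst hp hw
  refine ⟨?_, rfl⟩
  have := h1.eq.symm.trans h2.eq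
  funext a b
  by_cases hb : a = i ∧ b = j1
  · rw [hb.1, hb.2, h1.entry, h2.entry]
  · by_cases hb' : a = i ∧ b = j1 + 1
    · rw [hb'.1, hb'.2, h1.next, h2.next]
    · have := congrFun (congrFun this a) b
      rwa [upd_of_ne hb', upd_of_ne hb, upd_of_ne hb', upd_of_ne hb] at this

lemma BumpA.not_bumpC {F1 F2 G : Tab} {j1 j2 : ℕ} {p2 : Bool} (hI : Inc G)
    (h1 : BumpA F1 i j1 w1 G m) (h2 : BumpC F2 i j2 w2 p2 G m) : False := by
  obtain ⟨a, b⟩ := h1.line hI _ _ h2.line.2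
  rcases Nat.lt_or_ge j1 (j2 + 1) with h | h
  · exact lt_irrefl _ (b h)
  · exact lt_irrefl _ (a h)

lemma Step.unique (hV1 : Valid (· ∈ RinvPlus z) f1 E1 i w1) (hV2 : Valid (· ∈ RinvPlus z) f2 E2 i w2)
    (h1 : Step f1 E1 i w1 f' E' m) (h2 : Step f2 E2 i w2 f' E' m) :
    f1 = f2 ∧ E1 = E2 ∧ w1 = w2 := by
  have hE' := (hV1.step h1).ok
  have hI := hE'.inc
  have colA : ∀ {E w j d}, Valid (· ∈ RinvPlus z) true E i w →
      BumpA (lines true E) i j w (lines true E') m → E' i i = some d → m.ceil < d.ceil := by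
    intro E w j d hV h hd
    have := hV.prev.col_lt hV.ok h.before ⟨j, by omega, by rw [h.entry]; simp⟩
    exact (h.line (hI.lines true) i d hd).2 this
  have colC : ∀ {E w j p d}, Valid (· ∈ RinvPlus z) true E i w →
      BumpC (lines true E) i j w p (lines true E') m → E' i i = some d → m.ceil ≤ d.ceil := by
    intro E w j p d hV h hd
    have := hV.prev.col_lt hV.ok h.before ⟨j, by omega, by rw [h.entry]; simp⟩
    have h2 := h.line.2
    rcases Nat.lt_or_ge (j + 1) i with h3 | h3
    · have := hI.lines true i (j + 1) i i _ _ h2 hd le_rfl h3.le (by omega)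
      exact this.le
    · obtain rfl : i = j + 1 := by omega
      have := h2.symm.trans hd
      rw [← Option.some.inj this]
  have dia : ∀ {E w d}, Valid (· ∈ RinvPlus z) false E i w → E i i = some d → w.ceil < d.ceil →
      E' = upd E i i (some w.unprime) → m = ⟨d.ceil, w.primed⟩ →
      E' i i = some w.unprime ∧ w.unprime.ceil < m.ceil ∧
      E = upd E' i i (some ⟨m.ceil, false⟩) ∧
      ∀ y, E' i (i + 1) = some y → m.ceil < y.ceil := by
    rintro E w d hV hd hw rfl rfl
    refine ⟨upd_self _ _ _ _, hw, ?_, ?_⟩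
    · rw [upd_upd, upd_eq_self]
      rw [hd, ← hV.ok.diag _ _ hd]
    · intro y hy
      rw [upd_of_ne (by omega)] at hy
      have h6 : d.ceil < y.ceil :=
        hV.ok.inc i i i (i + 1) _ _ hd hy le_rfl (by omega) (by omega)
      exact h6
  rcases h1.inv with ⟨rfl, j1, -, h1⟩ | ⟨rfl, j1, p1, -, h1⟩ | ⟨rfl, rfl, d1, a1, b1, c1, e1⟩ |
      ⟨rfl, rfl, a1, b1, c1, e1⟩ <;>
    rcases h2.inv with ⟨hf, j2, -, h2⟩ | ⟨hf, j2, p2, -, h2⟩ | ⟨rfl, hf, d2, a2, b2, c2, e2⟩ |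
      ⟨rfl, hf, a2, b2, c2, e2⟩
  · subst hf
    obtain ⟨ha, hb⟩ := h1.unique (hI.lines _) h2
    exact ⟨rfl, lines_inj ha, hb⟩
  · subst hf
    exact (h1.not_bumpC (hI.lines _) h2).elim
  · subst hf
    obtain ⟨h3, h4, -, -⟩ := dia hV2 a2 b2 c2 e2
    have := colA hV1 h1 h3
    omega
  · subst hf
    subst c2
    have := colA hV1 h1 a2
    rw [e2] at this
    simp only at this
    omega
  · subst hf
    exact (h2.not_bumpC (hI.lines _) h1).elim
  · subst hf
    obtain ⟨ha, hb⟩ := h1.unique (hI.lines _) h2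
    exact ⟨rfl, lines_inj ha, hb⟩
  · subst hf
    obtain ⟨h3, h4, -, -⟩ := dia hV2 a2 b2 c2 e2
    have := colC hV1 h1 h3
    omega
  · subst hf
    subst c2
    have := colC hV1 h1 a2
    rw [e2] at this
    simp only at this
    omega
  · subst hf
    obtain ⟨h3, h4, -, -⟩ := dia hV1 a1 b1 c1 e1
    have := colA hV2 h2 h3
    omega
  · subst hf
    obtain ⟨h3, h4, -, -⟩ := dia hV1 a1 b1 c1 e1
    have := colC hV2 h2 h3
    omega
  · obtain ⟨h3, h4, h5, -⟩ := dia hV1 a1 b1 c1 e1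
    obtain ⟨k3, k4, k5, -⟩ := dia hV2 a2 b2 c2 e2
    refine ⟨rfl, h5.trans k5.symm, ?_⟩
    rw [h3] at k3
    rw [e1] at e2
    cases w1; cases w2
    simp [Letter.unprime] at k3 e2 ⊢
    exact ⟨k3, e2.2⟩
  · obtain ⟨h3, h4, h5, h6⟩ := dia hV1 a1 b1 c1 e1
    have := h6 _ (by rw [c2]; exact b2)
    rw [e2] at this
    simp at this
  · subst hf
    subst c1
    have := colA hV2 h2 a1
    rw [e1] at this
    simp only at this
    omega
  · subst hf
    subst c1
    have := colC hV2 h2 a1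
    rw [e1] at this
    simp only at this
    omega
  · obtain ⟨h3, h4, h5, h6⟩ := dia hV2 a2 b2 c2 e2
    have := h6 _ (by rw [c1]; exact b1)
    rw [e1] at this
    simp at this
  · refine ⟨rfl, c1.symm.trans c2, ?_⟩
    rw [e1] at e2
    cases w1; cases w2
    simpa using e2

/-! ### Complete insertions -/

/-- The line where an insertion ends. -/
def lastLine (p : Box) (g : Bool) : ℕ := if g = true ∧ p.1 ≠ p.2 then p.2 else p.1

lemma Fin.line (hV : Valid (· ∈ RinvPlus z) f E i w) (hF : Fin f E i w U p g j) :
    i = lastLine p g ∧ f = decide (g = true ∧ p.1 ≠ p.2) := by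
  have hb := hF.box
  have hg := hF.flag
  unfold lastLine
  cases f
  · by_cases hji : j = i
    · subst hji hb
      simp [bx]
    · simp only [hji, decide_false, Bool.false_and, Bool.or_false] at hg
      subst hg hb
      simp [bx]
  · have := hF.pos_lt hV.ok hV.prev
    subst hg hb
    simp [bx, this.ne]

lemma Fin.unique {j1 j2 i1 i2 : ℕ} (hV1 : Valid (· ∈ RinvPlus z) f1 E1 i1 w1)
    (hV2 : Valid (· ∈ RinvPlus z) f2 E2 i2 w2) (h1 : Fin f1 E1 i1 w1 U p g j1)
    (h2 : Fin f2 E2 i2 w2 U p g j2) : f1 = f2 ∧ E1 = E2 ∧ w1 = w2 := by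
  obtain ⟨a1, b1⟩ := h1.line hV1
  obtain ⟨a2, b2⟩ := h2.line hV2
  obtain rfl := b1.trans b2.symm
  obtain rfl := a1.trans a2.symm
  have hj : j1 = j2 := by
    have := h1.box.symm.trans h2.box
    cases f1
    · exact (Prod.mk.inj this).2
    · exact (Prod.mk.inj this).1
  subst hj
  refine ⟨rfl, ?_, ?_⟩
  · have e1 := h1.empty
    have e2 := h2.empty
    rw [lines_apply] at e1 e2
    rw [← upd_none_upd (x := some (lastLetter f1 i1 j1 w1)) e1,
      ← upd_none_upd (x := some (lastLetter f1 i1 j1 w2)) e2, ← h1.eq, ← h2.eq]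
  · have e := congrFun (congrFun (h1.eq.symm.trans h2.eq) (bx f1 i1 j1).1) (bx f1 i1 j1).2
    rw [upd_self, upd_self] at e
    replace e := Option.some.inj e
    have hg := h1.flag.symm.trans h2.flag
    unfold lastLetter at e
    split_ifs at e with hc
    · obtain ⟨rfl, rfl⟩ := hc
      simp only [decide_true, Bool.true_and, Bool.false_or] at hg
      cases w1; cases w2
      simp [Letter.unprime] at e hg ⊢
      exact ⟨e, hg⟩
    · exact e

lemma Ok.remove (hE : Ok U) {r c : ℕ} (h1 : U r (c + 1) = none) (h2 : U (r + 1) c = none) :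
    Ok (OEG.upd U r c none) := by
  have key : ∀ a b, OEG.upd U r c none a b ≠ none ↔ U a b ≠ none ∧ ¬ (a = r ∧ b = c) := by
    intro a b
    simp only [OEG.upd]
    split_ifs with h1
    · simp [h1]
    · simp [h1]
  refine ⟨fun a b => ?_, fun a b b' h3 h4 => ?_, fun a a' b h3 => ?_, ?_, ?_⟩
  · rw [key]
    exact fun h => hE.dom _ _ h.1
  · rw [key, key]
    rintro ⟨h5, h6⟩
    refine ⟨hE.row _ _ _ h3 h4 h5, ?_⟩
    rintro ⟨rfl, rfl⟩
    exact hE.row _ _ _ (by omega) (by omega) h5 h1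
  · rw [key, key]
    rintro ⟨h5, h6⟩
    refine ⟨hE.col _ _ _ h3 h5, ?_⟩
    rintro ⟨rfl, rfl⟩
    exact hE.col _ _ _ (by omega) h5 h2
  · intro a b a' b' x y hx hy
    have hx' : U a b = some x := by
      rw [← hx, upd_of_ne ((key a b).1 (by rw [hx]; simp)).2]
    have hy' : U a' b' = some y := by
      rw [← hy, upd_of_ne ((key a' b').1 (by rw [hy]; simp)).2]
    exact hE.inc _ _ _ _ _ _ hx' hy'
  · intro a x hx
    have hx' : U a a = some x := by
      rw [← hx, upd_of_ne ((key a a).1 (by rw [hx]; simp)).2]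
    exact hE.diag _ _ hx'

lemma Fin.back (hU : Ok U) (hW : FWord z U) (hp : Corner U p) (g : Bool) :
    ∃ f E i w j, Valid (· ∈ RinvPlus z) f E i w ∧ Fin f E i w U p g j := by
  obtain ⟨r, c⟩ := p
  obtain ⟨h1, h2, h3⟩ := hp
  simp only at h1 h2 h3
  obtain ⟨x, hx⟩ := Option.ne_none_iff_exists'.1 h1
  have hrc := hU.dom _ _ h1
  have hr : ∀ c', c < c' → U r c' = none := by
    intro c' hc
    by_contra h
    exact hU.row _ _ _ (by omega) hc h h2
  have hc : ∀ r', r < r' → U r' c = none := by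
    intro r' hr
    by_contra h
    exact hU.col _ _ _ hr h h3
  set E := upd U r c none with hEdef
  have hE : Ok E := hU.remove h2 h3
  have hEe : E r c = none := upd_self _ _ _ _
  have hEo : ∀ a b, ¬ (a = r ∧ b = c) → E a b = U a b := fun a b h => upd_of_ne h
  have hUE : ∀ y, y = x → upd E r c (some y) = U := by
    rintro y rfl
    rw [hEdef, upd_upd, upd_eq_self hx]
  by_cases hg : g = true ∧ r ≠ c
  · obtain ⟨rfl, hne⟩ := hg
    have hEr : ∀ j', r ≤ j' → E j' c = none := by
      intro j' hj
      rcases hj.eq_or_lt with rfl | hj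
      · exact hEe
      · rw [hEo _ _ (by omega)]; exact hc _ hj
    refine ⟨true, E, c, x, r, ⟨hE, ?_, ?_⟩, hEe, ?_, ?_, (hUE x rfl).symm, rfl, rfl⟩
    · rw [fword_append_col (by rw [hUE x rfl]; exact hU) hEr, hUE x rfl]
      exact hW
    · obtain ⟨c0, rfl⟩ : ∃ c0, c = c0 + 1 := ⟨c - 1, by omega⟩
      obtain ⟨u, hu⟩ := Option.ne_none_iff_exists'.1
        (hU.row r (c0 + 1) c0 (by omega) (by omega) (by rw [hx]; simp))
      refine ⟨r, u, ?_, ?_, ?_, by simp, ?_⟩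
      · exact (hEo _ _ (by omega)).trans hu
      · exact hU.inc _ _ _ _ _ _ hu hx le_rfl (by omega) (by omega)
      · intro y hy
        rw [show lines true E (c0 + 1) r = none from hEe] at hy
        simp at hy
      · intro _ _ y hy
        rw [show lines true E (c0 + 1) r = none from hEe] at hy
        simp at hy
    · intro j' y hy
      have hy' : E j' c = some y := hy
      have hj : j' < r := by
        by_contra hj
        rw [hEr j' (by omega)] at hy'
        simp at hy'
      rw [hEo _ _ (by omega)] at hy'
      exact hU.inc _ _ _ _ _ _ hy' hx hj.le le_rfl (by omega)
    · cases r with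
      | zero => exact Or.inl rfl
      | succ r0 =>
        refine Or.inr ⟨r0, rfl, ?_⟩
        have := hU.col (r0 + 1) r0 c (by omega) h1
        rwa [← hEo _ _ (by omega)] at this
  · set w : Letter := if r = c then ⟨x.ceil, g⟩ else x with hw
    have hwx : lastLetter false r c w = x := by
      unfold lastLetter
      by_cases h : r = c
      · rw [if_pos ⟨rfl, h.symm⟩, hw, if_pos h]
        subst h
        have := hU.diag _ _ hx
        cases x
        simp [Letter.unprime] at this ⊢
        exact this
      · rw [if_neg (fun h' => h h'.2.symm), hw, if_neg h]
    have hwc : w.ceil = x.ceil := by rw [hw]; split_ifs <;> rfl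
    have hEr : ∀ j', c ≤ j' → E r j' = none := by
      intro j' hj
      rcases hj.eq_or_lt with rfl | hj
      · exact hEe
      · rw [hEo _ _ (by omega)]; exact hr _ hj
    refine ⟨false, E, r, w, c, ⟨hE, ?_, ?_⟩, hEe, ?_, ?_, (hUE _ hwx).symm, rfl, ?_⟩
    · rw [fword_append_row (by rw [hUE _ hwx]; exact hU) hEr, hUE _ hwx]
      · exact hW
      · rintro a b ha rfl
        by_contra h
        have := hE.dom _ _ h
        exact hE.col _ _ _ ha.le h (hEr b (by omega))
      · intro b hb
        by_contra h
        have := hE.dom _ _ h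
        omega
    · cases r with
      | zero => rfl
      | succ r0 =>
        obtain ⟨u, hu⟩ := Option.ne_none_iff_exists'.1
          (hU.col (r0 + 1) r0 c (by omega) (by rw [hx]; simp))
        refine ⟨c, u, ?_, ?_, ?_, fun _ => hrc, by simp⟩
        · exact (hEo _ _ (by omega)).trans hu
        · rw [hwc]
          exact hU.inc _ _ _ _ _ _ hu hx (by omega) le_rfl (by omega)
        · intro y hy
          rw [show lines false E (r0 + 1) c = none from hEe] at hy
          simp at hy
    · intro j' y hy
      have hy' : E r j' = some y := hy
      have hj : j' < c := by
        by_contra hj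
        rw [hEr j' (by omega)] at hy'
        simp at hy'
      rw [hEo _ _ (by omega)] at hy'
      rw [hwc]
      exact hU.inc _ _ _ _ _ _ hy' hx le_rfl hj.le (by omega)
    · rcases hrc.eq_or_lt with h | h
      · exact Or.inl h.symm
      · refine Or.inr ⟨c - 1, by omega, ?_⟩
        have := hU.row r c (c - 1) (by omega) (by omega) h1
        rwa [← hEo _ _ (by omega)] at this
    · by_cases h : r = c
      · rw [hw, if_pos h]; simp [h]
      · have : g = false := by
          cases g
          · rfl
          · exact absurd ⟨rfl, h⟩ hg
        simp [this, Ne.symm h]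

inductive Run : Bool → Tab → ℕ → Letter → Tab → Box → Bool → Prop
  | fin {f : Bool} {E : Tab} {i : ℕ} {w : Letter} {U : Tab} {p : Box} {g : Bool} {j : ℕ}
      (h : Fin f E i w U p g j) : Run f E i w U p g
  | step {f : Bool} {E : Tab} {i : ℕ} {w : Letter} {f' : Bool} {E' : Tab} {m : Letter} {U : Tab}
      {p : Box} {g : Bool} (h : Step f E i w f' E' m) (h' : Run f' E' (i + 1) m U p g) :
      Run f E i w U p g

lemma Run.line_le (h : Run f E i w U p g) (hV : Valid (· ∈ RinvPlus z) f E i w) :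
    i ≤ lastLine p g := by
  induction h with
  | fin h => exact (h.line hV).1.le
  | step h _ ih => have := ih (hV.step h); omega

lemma Run.unique (h1 : Run f1 E1 i w1 U p g) (h2 : Run f2 E2 i w2 U p g)
    (hV1 : Valid (· ∈ RinvPlus z) f1 E1 i w1) (hV2 : Valid (· ∈ RinvPlus z) f2 E2 i w2) :
    f1 = f2 ∧ E1 = E2 ∧ w1 = w2 := by
  induction h1 generalizing f2 E2 w2 with
  | fin h1 =>
    cases h2 with
    | fin h2 => exact h1.unique hV1 hV2 h2
    | step h2 h2' =>
      have := h2'.line_le (hV2.step h2)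
      have := (h1.line hV1).1
      omega
  | step h1 h1' ih =>
    cases h2 with
    | fin h2 =>
      have := h1'.line_le (hV1.step h1)
      have := (h2.line hV2).1
      omega
    | step h2 h2' =>
      obtain ⟨rfl, rfl, rfl⟩ := ih h2' (hV1.step h1) (hV2.step h2)
      exact h1.unique hV1 hV2 h2

lemma Run.result (h : Run f E i w U p g) (hV : Valid (· ∈ RinvPlus z) f E i w) :
    Ok U ∧ FWord z U ∧ Corner U p := by
  induction h with
  | fin h =>
    obtain ⟨h1, h2, h3, -⟩ := h.result hV
    exact ⟨h1, h2, h3⟩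
  | step h _ ih => exact ih (hV.step h)

lemma Step.dom_iff (h : Step f E i w f' E' m) (a b : ℕ) : E' a b ≠ none ↔ E a b ≠ none := by
  have key : ∀ {F : Tab} {i j : ℕ} {x : Letter}, F i j ≠ none → ∀ a b,
      upd F i j (some x) a b ≠ none ↔ F a b ≠ none := by
    intro F i j x hx a b
    simp only [upd]
    split_ifs with h
    · simp [h.1, h.2, hx]
    · rfl
  have key2 : ∀ {F G : Tab}, (∀ a b, lines f G a b ≠ none ↔ lines f F a b ≠ none) →
      ∀ a b, G a b ≠ none ↔ F a b ≠ none := by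
    intro F G h a b
    cases f
    · exact h a b
    · exact h b a
  rcases h.inv with ⟨rfl, j1, -, h1⟩ | ⟨rfl, j1, p1, -, h1⟩ | ⟨rfl, rfl, d1, a1, b1, c1, e1⟩ |
      ⟨rfl, rfl, a1, b1, c1, e1⟩
  · refine key2 (fun a b => ?_) a b
    rw [h1.eq, key (by rw [h1.entry]; simp)]
  · refine key2 (fun a b => ?_) a b
    rw [h1.eq, key, key (by rw [h1.entry]; simp)]
    rw [key (by rw [h1.entry]; simp), h1.next]
    simp
  · rw [c1, key (by rw [a1]; simp)]
  · rw [c1]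

lemma Run.dom (h : Run f E i w U p g) (hV : Valid (· ∈ RinvPlus z) f E i w) :
    E p.1 p.2 = none ∧ ∀ a b, U a b ≠ none ↔ E a b ≠ none ∨ (a, b) = p := by
  induction h with
  | @fin f E i w U p g j h =>
    refine ⟨(h.result hV).2.2.2.1, fun a b => ?_⟩
    rw [h.eq, h.box, upd]
    split_ifs with hab
    · simp [hab]
    · rw [or_iff_left]
      rintro h'
      rw [← h'] at hab
      exact hab ⟨rfl, rfl⟩
  | step h _ ih =>
    obtain ⟨h1, h2⟩ := ih (hV.step h)
    constructor
    · by_contra hc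
      exact (h.dom_iff _ _).2 hc h1
    · intro a b
      rw [h2, h.dom_iff]

lemma Run.back (h : Run f E i w U p g) (hV : Valid (· ∈ RinvPlus z) f E i w)
    (hfin : ∃ n, ∀ a b, n ≤ a ∨ n ≤ b → E a b = none) :
    ∃ E0 u, Valid (· ∈ RinvPlus z) false E0 0 u ∧ Run false E0 0 u U p g ∧
      ∃ n, ∀ a b, n ≤ a ∨ n ≤ b → E0 a b = none := by
  induction i generalizing f E w with
  | zero =>
    obtain rfl : f = false := hV.prev
    exact ⟨E, w, hV, h, hfin⟩
  | succ i ih =>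
    obtain ⟨n, hn⟩ := hfin
    obtain ⟨f0, E0, w0, hV0, h0⟩ := hV.back ⟨max n i, by
      cases f
      · exact hn _ _ (by omega)
      · exact hn _ _ (by omega), by omega⟩
    refine ih (.step h0 h) hV0 ⟨n, fun a b hab => ?_⟩
    by_contra hc
    exact (h0.dom_iff a b).2 hc (hn a b hab)

lemma Run.exists (hV : Valid (· ∈ RinvPlus z) f E i w)
    {n : ℕ} (hfin : ∀ a b, n ≤ a ∨ n ≤ b → E a b = none) : ∃ U p g, Run f E i w U p g := by
  have hn : ∀ {E : Tab} (f : Bool) (i j : ℕ), (∀ a b, n ≤ a ∨ n ≤ b → E a b = none) →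
      n ≤ i ∨ n ≤ j → lines f E i j = none := by
    intro E f i j h hij
    cases f
    · exact h _ _ hij
    · exact h _ _ hij.symm
  obtain ⟨k, hk⟩ : ∃ k, n ≤ i + k := ⟨n, by omega⟩
  induction k generalizing f E i w with
  | zero =>
    obtain ⟨U, p, g, j, h⟩ := Fin.exists (f := f) (E := E) (i := i) (w := w) (n := i)
      (hn _ _ _ hfin (by omega)) le_rfl (fun j y hy => by
        rw [hn _ _ _ hfin (by omega)] at hy
        simp at hy)
    exact ⟨U, p, g, .fin h⟩
  | succ k ih =>
    rcases hV.progress with ⟨f', E', m, h⟩ | hs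
    · obtain ⟨U, p, g, h'⟩ := ih (hV.step h) (fun a b hab => by
        by_contra hc
        exact (h.dom_iff a b).1 hc (hfin a b hab)) (by omega)
      exact ⟨U, p, g, .step h h'⟩
    · obtain ⟨U, p, g, j, h⟩ := Fin.exists (f := f) (E := E) (i := i) (w := w) (n := max n i)
        (hn _ _ _ hfin (by omega)) (by omega) hs
      exact ⟨U, p, g, .fin h⟩

end

section

variable {z : Equiv.Perm ℤ} {E E' U : Tab} {f f' g : Bool} {i j r c k : ℕ} {p : Box}
  {w m x : Letter} {T : STab}

/-! ### Tableaux as lists -/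

def NE (T : STab) : Prop := ∀ row ∈ T, row ≠ []

lemma getD_getElem? (T : STab) (r k : ℕ) : (T.getD r [])[k]? = entry? T r (r + k) := by
  unfold entry? entryG?
  rw [if_pos (by omega), Nat.add_sub_cancel_left, List.getD_eq_getElem?_getD]
  cases T[r]? <;> simp

lemma entry?_le (h : entry? T r c ≠ none) : r ≤ c := by
  unfold entry? entryG? at h
  split_ifs at h with h1
  · exact h1
  · exact absurd rfl h

lemma entry?_eq (h : r ≤ c) : entry? T r c = (T.getD r [])[c - r]? := by
  rw [getD_getElem?]
  congr 1
  omega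

lemma entry?_of_lt (h : c < r) : entry? T r c = none := by
  by_contra hc
  have := entry?_le hc
  omega

lemma entry?_ne_none : entry? T r c ≠ none ↔ r ≤ c ∧ c < r + (T.getD r []).length := by
  by_cases h : r ≤ c
  · rw [entry?_eq h, ne_eq, List.getElem?_eq_none_iff]
    omega
  · rw [entry?_of_lt (by omega)]
    simp; omega

lemma entry?_row_lt (h : entry? T r c ≠ none) : r < T.length := by
  by_contra hc
  rw [entry?_ne_none, List.getD_eq_default _ _ (by omega)] at h
  simp at h
  omega

lemma entry?_setRowG (hr : r ≤ T.length) (row : List Letter) (a b : ℕ) :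
    entry? (setRowG T r row) a b = if a = r then (if r ≤ b then row[b - r]? else none)
      else entry? T a b := by
  by_cases hab : a ≤ b
  · rw [entry?_eq hab, entry?_eq hab]
    have : (setRowG T r row).getD a [] = if a = r then row else T.getD a [] := by
      unfold setRowG
      split_ifs with h1 h2 h2
      · rw [List.getD_eq_getElem?_getD, h2, List.getElem?_set_self h1]; rfl
      · rw [List.getD_eq_getElem?_getD, List.getElem?_set_ne (Ne.symm h2),
          List.getD_eq_getElem?_getD]
      · obtain rfl : r = T.length := by omega
        rw [List.getD_eq_getElem?_getD, h2]; simp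
      · rw [List.getD_eq_getElem?_getD, List.getD_eq_getElem?_getD]
        rcases Nat.lt_or_ge a T.length with h | h
        · rw [List.getElem?_append_left h]
        · rw [List.getElem?_append_right h, List.getElem?_eq_none (l := T) h,
            List.getElem?_eq_none (by simp; omega)]
    rw [this]
    split_ifs with h1 h2 h2
    · rw [h1]
    · omega
    · rfl
  · rw [entry?_of_lt (by omega), entry?_of_lt (by omega)]
    split_ifs
    · omega
    · rfl
    · rfl

lemma NE.setRowG (hT : NE T) {row : List Letter} (hrow : row ≠ []) : NE (setRowG T r row) := by
  intro l hl
  unfold _root_.setRowG at hl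
  split_ifs at hl
  · rcases List.mem_or_eq_of_mem_set hl with h | rfl
    · exact hT _ h
    · exact hrow
  · rcases List.mem_append.1 hl with h | h
    · exact hT _ h
    · rw [List.mem_singleton.1 h]; exact hrow

lemma entry?_setRowG_set (hx : entry? T r (r + k) ≠ none) (row : List Letter) 
    (hrow : row = T.getD r []) (w : Letter) :
    entry? (setRowG T r (row.set k w)) = upd (entry? T) r (r + k) (some w) := by
  subst hrow
  have hr := entry?_row_lt hx
  funext a b
  rw [entry?_setRowG hr.le]
  unfold upd
  by_cases ha : a = r
  · subst ha
    rw [if_pos rfl]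
    split_ifs with h1 h2 h2
    · obtain ⟨-, rfl⟩ := h2
      rw [entry?_ne_none] at hx
      rw [Nat.add_sub_cancel_left, List.getElem?_set_self (by omega)]
    · rw [List.getElem?_set_ne (by omega), entry?_eq h1]
    · omega
    · rw [entry?_of_lt (by omega)]
  · rw [if_neg ha, if_neg (fun h => ha h.1)]

lemma setEntryG_eq (hr : r < T.length) :
    setEntryG T r c x = setRowG T r ((T.getD r []).set (c - r) x) := by
  unfold setEntryG setRowG
  rw [if_pos hr]

lemma entry?_setEntryG (hx : entry? T r c ≠ none) (w : Letter) :
    entry? (setEntryG T r c w) = upd (entry? T) r c (some w) := by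
  have h := entry?_le hx
  rw [setEntryG_eq (entry?_row_lt hx)]
  have e : r + (c - r) = c := by omega
  rw [entry?_setRowG_set (by rw [e]; exact hx) _ rfl, e]

lemma NE.setEntryG (hT : NE T) (hx : entry? T r c ≠ none) : NE (setEntryG T r c w) := by
  rw [setEntryG_eq (entry?_row_lt hx)]
  refine hT.setRowG ?_
  rw [entry?_ne_none] at hx
  rw [← List.length_pos_iff, List.length_set]
  omega

lemma entry?_append (hr : r ≤ T.length) (hc : (T.getD r []).length = k) (w : Letter) :
    entry? (setRowG T r (T.getD r [] ++ [w])) = upd (entry? T) r (r + k) (some w) := by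
  funext a b
  rw [entry?_setRowG hr]
  unfold upd
  by_cases ha : a = r
  · subst ha
    rw [if_pos rfl]
    split_ifs with h1 h2 h2
    · obtain ⟨-, rfl⟩ := h2
      rw [Nat.add_sub_cancel_left, ← hc]
      simp
    · rw [entry?_eq h1]
      rcases Nat.lt_or_ge (b - a) (T.getD a []).length with h | h
      · rw [List.getElem?_append_left h]
      · rw [List.getElem?_append_right h, List.getElem?_eq_none (l := T.getD a []) h,
          List.getElem?_eq_none]
        rw [List.length_singleton]
        omega
    · omega
    · rw [entry?_of_lt (by omega)]
  · rw [if_neg ha, if_neg (fun h => ha h.1)]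

/-! ### Searching in lists described by a function -/

section search

variable {α : Type*} {l : List α} {G : ℕ → Option α} {q : α → Bool} {y : α}

lemma findIdx?_some (hG : ∀ k, l[k]? = G k) (hk : G k = some y) (hy : q y = true)
    (hlt : ∀ k' y', k' < k → G k' = some y' → q y' = false) : l.findIdx? q = some k := by
  rw [← hG] at hk
  obtain ⟨hkl, hk⟩ := List.getElem?_eq_some_iff.1 hk
  rw [List.findIdx?_eq_some_iff_getElem]
  refine ⟨hkl, by rw [hk]; exact hy, fun k' hk' => ?_⟩
  rw [hlt k' l[k'] hk' (by rw [← hG, List.getElem?_eq_getElem])]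
  simp

lemma findIdx?_none (hG : ∀ k, l[k]? = G k) (h : ∀ k y, G k = some y → q y = false) :
    l.findIdx? q = none := by
  rw [List.findIdx?_eq_none_iff]
  intro x hx
  obtain ⟨k, hk⟩ := List.getElem?_of_mem hx
  exact h k x (by rw [← hG, hk])

lemma getD_of (hG : ∀ k, l[k]? = G k) (hk : G k = some y) (d : α) : l.getD k d = y := by
  rw [List.getD_eq_getElem?_getD, hG, hk]; rfl

lemma length_of (hG : ∀ k, l[k]? = G k) (hk : G k = none) (h : k = 0 ∨ ∃ k0, k = k0 + 1 ∧ G k0 ≠ none) :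
    l.length = k := by
  have h1 : l.length ≤ k := by rw [← List.getElem?_eq_none_iff, hG, hk]
  rcases h with rfl | ⟨k0, rfl, h⟩
  · omega
  · rw [← hG, ne_eq, List.getElem?_eq_none_iff] at h
    omega

lemma filterMap_range_getElem? (G : ℕ → Option α) (hG : ∀ a b, a ≤ b → G b ≠ none → G a ≠ none)
    (N k : ℕ) : ((List.range N).filterMap G)[k]? = if k < N then G k else none := by
  have hlen : ∀ N, G N ≠ none → ((List.range N).filterMap G).length = N := by
    intro N
    induction N with
    | zero => simp
    | succ N ih =>
      intro h
      obtain ⟨y, hy⟩ := Option.ne_none_iff_exists'.1 (hG N (N + 1) (by omega) h)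
      rw [List.range_succ, List.filterMap_append, List.length_append,
        ih (hG N (N + 1) (by omega) h)]
      simp [hy]
  induction N with
  | zero => simp
  | succ N ih =>
    rw [List.range_succ, List.filterMap_append]
    cases hN : G N with
    | none =>
      have : List.filterMap G [N] = [] := by simp [hN]
      rw [this, List.append_nil, ih]
      split_ifs with h1 h2 h2
      · rfl
      · omega
      · obtain rfl : k = N := by omega
        exact hN.symm
      · rfl
    | some y =>
      have : List.filterMap G [N] = [y] := by simp [hN]
      have hl := hlen N (by rw [hN]; simp)
      rw [this]
      rcases Nat.lt_trichotomy k N with h | h | h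
      · rw [List.getElem?_append_left (by omega), ih, if_pos h, if_pos (by omega)]
      · subst h
        rw [List.getElem?_append_right (by omega), hl, if_pos (by omega), hN]
        simp
      · rw [List.getElem?_append_right (by omega), if_neg (by omega),
          List.getElem?_eq_none (by simp; omega)]

end search

end

section

variable {z : Equiv.Perm ℤ} {E E' U : Tab} {f f' g : Bool} {i j r c k n : ℕ} {p : Box}
  {w m x : Letter} {T : STab}

/-! ### One step of insertion on lists -/

def eg (f : Bool) : ℕ → STab → ℕ → Letter → STab × Bool := if f then egCol else egRow

lemma switchPrimes_next (a : ℤ) (q : Bool) :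
    switchPrimes ⟨a, q⟩ ⟨a + 1, false⟩ = (⟨a, false⟩, ⟨a + 1, q⟩) := by
  cases q <;> rfl

section row

lemma row_getElem? (hT : entry? T = E) (i k : ℕ) : (T.getD i [])[k]? = E i (i + k) := by
  rw [getD_getElem?, hT]

lemma egRow_bump (hT : entry? T = E) (hN : NE T) (hj : j ≠ i) (hij : i ≤ j)
    (h : BumpA E i j w E' m) :
    ∃ T', entry? T' = E' ∧ NE T' ∧ ∀ n, egRow (n + 1) T i w = egRow n T' (i + 1) m := by
  obtain ⟨k, rfl⟩ := Nat.exists_eq_add_of_le hij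
  obtain ⟨h1, h2, h3, h4, rfl⟩ := h
  have hG := row_getElem? hT i
  have hne : entry? T i (i + k) ≠ none := by rw [hT, h1]; simp
  have e1 : (T.getD i []).findIdx? (fun x => decide (w.ceil < x.ceil)) = some k :=
    findIdx?_some hG h1 (by simpa using h2) (fun k' y hk hy => by
      have := h3 (i + k') y (by omega) hy
      simp; omega)
  have e2 : (T.getD i []).findIdx? (fun x => decide (w.ceil ≤ x.ceil)) = some k :=
    findIdx?_some hG h1 (by simpa using h2.le) (fun k' y hk hy => by
      have := h3 (i + k') y (by omega) hy
      simp; omega)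
  have e3 : (T.getD i []).getD k default = m := getD_of hG h1 _
  refine ⟨setRowG T i ((T.getD i []).set k w), ?_, ?_, fun n => ?_⟩
  · rw [entry?_setRowG_set hne _ rfl, hT]
  · refine hN.setRowG ?_
    rw [← List.length_pos_iff, List.length_set]
    rw [entry?_ne_none] at hne; omega
  · have hk : k ≠ 0 := by omega
    rw [egRow]
    simp only [e1, e2, e3, Option.getD_some, if_true, if_neg hk]

lemma egRow_diag (hT : entry? T = E) (hN : NE T) (h1 : E r r = some x)
    (h2 : w.ceil < x.ceil) :
    ∃ T', entry? T' = upd E r r (some w.unprime) ∧ NE T' ∧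
      ∀ n, egRow (n + 1) T r w = egCol n T' (r + 1) ⟨x.ceil, w.primed⟩ := by
  have hG := row_getElem? hT r
  have hne : entry? T r (r + 0) ≠ none := by rw [hT, Nat.add_zero, h1]; simp
  have e1 : (T.getD r []).findIdx? (fun x => decide (w.ceil < x.ceil)) = some 0 :=
    findIdx?_some hG h1 (by simpa using h2) (fun k' y hk hy => by omega)
  have e2 : (T.getD r []).findIdx? (fun x => decide (w.ceil ≤ x.ceil)) = some 0 :=
    findIdx?_some hG h1 (by simpa using h2.le) (fun k' y hk hy => by omega)
  have e3 : (T.getD r []).getD 0 default = x := getD_of (k := 0) hG h1 _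
  refine ⟨setRowG T r ((T.getD r []).set 0 w.unprime), ?_, ?_, fun n => ?_⟩
  · rw [entry?_setRowG_set hne _ rfl, hT, Nat.add_zero]
  · refine hN.setRowG ?_
    rw [← List.length_pos_iff, List.length_set]
    rw [entry?_ne_none] at hne; omega
  · rw [egRow]
    simp only [e1, e2, e3, Option.getD_some, if_true]

lemma entry?_injOn {T T' : STab} (hN : NE T) (hN' : NE T') (h : entry? T = entry? T') : T = T' := by
  have key : ∀ {A B : STab}, NE A → entry? A = entry? B → A.length ≤ B.length := by
    intro A B hA hAB
    by_contra hlt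
    have hl : B.length < A.length := by omega
    have h0 : 0 < (A.getD B.length []).length := by
      rw [List.getD_eq_getElem _ _ hl, List.length_pos_iff]
      exact hA _ (List.getElem_mem hl)
    have h1 : entry? A B.length B.length ≠ none := by rw [entry?_ne_none]; omega
    rw [hAB] at h1
    exact absurd (entry?_row_lt h1) (lt_irrefl _)
  refine List.ext_getElem (le_antisymm (key hN h) (key hN' h.symm)) fun r h1 h2 => ?_
  rw [← List.getD_eq_getElem _ [] h1, ← List.getD_eq_getElem _ [] h2]
  refine List.ext_getElem? fun k => ?_
  rw [getD_getElem?, getD_getElem?, h]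

lemma egRow_switch {q : Bool} (hT : entry? T = E) (hN : NE T) (hij : i ≤ j)
    (h : BumpC E i j w q E' m) :
    ∃ T', entry? T' = E' ∧ NE T' ∧ ∀ n, egRow (n + 1) T i w = eg (decide (j = i)) n T' (i + 1) m := by
  obtain ⟨k, rfl⟩ := Nat.exists_eq_add_of_le hij
  obtain ⟨h1, h2, h3, h4, rfl, rfl⟩ := h
  have hG := row_getElem? hT i
  have hne : entry? T i (i + k) ≠ none := by rw [hT, h1]; simp
  have hne2 : entry? T i (i + (k + 1)) ≠ none := by rw [hT, ← Nat.add_assoc, h2]; simp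
  have e1 : (T.getD i []).findIdx? (fun x => decide (w.ceil < x.ceil)) = some (k + 1) :=
    findIdx?_some hG h2 (by simp) (fun k' y hk hy => by
      rcases Nat.eq_or_lt_of_le (Nat.lt_succ_iff.1 hk) with rfl | hk
      · rw [h1] at hy; cases hy; simp
      · have := h3 (i + k') y (by omega) hy
        simp; omega)
  have e2 : (T.getD i []).findIdx? (fun x => decide (w.ceil ≤ x.ceil)) = some k :=
    findIdx?_some hG h1 (by simp) (fun k' y hk hy => by
      have := h3 (i + k') y (by omega) hy
      simp; omega)
  have e3 : (T.getD i []).getD k default = _ := getD_of hG h1 _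
  have e4 : (T.getD i []).getD (k + 1) default = _ := getD_of hG h2 _
  refine ⟨setRowG T i (((T.getD i []).set k ⟨w.ceil, false⟩).set (k + 1) ⟨w.ceil + 1, q⟩), ?_, ?_,
    fun n => ?_⟩
  · have hlen := entry?_ne_none.1 hne2
    have hr := entry?_row_lt hne
    set T1 := setRowG T i ((T.getD i []).set k ⟨w.ceil, false⟩) with hT1
    have h5 : entry? T1 = upd E i (i + k) (some ⟨w.ceil, false⟩) := by
      rw [hT1, entry?_setRowG_set hne _ rfl, hT]
    have h6 : T1.getD i [] = (T.getD i []).set k ⟨w.ceil, false⟩ := by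
      rw [hT1]; unfold setRowG; rw [if_pos hr, List.getD_eq_getElem?_getD,
        List.getElem?_set_self hr]; rfl
    have h7 : entry? T1 i (i + (k + 1)) ≠ none := by
      rw [h5, upd_of_ne (by omega), ← hT]; exact hne2
    have h8 := entry?_setRowG_set h7 _ h6.symm ⟨w.ceil + 1, q⟩
    rw [h5] at h8
    rw [Nat.add_assoc, ← h8]
    congr 1
    rw [hT1]; unfold setRowG
    rw [if_pos hr, if_pos hr, if_pos (by simpa using hr), List.set_set]
  · refine hN.setRowG ?_
    rw [← List.length_pos_iff, List.length_set, List.length_set]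
    rw [entry?_ne_none] at hne; omega
  · rw [egRow]
    simp only [e1, e2, e3, e4, Option.getD_some, if_neg (Nat.ne_of_lt (Nat.lt_succ_self k)),
      switchPrimes_next]
    rcases Nat.eq_zero_or_pos k with rfl | hk
    · simp [eg, Letter.succL]
    · have : ¬ k = 0 := by omega
      simp [eg, this, Letter.succL]

lemma length_le_of_entry (h : i = 0 ∨ ∃ b, E (i - 1) b ≠ none) (hT : entry? T = E) :
    i ≤ T.length := by
  rcases h with h | ⟨b, h⟩
  · omega
  · rw [← hT] at h
    have := entry?_row_lt h
    omega

lemma egRow_fin (hT : entry? T = E) (hN : NE T) (hE : Ok E) (hi : i = 0 ∨ ∃ b, E (i - 1) b ≠ none)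
    (h : Fin false E i w U p g j) :
    ∃ T', entry? T' = U ∧ NE T' ∧ ∀ n, egRow (n + 1) T i w = (T', g) := by
  obtain ⟨h1, h2, h3, rfl, rfl, rfl⟩ := h
  have hl := length_le_of_entry hi hT
  have hG := row_getElem? hT i
  have hij : i ≤ j := by
    rcases h3 with h3 | ⟨j0, rfl, h3⟩
    · simp at h3; omega
    · have := hE.dom i j0 h3; omega
  obtain ⟨k, rfl⟩ := Nat.exists_eq_add_of_le hij
  have hlen : (T.getD i []).length = k := by
    refine length_of hG h1 ?_
    rcases h3 with h3 | ⟨j0, h4, h3⟩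
    · left; simpa using h3
    · have := hE.dom i j0 h3
      right
      exact ⟨j0 - i, by omega, by rw [show i + (j0 - i) = j0 by omega]; exact h3⟩
  have e1 : (T.getD i []).findIdx? (fun x => decide (w.ceil < x.ceil)) = none :=
    findIdx?_none hG (fun k' y hy => by
      have := h2 _ y hy
      simp; omega)
  have e2 : (T.getD i []).isEmpty = decide (k = 0) := by
    rw [← hlen]; cases T.getD i [] <;> simp
  refine ⟨setRowG T i (T.getD i [] ++ [lastLetter false i (i + k) w]), ?_, hN.setRowG (by simp), fun n => ?_⟩
  · rw [entry?_append hl hlen, hT]; rfl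
  · rw [egRow]
    simp only [e1, e2, decide_eq_true_eq]
    by_cases hk : k = 0
    · subst hk
      have h0 : T.getD i [] = [] := List.length_eq_zero_iff.1 hlen
      rw [h0]
      obtain ⟨wc, wp⟩ := w
      cases wp <;> simp [lastLetter, Letter.unprime]
    · rw [if_neg (fun h => hk h.1)]
      simp [lastLetter, hk]

end row

section col

lemma occ_getElem? (hT : entry? T = E) (hE : Ok E) (c k : ℕ) :
    ((List.range (c + 1)).filterMap (fun r => (entry? T r c).map (fun x => (r, x))))[k]? =
      (E k c).map (fun x => (k, x)) := by
  rw [filterMap_range_getElem?, hT]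
  · split_ifs with h
    · rfl
    · have : E k c = none := by
        by_contra hc
        have := hE.dom k c hc
        omega
      rw [this]; rfl
  · intro a b hab hb
    rw [hT] at hb ⊢
    rw [ne_eq, Option.map_eq_none_iff] at hb ⊢
    exact hE.col b a c hab hb

lemma occ_findIdx?_some {q : Letter → Bool} (hT : entry? T = E) (hE : Ok E) (hk : E k c = some x)
    (hy : q x = true) (hlt : ∀ k' y', k' < k → E k' c = some y' → q y' = false) :
    ((List.range (c + 1)).filterMap (fun r => (entry? T r c).map (fun x => (r, x)))).findIdx?
      (fun p => q p.2) = some k := by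
  refine findIdx?_some (occ_getElem? hT hE c) (y := (k, x)) (by rw [hk]; rfl) hy ?_
  intro k' y' hk' hy'
  obtain ⟨a, ha, rfl⟩ := Option.map_eq_some_iff.1 hy'
  exact hlt k' a hk' ha

lemma occ_getD (hT : entry? T = E) (hE : Ok E) (hk : E k c = some x) (d : ℕ × Letter) :
    ((List.range (c + 1)).filterMap (fun r => (entry? T r c).map (fun x => (r, x)))).getD k d =
      (k, x) :=
  getD_of (occ_getElem? hT hE c) (by rw [hk]; rfl) d

lemma egCol_bump (hT : entry? T = E) (hN : NE T) (hE : Ok E) (hE' : Ok E')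
    (h : BumpA (lines true E) i j w (lines true E') m) :
    ∃ T', entry? T' = E' ∧ NE T' ∧ ∀ n, egCol (n + 1) T i w = egCol n T' (i + 1) m := by
  obtain ⟨h1, h2, h3, h4, h5⟩ := h
  obtain rfl : E' = upd E j i (some w) := by
    rw [← lines_lines true E', h5, lines_upd_lines]; rfl
  change E j i = some m at h1
  have hne : entry? T j i ≠ none := by rw [hT, h1]; simp
  have e1 := occ_findIdx?_some (q := fun x => decide (w.ceil < x.ceil)) hT hE h1 (by simpa using h2)
    (fun k' y hk hy => by
      have := h3 k' y hk hy
      simp; omega)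
  have e2 := occ_findIdx?_some (q := fun x => decide (w.ceil ≤ x.ceil)) hT hE h1
    (by simpa using h2.le) (fun k' y hk hy => by
      have := h3 k' y hk hy
      simp; omega)
  have e3 := occ_getD hT hE h1 (0, default)
  refine ⟨setEntryG T j i w, by rw [entry?_setEntryG hne, hT], hN.setEntryG hne, fun n => ?_⟩
  rw [egCol]
  simp only [e1, e2, e3, Option.getD_some, if_true]
  split_ifs with hj
  · subst hj
    have a1 := hE.diag _ _ h1
    have a2 := hE'.diag j w (upd_self _ _ _ _)
    obtain ⟨wc, wp⟩ := w
    obtain ⟨mc, mp⟩ := m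
    cases a1
    cases a2
    rfl
  · rfl

lemma egCol_switch {q : Bool} (hT : entry? T = E) (hN : NE T) (hE : Ok E)
    (h : BumpC (lines true E) i j w q (lines true E') m) :
    ∃ T', entry? T' = E' ∧ NE T' ∧ ∀ n, egCol (n + 1) T i w = egCol n T' (i + 1) m := by
  obtain ⟨h1, h2, h3, h4, h5, rfl⟩ := h
  obtain rfl : E' = upd (upd E j i (some ⟨w.ceil, false⟩)) (j + 1) i (some ⟨w.ceil + 1, q⟩) := by
    rw [← lines_lines true E', h5, lines_upd, lines_upd_lines]; rfl
  change E j i = some _ at h1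
  change E (j + 1) i = some _ at h2
  have hne : entry? T j i ≠ none := by rw [hT, h1]; simp
  have e1 := occ_findIdx?_some (q := fun x => decide (w.ceil < x.ceil)) hT hE h2 (by simp)
    (fun k' y hk hy => by
      rcases Nat.eq_or_lt_of_le (Nat.lt_succ_iff.1 hk) with rfl | hk
      · rw [h1] at hy; cases hy; simp
      · have := h3 k' y hk hy
        simp; omega)
  have e2 := occ_findIdx?_some (q := fun x => decide (w.ceil ≤ x.ceil)) hT hE h1 (by simp)
    (fun k' y hk hy => by
      have := h3 k' y hk hy
      simp; omega)
  have e3 := occ_getD hT hE h1 (0, default)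
  have e4 := occ_getD hT hE h2 (0, default)
  have h6 := entry?_setEntryG hne ⟨w.ceil, false⟩
  rw [hT] at h6
  have hne2 : entry? (setEntryG T j i ⟨w.ceil, false⟩) (j + 1) i ≠ none := by
    rw [h6, upd_of_ne (by omega), h2]; simp
  refine ⟨setEntryG (setEntryG T j i ⟨w.ceil, false⟩) (j + 1) i ⟨w.ceil + 1, q⟩, ?_,
    (hN.setEntryG hne).setEntryG hne2, fun n => ?_⟩
  · rw [entry?_setEntryG hne2, h6]
  · rw [egCol]
    simp only [e1, e2, e3, e4, Option.getD_some, if_neg (Nat.ne_of_lt (Nat.lt_succ_self j)),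
      switchPrimes_next]
    rfl

lemma egCol_fin (hT : entry? T = E) (hN : NE T) (hE : Ok E)
    (hU : Ok U) (hlt : j < i) (h : Fin true E i w U p g j) :
    ∃ T', entry? T' = U ∧ NE T' ∧ ∀ n, egCol (n + 1) T i w = (T', g) := by
  obtain ⟨h1, h2, h3, rfl, rfl, rfl⟩ := h
  change E j i = none at h1
  have hlen : ((List.range (i + 1)).filterMap
      (fun r => (entry? T r i).map (fun x => (r, x)))).length = j := by
    refine length_of (occ_getElem? hT hE i) (by rw [h1]; rfl) ?_
    rcases h3 with h3 | ⟨j0, h4, h3⟩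
    · left; simpa using h3
    · right; refine ⟨j0, h4, ?_⟩
      rw [ne_eq, Option.map_eq_none_iff]; exact h3
  have e1 : ((List.range (i + 1)).filterMap
      (fun r => (entry? T r i).map (fun x => (r, x)))).findIdx?
      (fun p => decide (w.ceil < p.2.ceil)) = none := by
    refine findIdx?_none (occ_getElem? hT hE i) ?_
    intro k y hy
    obtain ⟨a, ha, rfl⟩ := Option.map_eq_some_iff.1 hy
    have := h2 k a ha
    simp; omega
  have hl : j ≤ T.length := by
    rcases h3 with h3 | ⟨j0, rfl, h3⟩
    · simp at h3; omega
    · exact length_le_of_entry (E := E) (Or.inr ⟨i, h3⟩) hT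
  have hmem : upd E j i (some w) j i ≠ none := by rw [upd_self]; simp
  have hji : j ≤ i := hU.dom j i hmem
  have hk : (T.getD j []).length = i - j := by
    have a1 : i - j ≤ (T.getD j []).length := by
      rcases Nat.eq_or_lt_of_le hji with rfl | hlt
      · omega
      · have : entry? T j (i - 1) ≠ none := by
          have := hU.row j i (i - 1) (by omega) (by omega) hmem
          rwa [show bx true i j = (j, i) from rfl, upd_of_ne (by simp only; omega), ← hT] at this
        rw [entry?_ne_none] at this
        omega
    have a2 : ¬ entry? T j i ≠ none := by rw [hT, h1]; simp
    rw [entry?_ne_none] at a2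
    omega
  refine ⟨setRowG T j (T.getD j [] ++ [w]), ?_, hN.setRowG (by simp), fun n => ?_⟩
  · rw [entry?_append hl hk, hT, show j + (i - j) = i by omega]; rfl
  · rw [egCol]
    simp only [e1, hlen]
    simp [hlt.ne]

end col

lemma Step.eg (h : Step f E i w f' E' m) (hV : Valid (· ∈ RinvPlus z) f E i w)
    (hT : entry? T = E) (hN : NE T) :
    ∃ T', entry? T' = E' ∧ NE T' ∧ ∀ n, eg f (n + 1) T i w = eg f' n T' (i + 1) m := by
  have hE := hV.ok
  have hE' := (hV.step h).ok
  have hrow : ∀ {j x}, E i j = some x → i ≤ j := fun {j x} h => hE.dom i j (by rw [h]; simp)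
  rcases h.inv with ⟨rfl, j, hj, h1⟩ | ⟨rfl, j, q, hj, h1⟩ | ⟨rfl, rfl, d, hd, h1, rfl, rfl⟩ |
      ⟨rfl, rfl, a1, b1, rfl, rfl⟩
  · cases f'
    · exact egRow_bump hT hN (hj rfl) (hrow h1.entry) h1
    · exact egCol_bump hT hN hE hE' h1
  · cases f'
    · have := egRow_switch hT hN (hrow h1.entry) h1
      rwa [decide_eq_false (hj rfl)] at this
    · exact egCol_switch hT hN hE h1
  · exact egRow_diag hT hN hd h1
  · have hB : BumpC E' i i w false E' ⟨w.ceil + 1, w.primed⟩ := by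
      refine ⟨a1, b1, fun j' y hj' hy => ?_, fun j' y hj' hy => ?_, ?_, rfl⟩
      · have := hrow hy
        omega
      · exact hE.inc i (i + 1) i j' _ _ b1 hy le_rfl (by omega) (by omega)
      · rw [upd_eq_self a1, upd_eq_self b1]
    have := egRow_switch hT hN le_rfl hB
    rwa [decide_eq_true rfl] at this

lemma Fin.eg (h : Fin f E i w U p g j) (hV : Valid (· ∈ RinvPlus z) f E i w)
    (hT : entry? T = E) (hN : NE T) :
    ∃ T', entry? T' = U ∧ NE T' ∧ ∀ n, eg f (n + 1) T i w = (T', g) := by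
  cases f
  · refine egRow_fin hT hN hV.ok ?_ h
    cases i with
    | zero => exact Or.inl rfl
    | succ i =>
      obtain ⟨b, x, hb⟩ := hV.prev
      exact Or.inr ⟨b, by rw [Nat.add_sub_cancel, show E i b = some x from hb.entry]; simp⟩
  · exact egCol_fin hT hN hV.ok (h.result hV).1 (h.pos_lt hV.ok hV.prev) h

lemma Run.eg (h : Run f E i w U p g) (hV : Valid (· ∈ RinvPlus z) f E i w)
    (hT : entry? T = E) (hN : NE T) (hn : lastLine p g < i + n) :
    ∃ T', entry? T' = U ∧ NE T' ∧ eg f n T i w = (T', g) := by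
  induction h generalizing T n with
  | fin h =>
    have := (h.line hV).1
    obtain ⟨n, rfl⟩ := Nat.exists_eq_succ_of_ne_zero (show n ≠ 0 by omega)
    obtain ⟨T', h1, h2, h3⟩ := h.eg hV hT hN
    exact ⟨T', h1, h2, h3 n⟩
  | step h h' ih =>
    have := h'.line_le (hV.step h)
    obtain ⟨n, rfl⟩ := Nat.exists_eq_succ_of_ne_zero (show n ≠ 0 by omega)
    obtain ⟨T1, h1, h2, h3⟩ := h.eg hV hT hN
    obtain ⟨T', h4, h5, h6⟩ := ih (hV.step h) h1 h2 (n := n) (by omega)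
    exact ⟨T', h4, h5, (h3 n).trans h6⟩

lemma length_row_le_flatten (hT : r < T.length) : (T.getD r []).length ≤ T.flatten.length := by
  rw [List.getD_eq_getElem _ _ hT]
  exact List.Sublist.length_le (List.sublist_flatten_of_mem (List.getElem_mem hT))

lemma Run.egInsert (h : Run false E 0 w U p g) (hV : Valid (· ∈ RinvPlus z) false E 0 w)
    (hT : entry? T = E) (hN : NE T) :
    ∃ T', entry? T' = U ∧ NE T' ∧ egInsert T w = (T', g) := by
  refine h.eg hV hT hN (n := T.flatten.length + T.length + 2) ?_
  obtain ⟨hU, -, hp⟩ := h.result hV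
  have hle := hU.dom _ _ hp.mem
  have hdom := h.dom hV
  have h1 : p.1 ≤ T.length := by
    rcases Nat.eq_zero_or_pos p.1 with h0 | h0
    · omega
    · have := hU.col p.1 (p.1 - 1) p.2 (by omega) hp.mem
      rw [hdom.2] at this
      rcases this with h2 | h2
      · rw [← hT] at h2
        have := entry?_row_lt h2
        omega
      · rw [← h2] at h0
        simp only at h0
        rw [Prod.ext_iff] at h2
        omega
  unfold lastLine
  split_ifs with hg
  · have h2 := hU.row 0 p.2 (p.2 - 1) (by omega) (by omega) (hU.col p.1 0 p.2 (by omega) hp.mem)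
    rw [hdom.2] at h2
    rcases h2 with h2 | h2
    · rw [← hT] at h2
      have h3 := entry?_row_lt h2
      rw [entry?_ne_none] at h2
      have := length_row_le_flatten h3
      omega
    · rw [Prod.ext_iff] at h2
      have := hg.2
      simp only at h2
      omega
  · omega

/-! ### Lists realizing an array -/

lemma exists_list {E E0 : Tab} (hE0 : Ok E0)
    (hd : ∀ a b, E a b ≠ none ↔ E0 a b ≠ none) (hfin : ∃ n, ∀ a b, n ≤ a ∨ n ≤ b → E a b = none) :
    ∃ T, entry? T = E ∧ NE T := by
  classical
  have hrow : ∀ r c c', r ≤ c' → c' ≤ c → E r c ≠ none → E r c' ≠ none := by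
    intro r c c'
    rw [hd, hd]
    exact hE0.row r c c'
  have hcol : ∀ r r' c, r' ≤ r → E r c ≠ none → E r' c ≠ none := by
    intro r r' c
    rw [hd, hd]
    exact hE0.col r r' c
  obtain ⟨n, hn⟩ := hfin
  set R : ℕ → List Letter := fun r => (List.range n).filterMap (fun k => E r (r + k)) with hR
  have hRk : ∀ r k, (R r)[k]? = E r (r + k) := by
    intro r k
    rw [hR]
    simp only
    rw [filterMap_range_getElem?]
    · split_ifs with h
      · rfl
      · rw [hn _ _ (Or.inr (by omega))]
    · intro a b hab hb
      exact hrow r _ _ (by omega) (by omega) hb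
  set G : ℕ → Option (List Letter) := fun r => if E r r = none then none else some (R r) with hG
  have hTk : ∀ r, ((List.range n).filterMap G)[r]? = G r := by
    intro r
    rw [filterMap_range_getElem?]
    · split_ifs with h
      · rfl
      · rw [hG]; simp only; rw [if_pos (hn _ _ (Or.inr (by omega)))]
    · intro a b hab hb
      rw [hG] at hb ⊢
      simp only [ne_eq, ite_eq_left_iff, reduceCtorEq, imp_false, not_not] at hb ⊢
      exact hrow a b a le_rfl hab (hcol b a b hab hb)
  refine ⟨(List.range n).filterMap G, ?_, ?_⟩
  · funext r c
    by_cases hrc : r ≤ c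
    · rw [entry?_eq hrc, List.getD_eq_getElem?_getD, hTk, hG]
      simp only
      split_ifs with h
      · have : E r c = none := by
          by_contra hc
          exact hrow r c r le_rfl hrc hc h
        rw [this]; rfl
      · rw [Option.getD_some, hRk]
        congr 1; omega
    · rw [entry?_of_lt (by omega)]
      by_contra hc
      exact hrc (hE0.dom r c ((hd r c).1 (Ne.symm hc)))
  · intro row hrow
    obtain ⟨r, hr⟩ := List.getElem?_of_mem hrow
    rw [hTk, hG] at hr
    simp only at hr
    split_ifs at hr with h
    cases hr
    rintro h0
    have := hRk r 0
    rw [h0, Nat.add_zero] at this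
    exact h this.symm

lemma finite_entry (T : STab) : ∃ n, ∀ a b, n ≤ a ∨ n ≤ b → entry? T a b = none := by
  refine ⟨T.length + T.flatten.length, fun a b h => ?_⟩
  by_contra hc
  have h1 := entry?_row_lt hc
  rw [← ne_eq, entry?_ne_none] at hc
  have := length_row_le_flatten h1
  omega

end

section

variable {z z' : Equiv.Perm ℤ} {E E' : Tab} {f f' g : Bool} {i j r c k n : ℕ} {p : Box}
  {w m x u : Letter} {T U : STab} {P : PWord → Prop}

/-! ### Reading words of lists -/

lemma entry?_snoc (T : STab) (row : List Letter) (a b : ℕ) :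
    entry? (T ++ [row]) a b = if a = T.length then (if a ≤ b then row[b - a]? else none)
      else entry? T a b := by
  have : T ++ [row] = setRowG T T.length row := by unfold setRowG; rw [if_neg (lt_irrefl _)]
  rw [this, entry?_setRowG le_rfl]
  split_ifs with h1 h2 h3 h3 <;> first | rfl | omega | rw [h1]

lemma exists_boxes (T : STab) : ∃ A : List (Box × Letter),
    A.Pairwise (fun a b => rowOrd a.1 < rowOrd b.1) ∧ A.map Prod.snd = rowWord T ∧
      ∀ x, x ∈ A ↔ x ∈ graph (entry? T) := by
  induction T using List.reverseRecOn with
  | nil =>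
    refine ⟨[], List.Pairwise.nil, rfl, ?_⟩
    rintro ⟨⟨a, b⟩, x⟩
    rw [mem_graph]
    simp [entry?, entryG?]
  | append_singleton T row ih =>
    obtain ⟨A, h1, h2, h3⟩ := ih
    have hA0 : ∀ y, y ∈ row.zipIdx.map (fun y => (((T.length, T.length + y.2) : Box), y.1)) ↔
        y.1.1 = T.length ∧ T.length ≤ y.1.2 ∧ row[y.1.2 - T.length]? = some y.2 := by
      rintro ⟨⟨a, b⟩, x⟩
      rw [List.mem_map]
      constructor
      · rintro ⟨⟨y, k⟩, hy, he⟩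
        rw [List.mem_zipIdx_iff_getElem?] at hy
        simp only [Prod.mk.injEq] at he
        obtain ⟨⟨rfl, rfl⟩, rfl⟩ := he
        exact ⟨rfl, by simp, by simpa using hy⟩
      · rintro ⟨ha, hb, hx⟩
        simp only at ha hb hx
        subst ha
        refine ⟨(x, b - T.length), List.mem_zipIdx_iff_getElem?.2 hx, ?_⟩
        simp only [Prod.mk.injEq, true_and, and_true]
        omega
    refine ⟨row.zipIdx.map (fun y => ((T.length, T.length + y.2), y.1)) ++ A, ?_, ?_, ?_⟩
    · rw [List.pairwise_append]
      refine ⟨?_, h1, ?_⟩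
      · rw [List.pairwise_map]
        have : (row.zipIdx.map Prod.snd).Pairwise (· < ·) := by
          rw [List.zipIdx_map_snd]
          exact List.pairwise_lt_range' 1
        rw [List.pairwise_map] at this
        refine this.imp fun {a b} hab => ?_
        simp only [rowOrd, key_lt]
        right
        exact ⟨trivial, by push_cast; omega⟩
      · rintro ⟨⟨a, b⟩, x⟩ ha ⟨⟨a', b'⟩, x'⟩ hb
        rw [hA0] at ha
        rw [h3, mem_graph] at hb
        have := entry?_row_lt (T := T) (r := a') (c := b') (by rw [hb]; simp)
        simp only at ha
        simp only [rowOrd, key_lt]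
        omega
    · rw [List.map_append, h2, List.map_map]
      simp only [rowWord, List.reverse_append, List.reverse_singleton, List.singleton_append,
        List.flatten_cons]
      congr 1
      exact List.zipIdx_map_fst 0 row
    · rintro ⟨⟨a, b⟩, x⟩
      rw [List.mem_append, hA0, h3, mem_graph, mem_graph, entry?_snoc]
      simp only
      split_ifs with ha hb
      · subst ha
        have : entry? T T.length b ≠ some x := fun h =>
          absurd (entry?_row_lt (T := T) (c := b) (by rw [h]; simp)) (lt_irrefl _)
        simp [this, hb]
      · subst ha
        have : entry? T T.length b ≠ some x := fun h =>
          absurd (entry?_row_lt (T := T) (c := b) (by rw [h]; simp)) (lt_irrefl _)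
        simp [this, hb]
      · simp [ha]

lemma word_rowWord (T : STab) (X : PWord) :
    Word P (graph (entry? T)) rowOrd (rthr 0) X ↔ P (rowWord T ++ X) := by
  obtain ⟨A, h1, h2, h3⟩ := exists_boxes T
  have hlt : ∀ p, rowOrd p < rthr 0 := by
    intro p; simp only [rowOrd, rthr, key_lt]; omega
  constructor
  · intro h
    obtain ⟨A', B, a1, -, -, a2, a3, a4⟩ := h.exists_split
    have hB : B = [] := by
      rw [List.eq_nil_iff_forall_not_mem]
      intro b hb
      exact absurd (a2 b hb) (not_lt_of_gt (hlt _))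
    subst hB
    have : A' = A := by
      refine List.Perm.eq_of_pairwise (le := fun a b => rowOrd a.1 < rowOrd b.1)
        (fun a b _ _ h1 h2 => absurd h1 (not_lt_of_gt h2)) a1 h1 ?_
      rw [List.perm_ext_iff_of_nodup (nodup_of_pairwise_lt a1) (nodup_of_pairwise_lt h1)]
      intro x
      rw [h3, a3]; simp
    rw [← h2, ← this]
    simpa using a4
  · intro h
    refine word_of_split h1 List.Pairwise.nil (fun a _ => hlt _) (by simp) ?_ ?_
    · intro x; rw [h3]; simp
    · rw [h2]; simpa using h

/-- Tableaux whose reading words are primed involution words for `z`. -/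
structure RTab (z : Equiv.Perm ℤ) (T : STab) : Prop where
  ne : NE T
  ok : Ok (entry? T)
  word : rowWord T ∈ RinvPlus z

lemma RTab.fword (h : RTab z T) : FWord z (entry? T) :=
  (word_rowWord T []).2 (by simpa using h.word)

lemma rtab_of_fword (h1 : NE T) (h2 : Ok (entry? T)) (h3 : FWord z (entry? T)) : RTab z T :=
  ⟨h1, h2, by simpa using (word_rowWord T []).1 h3⟩

lemma valid_iff : Valid (· ∈ RinvPlus z) false (entry? T) 0 u ↔
    Ok (entry? T) ∧ rowWord T ++ [u] ∈ RinvPlus z := by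
  constructor
  · intro h
    exact ⟨h.ok, (word_rowWord T [u]).1 (lword_false.1 h.word)⟩
  · rintro ⟨h1, h2⟩
    exact ⟨h1, lword_false.2 ((word_rowWord T [u]).2 h2), rfl⟩

/-- Insertion of a letter `u` into `T` gives `U` with new box `p` and direction flag `g`. -/
def Ins (T : STab) (u : Letter) (U : STab) (p : Box) (g : Bool) : Prop :=
  Run false (entry? T) 0 u (entry? U) p g

lemma exists_ins (hT : NE T) (hok : Ok (entry? T)) (hw : rowWord T ++ [u] ∈ RinvPlus z) :
    ∃ U p g, Ins T u U p g ∧ egInsert T u = (U, g) ∧ RTab z U := by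
  have hV := valid_iff.2 ⟨hok, hw⟩
  obtain ⟨n, hn⟩ := finite_entry T
  obtain ⟨U, p, g, h⟩ := Run.exists hV hn
  obtain ⟨T', h1, h2, h3⟩ := h.egInsert hV rfl hT
  obtain ⟨h4, h5, h6⟩ := h.result hV
  subst h1
  exact ⟨T', p, g, h, h3, rtab_of_fword h2 h4 h5⟩

lemma Ins.eq (h : Ins T u U p g) (hT : NE T) (hok : Ok (entry? T)) (hU : NE U)
    (hw : rowWord T ++ [u] ∈ RinvPlus z) : egInsert T u = (U, g) := by
  obtain ⟨T', h1, h2, h3⟩ := Run.egInsert h (valid_iff.2 ⟨hok, hw⟩) rfl hT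
  rw [h3, entry?_injOn h2 hU h1]

lemma exists_unins (hU : RTab z U) (hp : Corner (entry? U) p) (g : Bool) :
    ∃ T u, NE T ∧ Ok (entry? T) ∧ rowWord T ++ [u] ∈ RinvPlus z ∧ Ins T u U p g := by
  obtain ⟨f, E, i, w, j, h1, h2⟩ := Fin.back hU.ok hU.fword hp g
  obtain ⟨n, hn⟩ := finite_entry U
  obtain ⟨E0, u, h3, h4, h5⟩ := Run.back (Run.fin h2) h1 ⟨n, fun a b hab => by
    by_contra hc
    exact (((Run.fin h2).dom h1).2 a b).2 (Or.inl hc) (hn a b hab)⟩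
  obtain ⟨T, rfl, hT⟩ := exists_list h3.ok (fun _ _ => Iff.rfl) h5
  exact ⟨T, u, hT, (valid_iff.1 h3).1, (valid_iff.1 h3).2, h4⟩

lemma Ins.unique {T' : STab} {u' : Letter} (h : Ins T u U p g) (h' : Ins T' u' U p g)
    (hT : NE T) (hok : Ok (entry? T)) (hw : rowWord T ++ [u] ∈ RinvPlus z)
    (hT' : NE T') (hok' : Ok (entry? T')) (hw' : rowWord T' ++ [u'] ∈ RinvPlus z) :
    T = T' ∧ u = u' := by
  obtain ⟨-, h1, h2⟩ := Run.unique h h' (valid_iff.2 ⟨hok, hw⟩) (valid_iff.2 ⟨hok', hw'⟩)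
  exact ⟨entry?_injOn hT hT' h1, h2⟩

lemma mem_RinvPlus_append {a b : PWord} : a ++ b ∈ RinvPlus z ↔
    ∃ y, a ∈ RinvPlus y ∧ Val y b ∧ act y (unprimeWord b) = z := by
  rw [mem_RinvPlus, val_append, unprimeWord_append, act_append]
  constructor
  · rintro ⟨⟨h1, h2⟩, h3⟩
    exact ⟨_, mem_RinvPlus.2 ⟨h1, rfl⟩, h2, h3⟩
  · rintro ⟨y, h1, h2, h3⟩
    obtain ⟨h4, rfl⟩ := mem_RinvPlus.1 h1
    exact ⟨⟨h4, h2⟩, h3⟩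

lemma RinvPlus_unique {a : PWord} (h : a ∈ RinvPlus z) (h' : a ∈ RinvPlus z') : z = z' := by
  rw [← (mem_RinvPlus.1 h).2, ← (mem_RinvPlus.1 h').2]

lemma rtab_nil : RTab 1 [] where
  ne := by simp [NE]
  ok := by
    have : ∀ a b, entry? ([] : STab) a b = none := fun a b => by simp [entry?, entryG?]
    constructor <;> simp [this, Inc]
  word := mem_RinvPlus_one_nil

lemma PEG_snoc (a : PWord) (u : Letter) : PEG (a ++ [u]) = (egInsert (PEG a) u).1 := by
  simp [PEG]

lemma append_mem_congr {a a' b : PWord} (ha : a ∈ RinvPlus z) (ha' : a' ∈ RinvPlus z)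
    (h : a ++ b ∈ RinvPlus z') : a' ++ b ∈ RinvPlus z' := by
  rw [mem_RinvPlus_append] at h ⊢
  obtain ⟨y, h1, h2⟩ := h
  obtain rfl := RinvPlus_unique ha h1
  exact ⟨_, ha', h2⟩

lemma rtab_PEG {a : PWord} (h : a ∈ RinvPlus z) : RTab z (PEG a) := by
  induction a using List.reverseRecOn generalizing z with
  | nil =>
    obtain rfl := RinvPlus_unique h mem_RinvPlus_one_nil
    exact rtab_nil
  | append_singleton a u ih =>
    obtain ⟨y, h1, -⟩ := mem_RinvPlus_append.1 h
    have h2 := ih h1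
    obtain ⟨U, p, g, -, h3, h4⟩ := exists_ins h2.ne h2.ok (append_mem_congr h1 h2.word h)
    rw [PEG_snoc, h3]
    exact h4

end

/-! ### Certificates for insertion paths -/

section

variable {z : Equiv.Perm ℤ} {E E' F F' U V : Tab} {f f' g g1 g2 : Bool} {i j r c c1 : ℕ}
  {p p1 p2 : Box} {w m : Letter} {x y : ℤ}

/-- The value of the entry in a box. -/
def vl (F : Tab) (a b : ℕ) : Option ℤ := (F a b).map Letter.ceil

lemma vl_eq_some {a b : ℕ} : vl F a b = some x ↔ ∃ y, F a b = some y ∧ y.ceil = x := by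
  simp [vl]

lemma vl_of_some {a b : ℕ} (h : F a b = some w) : vl F a b = some w.ceil := by
  simp [vl, h]

lemma vl_eq_none {a b : ℕ} : vl F a b = none ↔ F a b = none := by
  simp [vl]

lemma vl_upd (a b a' b' : ℕ) : vl (upd F a b (some w)) a' b' =
    if a' = a ∧ b' = b then some w.ceil else vl F a' b' := by
  simp only [vl, upd]
  split_ifs <;> rfl

inductive ColCert (U : Tab) : ℕ → ℤ → ℕ → Prop
  | append {c : ℕ} {x : ℤ} (h1 : ∃ a, vl U a c = some x) (h2 : ∀ a y, vl U a c = some y → y ≤ x)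
      (h3 : U c c = none) : ColCert U c x c
  | bump {c : ℕ} {x m : ℤ} {c1 : ℕ} (h1 : ∃ a, vl U a c = some x)
      (h2 : ∀ a y, vl U a c = some y → x + 1 < y → m < y) (h3 : x < m)
      (h4 : ∀ D, vl U c c = some D → m < D ∨ (m = D ∧ vl U (c - 1) (c - 1) = some (D - 2)))
      (h : ColCert U (c + 1) m c1) : ColCert U c x c1

inductive RowCert (U : Tab) : ℕ → ℤ → Box → Bool → Prop
  | append {r : ℕ} {w : ℤ} {c : ℕ} {g : Bool} (h1 : vl U r c = some w) (h2 : r ≤ c)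
      (h3 : ∀ b y, vl U r b = some y → y ≤ w) (h4 : g = true → c = r) : RowCert U r w (r, c) g
  | bump {r : ℕ} {w m : ℤ} {p : Box} {g : Bool} (h1 : ∃ b, vl U r b = some w)
      (h2 : ∀ b y, vl U r b = some y → w + 1 < y → m < y) (h3 : w < m)
      (h : RowCert U (r + 1) m p g) : RowCert U r w p g
  | diag {r : ℕ} {w m : ℤ} {p : Box} (h1 : vl U r r = some w) (h3 : w < m)
      (h : ColCert U (r + 1) m p.2) : RowCert U r w p true

lemma ColCert.le (h : ColCert U c x c1) : c ≤ c1 := by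
  induction h with
  | append => exact le_rfl
  | bump _ _ _ _ _ ih => omega

lemma RowCert.le (h : RowCert U r x p g) : g = true ∨ r ≤ p.1 := by
  induction h with
  | append => exact Or.inr le_rfl
  | bump _ _ _ _ ih => exact ih.imp_right (by omega)
  | diag => exact Or.inl rfl

/-- The effect of a column step on the values. -/
structure ColStep (E E' : Tab) (c : ℕ) (w m : ℤ) : Prop where
  lt : w < m
  mem' : ∃ a, vl E' a c = some w
  gap' : ∀ a y, vl E' a c = some y → w + 1 < y → m < y
  diag' : ∀ D, vl E' c c = some D → m < D ∨ (m = D ∧ vl E' (c - 1) (c - 1) = some (D - 2))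
  mem : ∃ a, vl E a c = some m
  min : ∀ a y, vl E a c = some y → w < y → m ≤ y
  change : ∀ a b, vl E' a b = vl E a b ∨ b = c ∧ vl E a b = some m ∧ vl E' a b = some w

/-- The effect of a row step on the values. -/
structure RowStep (E E' : Tab) (r : ℕ) (w m : ℤ) : Prop where
  lt : w < m
  mem' : ∃ b, vl E' r b = some w
  gap' : ∀ b y, vl E' r b = some y → w + 1 < y → m < y
  mem : ∃ b, vl E r b = some m
  min : ∀ b y, vl E r b = some y → w < y → m ≤ y
  change : ∀ a b, vl E' a b = vl E a b ∨ a = r ∧ vl E a b = some m ∧ vl E' a b = some w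

lemma Inc.vl_lt (h : Inc E) {a b a' b' : ℕ} (hx : vl E a b = some x) (hy : vl E a' b' = some y)
    (ha : a ≤ a') (hb : b ≤ b') (hne : ¬ (a = a' ∧ b = b')) : x < y := by
  obtain ⟨u, hu, rfl⟩ := vl_eq_some.1 hx
  obtain ⟨v, hv, rfl⟩ := vl_eq_some.1 hy
  exact h _ _ _ _ _ _ hu hv ha hb hne

lemma vl_lines (a b : ℕ) : vl (lines f E) a b = vl E (bx f a b).1 (bx f a b).2 := by
  simp only [vl, lines_apply]

lemma BumpA.rowStep (h : BumpA F i j w F' m) : RowStep F F' i w.ceil m.ceil := by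
  obtain ⟨h1, h2, h3, h4, rfl⟩ := h
  have k : ∀ j' y, vl F i j' = some y → j' < j ∧ y < w.ceil ∨ j' = j ∧ y = m.ceil ∨
      j < j' ∧ m.ceil < y := by
    intro j' y hy
    obtain ⟨u, hu, rfl⟩ := vl_eq_some.1 hy
    rcases lt_trichotomy j' j with hj | rfl | hj
    · exact Or.inl ⟨hj, h3 _ _ hj hu⟩
    · rw [h1] at hu
      rw [Option.some.inj hu]; simp
    · exact Or.inr (Or.inr ⟨hj, h4 _ _ hj hu⟩)
  refine ⟨h2, ⟨j, by simp [vl_upd]⟩, ?_, ⟨j, vl_of_some h1⟩, ?_, ?_⟩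
  · intro b y hy hw
    rw [vl_upd] at hy
    split_ifs at hy with hb
    · have := Option.some.inj hy
      omega
    · have := k b y hy
      omega
  · intro b y hy hw
    have := k b y hy
    omega
  · intro a b
    rw [vl_upd]
    split_ifs with hb
    · obtain ⟨rfl, rfl⟩ := hb
      exact Or.inr ⟨rfl, vl_of_some h1, rfl⟩
    · exact Or.inl rfl

lemma BumpC.vl_eq {q : Bool} (h : BumpC F i j w q F' m) : vl F' = vl F := by
  funext a b
  rw [h.eq, vl_upd, vl_upd]
  split_ifs with h1 h2
  · rw [h1.1, h1.2, vl_of_some h.next]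
  · rw [h2.1, h2.2, vl_of_some h.entry]
  · rfl

lemma BumpC.rowStep {q : Bool} (h : BumpC F i j w q F' m) : RowStep F F' i w.ceil m.ceil := by
  have hm : m.ceil = w.ceil + 1 := by rw [h.out]
  have e := h.vl_eq
  obtain ⟨h1, h2, h3, h4, -, -⟩ := h
  have k : ∀ j' y, vl F i j' = some y → y ≤ w.ceil + 1 ∨ w.ceil + 1 < y := by
    intro j' y hy; omega
  have k2 : vl F i (j + 1) = some m.ceil := by rw [vl_of_some h2, hm]
  refine ⟨by omega, ⟨j, by rw [e]; exact vl_eq_some.2 ⟨_, h1, rfl⟩⟩, ?_, ⟨_, k2⟩, ?_, ?_⟩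
  · intro b y hy hw
    omega
  · intro b y hy hw
    omega
  · intro a b
    exact Or.inl (by rw [e])

lemma RowStep.colStep (h : RowStep (lines true E) (lines true E') c x y)
    (hd : ∀ D, vl E' c c = some D → y < D ∨ (y = D ∧ vl E' (c - 1) (c - 1) = some (D - 2))) :
    ColStep E E' c x y := by
  obtain ⟨h1, h2, h3, h4, h5, h6⟩ := h
  simp only [vl_lines, bx, if_true] at *
  exact ⟨h1, h2, h3, hd, h4, h5, fun a b => h6 b a⟩

lemma Step.col (h : Step true E c w f' E' m) (hV : Valid (· ∈ RinvPlus z) true E c w) :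
    f' = true ∧ ColStep E E' c w.ceil m.ceil := by
  rcases h.inv with ⟨rfl, j, -, h⟩ | ⟨rfl, j, q, -, h⟩ | ⟨h, -⟩ | ⟨h, -⟩
  · refine ⟨rfl, h.rowStep.colStep fun D hD => Or.inl ?_⟩
    have hj := hV.prev.col_lt hV.ok h.before ⟨j, by omega, by rw [h.entry]; simp⟩
    obtain ⟨u, hu, rfl⟩ := vl_eq_some.1 hD
    refine h.after c u hj ?_
    rw [← show lines true E' c c = some u from hu, h.eq, upd_of_ne (by omega)]
  · refine ⟨rfl, h.rowStep.colStep fun D hD => ?_⟩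
    have hm : m.ceil = w.ceil + 1 := by rw [h.out]
    have hj := hV.prev.col_lt hV.ok h.before ⟨j, by omega, by rw [h.entry]; simp⟩
    have e : vl E' = vl E := by
      funext a b
      have := congrFun (congrFun h.vl_eq b) a
      simpa only [vl_lines, bx, if_true] using this
    rw [e] at hD ⊢
    obtain ⟨u, hu, rfl⟩ := vl_eq_some.1 hD
    rcases Nat.lt_or_ge (j + 1) c with hc | hc
    · left
      have := h.after c u hc hu
      omega
    · obtain rfl : c = j + 1 := by omega
      right
      have hu' : E (j + 1) (j + 1) = some ⟨w.ceil + 1, false⟩ := h.next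
      have hx : E j (j + 1) = some ⟨w.ceil, q⟩ := h.entry
      rw [hu'] at hu
      obtain rfl := Option.some.inj hu
      refine ⟨hm, ?_⟩
      obtain ⟨v, hv⟩ := Option.ne_none_iff_exists'.1
        (hV.ok.row j (j + 1) j le_rfl (by omega) (by rw [hx]; simp))
      have h5 : v.ceil < Letter.ceil ⟨w.ceil, q⟩ :=
        hV.ok.inc j j j (j + 1) _ _ hv hx le_rfl (by omega) (by omega)
      have := diag_of_lword (m := w) hV.ok hv h5 hx rfl hu' hV.word
      rw [Nat.add_sub_cancel, vl_of_some hv, this]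
      congr 1
      simp only
      ring
  · simp at h
  · simp at h

lemma Step.row_false (h : Step false E r w false E' m) (hV : Valid (· ∈ RinvPlus z) false E r w) :
    RowStep E E' r w.ceil m.ceil ∧ ∃ d, vl E r r = some d ∧ d < w.ceil := by
  have k : ∀ {F G : Tab} {j : ℕ} {x : Letter}, j ≠ r → lines false F = F → E r j = some x →
      (∀ j' y, j' < j → E r j' = some y → y.ceil < w.ceil) →
      ∃ d, vl E r r = some d ∧ d < w.ceil := by
    intro F G j x hj _ hx hb
    have hrj := hV.ok.dom r j (by rw [hx]; simp)
    obtain ⟨v, hv⟩ := Option.ne_none_iff_exists'.1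
        (hV.ok.row r j r le_rfl hrj (by rw [hx]; simp))
    exact ⟨_, vl_of_some hv, hb r v (by omega) hv⟩
  rcases h.inv with ⟨-, j, hj, h⟩ | ⟨-, j, q, hj, h⟩ | ⟨-, h, -⟩ | ⟨-, h, -⟩
  · exact ⟨h.rowStep, k (F := E) (G := E) (hj rfl) rfl h.entry h.before⟩
  · exact ⟨h.rowStep, k (F := E) (G := E) (hj rfl) rfl h.entry h.before⟩
  · simp at h
  · simp at h

lemma Step.row_true (h : Step false E r w true E' m) (hV : Valid (· ∈ RinvPlus z) false E r w) :
    RowStep E E' r w.ceil m.ceil ∧ vl E' r r = some w.ceil ∧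
      (∃ d, vl E r r = some d ∧ w.ceil ≤ d ∧ d ≤ m.ceil) ∧
      (∃ b, b ≤ r + 1 ∧ vl E r b = some m.ceil) ∧
      (∀ a b, r + 1 ≤ b → vl E' a b = vl E a b) := by
  rcases h.inv with ⟨h, -⟩ | ⟨h, -⟩ | ⟨-, -, d, h1, h2, rfl, rfl⟩ | ⟨-, -, h1, h2, rfl, rfl⟩
  · simp at h
  · simp at h
  · have hA : BumpA E r r w.unprime (upd E r r (some w.unprime)) d := by
      refine ⟨h1, h2, ?_, ?_, rfl⟩
      · intro j' y hj hy
        have := hV.ok.dom r j' (by rw [hy]; simp)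
        omega
      · intro j' y hj hy
        exact hV.ok.inc r r r j' _ _ h1 hy le_rfl (by omega) (by omega)
    refine ⟨hA.rowStep, ?_, ⟨d.ceil, vl_of_some h1, h2.le, le_rfl⟩, ⟨r, by omega, vl_eq_some.2 ⟨_, h1, rfl⟩⟩, ?_⟩
    · rw [vl_upd]; simp [Letter.unprime]
    · intro a b hb
      rw [vl_upd, if_neg (by omega)]
  · have hw : vl E' r r = some w.ceil := vl_eq_some.2 ⟨_, h1, rfl⟩
    have hw' : vl E' r (r + 1) = some (w.ceil + 1) := vl_eq_some.2 ⟨_, h2, rfl⟩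
    refine ⟨⟨by simp, ⟨r, hw⟩, ?_, ⟨r + 1, hw'⟩, ?_, fun _ _ => Or.inl rfl⟩, hw,
      ⟨_, hw, le_rfl, by simp⟩, ⟨r + 1, le_rfl, hw'⟩, fun _ _ _ => rfl⟩
    · intro b y hy hw
      exact hw
    · intro b y hy hw
      exact hw

/-! ### Certificates from runs -/

lemma Fin.col (h : Fin true E c w U p g j) (hV : Valid (· ∈ RinvPlus z) true E c w) :
    g = true ∧ p = (j, c) ∧ j < c ∧ (∀ a y, vl E a c = some y → y < w.ceil) ∧
    E j c = none ∧ U = upd E j c (some w) := by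
  refine ⟨by simp [h.flag], by simp [h.box, bx], h.pos_lt hV.ok hV.prev, ?_, h.empty, ?_⟩
  · intro a y hy
    obtain ⟨u, hu, rfl⟩ := vl_eq_some.1 hy
    exact h.small a u hu
  · rw [h.eq]
    simp [bx, lastLetter]

lemma Fin.row (h : Fin false E r w U p g j) (hV : Valid (· ∈ RinvPlus z) false E r w) :
    (g = true → j = r) ∧ p = (r, j) ∧ r ≤ j ∧ (∀ b y, vl E r b = some y → y < w.ceil) ∧
    E r j = none ∧ (∀ a b, vl U a b = if a = r ∧ b = j then some w.ceil else vl E a b) ∧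
    (E r r = none → j = r) := by
  refine ⟨fun hg => ?_, by simp [h.box, bx], h.row_le hV.ok, ?_, h.empty, ?_, ?_⟩
  · have := h.flag
    rw [hg] at this
    simp at this
    exact this.1
  · intro a y hy
    obtain ⟨u, hu, rfl⟩ := vl_eq_some.1 hy
    exact h.small a u hu
  · intro a b
    rw [h.eq]
    simp only [bx]
    rw [if_neg (by simp), vl_upd, lastLetter_ceil]
  · intro hr
    rcases h.first with h1 | ⟨j0, rfl, h1⟩
    · simpa using h1
    · exact absurd hr (hV.ok.row r j0 r le_rfl (hV.ok.dom _ _ h1) h1)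

lemma Run.col_frame (h : Run f E c w U p g) (hf : f = true)
    (hV : Valid (· ∈ RinvPlus z) f E c w) (a b : ℕ) :
    vl U a b = vl E a b ∨ c ≤ b ∧ (∀ o, vl E a b = some o → w.ceil < o) ∧
      ∃ n, vl U a b = some n ∧ w.ceil ≤ n := by
  induction h with
  | fin h =>
    subst hf
    obtain ⟨-, -, -, -, h1, rfl⟩ := h.col hV
    rw [vl_upd]
    split_ifs with hb
    · obtain ⟨rfl, rfl⟩ := hb
      exact Or.inr ⟨le_rfl, by simp [vl, h1], _, rfl, le_rfl⟩
    · exact Or.inl rfl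
  | step h h' ih =>
    subst hf
    obtain ⟨rfl, hs⟩ := h.col hV
    have h1 := hs.lt
    rcases ih rfl (hV.step h) with h2 | ⟨hb, h2, n, h3, h4⟩
    · rcases hs.change a b with h5 | ⟨rfl, h5, h6⟩
      · exact Or.inl (h2.trans h5)
      · refine Or.inr ⟨le_rfl, ?_, _, h2.trans h6, le_rfl⟩
        rw [h5]; rintro o ⟨⟩; exact h1
    · rcases hs.change a b with h5 | ⟨rfl, -⟩
      · refine Or.inr ⟨by omega, ?_, n, h3, by omega⟩
        intro o ho
        have := h2 o (h5.trans ho)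
        omega
      · omega

lemma Run.row_frame (h : Run f E r w U p g) (hf : f = false)
    (hV : Valid (· ∈ RinvPlus z) f E r w) (a b : ℕ) (ha : a < r) :
    vl U a b = vl E a b ∨ (∀ o, vl E a b = some o → w.ceil < o) ∧
      ∃ n, vl U a b = some n ∧ w.ceil < n := by
  induction h with
  | fin h =>
    subst hf
    obtain ⟨-, -, -, -, -, h1, -⟩ := h.row hV
    left
    rw [h1, if_neg (by omega)]
  | @step f E r w f' E' m U p g h h' ih =>
    subst hf
    cases f' with
    | false =>
      have hs := (h.row_false hV).1
      have h1 := hs.lt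
      rcases hs.change a b with h5 | ⟨rfl, -⟩
      · rw [← h5]
        exact (ih rfl (hV.step h) (by omega)).imp_right fun ⟨h2, n, h3, h4⟩ =>
          ⟨fun o ho => h1.trans (h2 o ho), n, h3, h1.trans h4⟩
      · omega
    | true =>
      have hs := (h.row_true hV).1
      have h1 := hs.lt
      rcases hs.change a b with h5 | ⟨rfl, -⟩
      · rw [← h5]
        exact (h'.col_frame rfl (hV.step h) a b).imp_right fun ⟨_, h2, n, h3, h4⟩ =>
          ⟨fun o ho => h1.trans (h2 o ho), n, h3, h1.trans_le h4⟩
      · omega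

lemma Run.flag_col (h : Run f E c w U p g) (hf : f = true)
    (hV : Valid (· ∈ RinvPlus z) f E c w) : g = true := by
  induction h with
  | fin h => subst hf; exact (h.col hV).1
  | step h h' ih => subst hf; exact ih (h.col hV).1 (hV.step h)

lemma Run.colCert (h : Run f E c w U p g) (hf : f = true)
    (hV : Valid (· ∈ RinvPlus z) f E c w) : ColCert U c w.ceil p.2 := by
  induction h with
  | @fin f E c w U p g j h =>
    subst hf
    obtain ⟨-, rfl, hj, hs, h1, rfl⟩ := h.col hV
    refine .append ⟨j, by simp [vl_upd]⟩ ?_ ?_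
    · intro a y hy
      rw [vl_upd] at hy
      split_ifs at hy with hb
      · exact (Option.some.inj hy).ge
      · exact (hs a y hy).le
    · rw [upd_of_ne (by omega)]
      by_contra hc
      exact hV.ok.col c j c hj.le hc h1
  | @step f E c w f' E' m U p g h h' ih =>
    subst hf
    obtain ⟨rfl, hs⟩ := h.col hV
    have fr : ∀ a b, b ≤ c → vl U a b = vl E' a b := by
      intro a b hb
      rcases h'.col_frame rfl (hV.step h) a b with h2 | ⟨h2, -⟩
      · exact h2
      · omega
    obtain ⟨a, ha⟩ := hs.mem'
    refine .bump (m := m.ceil) ⟨a, by rw [fr _ _ le_rfl, ha]⟩ ?_ hs.lt ?_ (ih rfl (hV.step h))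
    · intro a y
      rw [fr _ _ le_rfl]
      exact hs.gap' a y
    · intro D
      rw [fr _ _ le_rfl, fr _ _ (by omega)]
      exact hs.diag' D

lemma Run.rowCert (h : Run f E r w U p g) (hf : f = false)
    (hV : Valid (· ∈ RinvPlus z) f E r w) : RowCert U r w.ceil p g := by
  induction h with
  | @fin f E r w U p g j h =>
    subst hf
    obtain ⟨h1, rfl, h2, h3, h4, h5, -⟩ := h.row hV
    refine .append (by rw [h5, if_pos ⟨rfl, rfl⟩]) h2 ?_ h1
    intro b y hy
    rw [h5] at hy
    split_ifs at hy with hb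
    · exact (Option.some.inj hy).ge
    · exact (h3 b y hy).le
  | @step f E r w f' E' m U p g h h' ih =>
    subst hf
    cases f' with
    | false =>
      have hs := (h.row_false hV).1
      have fr := fun b => h'.row_frame rfl (hV.step h) r b (by omega)
      obtain ⟨b, hb⟩ := hs.mem'
      refine .bump (m := m.ceil) ⟨b, ?_⟩ ?_ hs.lt (ih rfl (hV.step h))
      · rcases fr b with h1 | ⟨h1, -⟩
        · rw [h1, hb]
        · exact absurd (h1 _ hb) hs.lt.not_gt
      · intro b y hy
        rcases fr b with h1 | ⟨-, n, h1, h2⟩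
        · exact hs.gap' b y (h1 ▸ hy)
        · rw [h1] at hy
          rw [← Option.some.inj hy]
          exact fun _ => h2
    | true =>
      obtain ⟨hs, h1, -⟩ := h.row_true hV
      have h2 := Run.colCert h' rfl (hV.step h)
      obtain rfl := h'.flag_col rfl (hV.step h)
      refine .diag ?_ hs.lt h2
      rcases h'.col_frame rfl (hV.step h) r r with h3 | ⟨h3, -⟩
      · rw [h3, h1]
      · omega

lemma Run.col_le (h : Run true E c w U p g) (hV : Valid (· ∈ RinvPlus z) true E c w) :
    g = true ∧ c ≤ p.2 :=
  ⟨h.flag_col rfl hV, (h.colCert rfl hV).le⟩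

lemma Run.row_le (h : Run false E r w U p g) (hV : Valid (· ∈ RinvPlus z) false E r w)
    (hg : g = false) : r ≤ p.1 := by
  have := h.line_le hV
  rwa [lastLine, if_neg (by simp [hg])] at this

/-! ### Comparison of consecutive insertions -/

def FrC (F U : Tab) (c : ℕ) (y : ℤ) : Prop := ∀ a b, c ≤ b → vl F a b = vl U a b ∨
  ∃ o n, vl U a b = some o ∧ vl F a b = some n ∧ o < y ∧ n < y

def FrR (F U : Tab) (r : ℕ) (y : ℤ) : Prop := ∀ a b, vl F a b = vl U a b ∨
  a < r ∧ ∃ o n, vl U a b = some o ∧ vl F a b = some n ∧ o ≤ y ∧ n ≤ y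

lemma FrC.next (h : FrC F U c x) (hs : ColStep F F' c x y) : FrC F' U (c + 1) y := by
  intro a b hb
  rcases hs.change a b with h1 | ⟨rfl, -⟩
  · rw [h1]
    have := hs.lt
    exact (h a b (by omega)).imp_right fun ⟨o, n, h1, h2, h3, h4⟩ =>
      ⟨o, n, h1, h2, by omega, by omega⟩
  · omega

lemma FrC.up (h : FrC F U c y) {a : ℕ} (hx : vl U a c = some x) (hxy : y ≤ x) :
    vl F a c = some x := by
  rcases h a c le_rfl with h1 | ⟨o, n, h1, -, h2, -⟩
  · rw [h1, hx]
  · rw [hx] at h1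
    obtain rfl := Option.some.inj h1
    omega

lemma FrC.down (h : FrC F U c y) {a : ℕ} (hx : vl F a c = some x) (hxy : y ≤ x) :
    vl U a c = some x := by
  rcases h a c le_rfl with h1 | ⟨o, n, -, h1, -, h2⟩
  · rw [← h1, hx]
  · rw [hx] at h1
    obtain rfl := Option.some.inj h1
    omega

lemma FrR.row (h : FrR F U r y) (b : ℕ) : vl F r b = vl U r b := by
  rcases h r b with h1 | ⟨h1, -⟩
  · exact h1
  · omega

lemma FrR.next (h : FrR F U r x) (hs : RowStep F F' r x y) : FrR F' U (r + 1) y := by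
  intro a b
  have h1 := hs.lt
  rcases hs.change a b with h2 | ⟨rfl, h2, h3⟩
  · rw [h2]
    exact (h a b).imp_right fun ⟨h0, o, n, h1, h2, h3, h4⟩ =>
      ⟨by omega, o, n, h1, h2, by omega, by omega⟩
  · rw [h.row] at h2
    exact Or.inr ⟨by omega, _, _, h2, h3, le_rfl, h1.le⟩

lemma FrR.toC (h : FrR F U r x) (hs : RowStep F F' r x y)
    (hc : ∀ a b, r + 1 ≤ b → vl F' a b = vl F a b) : FrC F' U (r + 1) y := by
  intro a b hb
  have h1 := hs.lt
  rw [hc a b hb]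
  exact (h a b).imp_right fun ⟨h0, o, n, h1, h2, h3, h4⟩ =>
      ⟨o, n, h1, h2, by omega, by omega⟩

lemma ColCert.asc (hC : ColCert U c x c1) (h : Run true F c w V p2 g2)
    (hV : Valid (· ∈ RinvPlus z) true F c w) (hF : FrC F U c w.ceil) (hx : x < w.ceil) :
    p2.2 ≤ c1 := by
  induction hC generalizing F w with
  | @append c x h1 h2 h3 =>
    cases h with
    | fin h =>
      obtain ⟨-, rfl, -⟩ := h.col hV
      exact le_rfl
    | step h h' =>
      obtain ⟨rfl, hs⟩ := h.col hV
      obtain ⟨a, ha⟩ := hs.mem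
      have := h2 a _ (hF.down ha hs.lt.le)
      have := hs.lt
      omega
  | @bump c x m1 c1 h1 h2 h3 h4 hC ih =>
    cases h with
    | fin h =>
      obtain ⟨-, rfl, -⟩ := h.col hV
      have := hC.le
      simp only
      omega
    | step h h' =>
      obtain ⟨rfl, hs⟩ := h.col hV
      obtain ⟨a, ha⟩ := hs.mem
      have hl := hs.lt
      exact ih h' (hV.step h) (hF.next hs) (h2 a _ (hF.down ha hl.le) (by omega))

lemma ColCert.desc (hC : ColCert U c x c1) (h : Run true F c w V p2 g2)
    (hV : Valid (· ∈ RinvPlus z) true F c w) (hF : FrC F U c w.ceil) (hx : w.ceil < x) :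
    c1 < p2.2 := by
  induction hC generalizing F w with
  | @append c x h1 h2 h3 =>
    obtain ⟨a, ha⟩ := h1
    have ha := hF.up ha hx.le
    cases h with
    | fin h =>
      obtain ⟨-, rfl, -, hs, -⟩ := h.col hV
      exact absurd (hs _ _ ha) hx.not_gt
    | step h h' =>
      obtain ⟨rfl, hs⟩ := h.col hV
      exact (h'.col_le (hV.step h)).2
  | @bump c x m1 c1 h1 h2 h3 h4 hC ih =>
    obtain ⟨a, ha⟩ := h1
    have ha := hF.up ha hx.le
    cases h with
    | fin h =>
      obtain ⟨-, rfl, -, hs, -⟩ := h.col hV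
      exact absurd (hs _ _ ha) hx.not_gt
    | step h h' =>
      obtain ⟨rfl, hs⟩ := h.col hV
      exact ih h' (hV.step h) (hF.next hs) ((hs.min _ _ ha hx).trans_lt h3)

lemma RowCert.desc_col (hU : Ok U) (hR : RowCert U c x p1 g1) (h : Run true F c w V p2 g2)
    (hV : Valid (· ∈ RinvPlus z) true F c w) (hF : FrC F U c w.ceil)
    (hD : ∀ D, vl U c c = some D → w.ceil < D) (hg : g1 = true) : p1.2 < p2.2 := by
  induction hR generalizing F w with
  | @append c x c' g h1 h2 h3 h4 =>
    obtain rfl := h4 hg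
    have hx := hD _ h1
    have ha := hF.up h1 hx.le
    cases h with
    | fin h =>
      obtain ⟨-, rfl, -, hs, -⟩ := h.col hV
      exact absurd (hs _ _ ha) hx.not_gt
    | step h h' =>
      obtain ⟨rfl, hs⟩ := h.col hV
      exact (h'.col_le (hV.step h)).2
  | @bump c x m1 p1 g1 h1 h2 h3 hR ih =>
    obtain ⟨b, hb⟩ := h1
    obtain ⟨D, hDD⟩ : ∃ D, vl U c c = some D := by
      obtain ⟨u, hu, -⟩ := vl_eq_some.1 hb
      have hne : U c b ≠ none := by rw [hu]; simp
      obtain ⟨v, hv⟩ := Option.ne_none_iff_exists'.1 (hU.row c b c le_rfl (hU.dom _ _ hne) hne)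
      exact ⟨_, vl_of_some hv⟩
    have hx := hD _ hDD
    have ha := hF.up hDD hx.le
    cases h with
    | fin h =>
      obtain ⟨-, rfl, -, hs, -⟩ := h.col hV
      exact absurd (hs _ _ ha) hx.not_gt
    | step h h' =>
      obtain ⟨rfl, hs⟩ := h.col hV
      refine ih h' (hV.step h) (hF.next hs) (fun D' hD' => ?_) hg
      have := hU.inc.vl_lt hDD hD' (by omega) (by omega) (by omega)
      exact (hs.min _ _ ha hx).trans_lt this
  | @diag c x m1 p1 h1 h3 hC =>
    have hx := hD _ h1
    have ha := hF.up h1 hx.le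
    cases h with
    | fin h =>
      obtain ⟨-, rfl, -, hs, -⟩ := h.col hV
      exact absurd (hs _ _ ha) hx.not_gt
    | step h h' =>
      obtain ⟨rfl, hs⟩ := h.col hV
      exact hC.desc h' (hV.step h) (hF.next hs) ((hs.min _ _ ha hx).trans_lt h3)

lemma ColCert.asc_row (hC : ColCert U r x c1) (h : Run false F r w V p2 g2)
    (hV : Valid (· ∈ RinvPlus z) false F r w) (hF : FrR F U r w.ceil)
    (hD : ∀ v, vl U (r - 1) (r - 1) = some v → v + 2 ≤ w.ceil) (hg : g2 = true) :
    p2.2 ≤ c1 := by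
  induction hC generalizing F w with
  | @append r x h1 h2 h3 =>
    have hr : F r r = none := by rw [← vl_eq_none, hF.row, vl_eq_none, h3]
    cases h with
    | fin h =>
      obtain ⟨-, rfl, -, -, -, -, h⟩ := h.row hV
      exact (h hr).le
    | @step _ _ _ _ f' F' m _ _ _ h h' =>
      cases f' with
      | false =>
        obtain ⟨-, d, hd, -⟩ := h.row_false hV
        rw [vl_eq_none.2 hr] at hd
        simp at hd
      | true =>
        obtain ⟨-, -, ⟨d, hd, -⟩, -⟩ := h.row_true hV
        rw [vl_eq_none.2 hr] at hd
        simp at hd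
  | @bump r x m1 c1 h1 h2 h3 h4 hC ih =>
    cases h with
    | fin h =>
      obtain ⟨hj, rfl, -⟩ := h.row hV
      have := hC.le
      have := hj hg
      simp only
      omega
    | @step _ _ _ _ f' F' m _ _ _ h h' =>
      cases f' with
      | false =>
        obtain ⟨hs, d, hd, hdw⟩ := h.row_false hV
        have hl := hs.lt
        refine ih h' (hV.step h) (hF.next hs) ?_
        intro v hv
        rw [Nat.add_sub_cancel, ← hF.row, hd] at hv
        have := Option.some.inj hv
        omega
      | true =>
        obtain ⟨hs, -, ⟨d, hd, hd1, hd2⟩, -, hc⟩ := h.row_true hV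
        have hl := hs.lt
        refine hC.asc h' (hV.step h) (hF.toC hs hc) ?_
        rcases h4 d (by rw [← hF.row, hd]) with h5 | ⟨h5, h6⟩
        · omega
        · have := hD _ h6
          omega

lemma RowCert.asc (hU : Ok U) (hR : RowCert U r x p1 g1) (h : Run false F r w V p2 g2)
    (hV : Valid (· ∈ RinvPlus z) false F r w) (hF : FrR F U r w.ceil) (hx : x < w.ceil) :
    (g2 = true → g1 = true ∧ p2.2 ≤ p1.2) ∧ (g2 = false → g1 = true ∨ p2.1 ≤ p1.1) := by
  have ne : ∀ {b : ℕ} {x : ℤ} {r : ℕ} {F : Tab} {w : Letter}, vl U r b = some x →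
      FrR F U r w.ceil → F r r ≠ none := by
    intro b x r F w hb hF
    obtain ⟨u, hu, -⟩ := vl_eq_some.1 hb
    have hne : U r b ≠ none := by rw [hu]; simp
    have := hU.row r b r le_rfl (hU.dom _ _ hne) hne
    rwa [ne_eq, ← vl_eq_none, hF.row, vl_eq_none]
  induction hR generalizing F w with
  | @append r x c' g h1 h2 h3 h4 =>
    have hne := ne h1 hF
    cases h with
    | fin h =>
      obtain ⟨hj, rfl, -, -, he, -⟩ := h.row hV
      refine ⟨fun hg => ?_, fun _ => Or.inr le_rfl⟩
      rw [hj hg] at he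
      exact absurd he hne
    | @step _ _ _ _ f' F' m _ _ _ h h' =>
      have hs : RowStep F F' r w.ceil m.ceil := by
        cases f' with
        | false => exact (h.row_false hV).1
        | true => exact (h.row_true hV).1
      obtain ⟨b, hb⟩ := hs.mem
      rw [hF.row] at hb
      have := h3 _ _ hb
      have := hs.lt
      omega
  | @bump r x m1 p1 g1 h1 h2 h3 hR ih =>
    obtain ⟨b, hb⟩ := h1
    have hne := ne hb hF
    cases h with
    | fin h =>
      obtain ⟨hj, rfl, -, -, he, -⟩ := h.row hV
      refine ⟨fun hg => ?_, fun _ => hR.le.imp_right fun h => by simp only; omega⟩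
      rw [hj hg] at he
      exact absurd he hne
    | @step _ _ _ _ f' F' m _ _ _ h h' =>
      cases f' with
      | false =>
        obtain ⟨hs, -⟩ := h.row_false hV
        obtain ⟨b, hb⟩ := hs.mem
        rw [hF.row] at hb
        have hl := hs.lt
        exact ih h' (hV.step h) (hF.next hs) (h2 _ _ hb (by omega))
      | true =>
        obtain ⟨hs, -, ⟨d, hd, hd1, hd2⟩, -, hc⟩ := h.row_true hV
        rw [hF.row] at hd
        obtain ⟨u, hu, -⟩ := vl_eq_some.1 hb
        have hrb := hU.dom r b (by rw [hu]; simp)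
        rcases hrb.eq_or_lt with rfl | hrb
        · rw [hd] at hb
          have := Option.some.inj hb
          omega
        · have := hU.inc.vl_lt hd hb le_rfl hrb.le (by omega)
          omega
  | @diag r x m1 p1 h1 h3 hC =>
    have hne := ne h1 hF
    refine ⟨fun hg => ⟨rfl, ?_⟩, fun _ => Or.inl rfl⟩
    cases h with
    | fin h =>
      obtain ⟨hj, rfl, -, -, he, -⟩ := h.row hV
      rw [hj hg] at he
      exact absurd he hne
    | @step _ _ _ _ f' F' m _ _ _ h h' =>
      cases f' with
      | false =>
        obtain ⟨hs, -⟩ := h.row_false hV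
        have hl := hs.lt
        refine hC.asc_row h' (hV.step h) (hF.next hs) ?_ hg
        intro v hv
        rw [Nat.add_sub_cancel, h1] at hv
        have := Option.some.inj hv
        omega
      | true =>
        obtain ⟨hs, -, ⟨d, hd, hd1, hd2⟩, -, hc⟩ := h.row_true hV
        rw [hF.row, h1] at hd
        have := Option.some.inj hd
        omega

lemma RowCert.desc (hU : Ok U) (hR : RowCert U r x p1 g1) (h : Run false F r w V p2 g2)
    (hV : Valid (· ∈ RinvPlus z) false F r w) (hF : FrR F U r w.ceil) (hx : w.ceil < x) :
    (g2 = true → g1 = true → p1.2 < p2.2) ∧ (g2 = false → g1 = false ∧ p1.1 < p2.1) := by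
  induction hR generalizing F w with
  | @append r x c' g h1 h2 h3 h4 =>
    have ha := h1
    rw [← hF.row] at ha
    cases h with
    | fin h =>
      obtain ⟨-, rfl, -, hs, -⟩ := h.row hV
      exact absurd (hs _ _ ha) hx.not_gt
    | @step _ _ _ _ f' F' m _ _ _ h h' =>
      cases f' with
      | false =>
        obtain ⟨hs, d, hd, hdw⟩ := h.row_false hV
        have hg : g = false := by
          by_contra hg
          obtain rfl := h4 (by simpa using hg)
          rw [ha] at hd
          have := Option.some.inj hd
          omega
        refine ⟨fun _ h => by simp [hg] at h, fun h2 => ⟨hg, h'.row_le (hV.step h) h2⟩⟩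
      | true =>
        obtain ⟨hg2, hle⟩ := h'.col_le (hV.step h)
        refine ⟨fun _ hg => ?_, fun hg => by simp [hg2] at hg⟩
        simpa [h4 hg] using hle
  | @bump r x m1 p1 g1 h1 h2 h3 hR ih =>
    obtain ⟨b, hb⟩ := h1
    have ha := hb
    rw [← hF.row] at ha
    cases h with
    | fin h =>
      obtain ⟨-, rfl, -, hs, -⟩ := h.row hV
      exact absurd (hs _ _ ha) hx.not_gt
    | @step _ _ _ _ f' F' m _ _ _ h h' =>
      cases f' with
      | false =>
        obtain ⟨hs, -⟩ := h.row_false hV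
        exact ih h' (hV.step h) (hF.next hs) ((hs.min _ _ ha hx).trans_lt h3)
      | true =>
        obtain ⟨hs, -, -, ⟨b', hb', hm⟩, hc⟩ := h.row_true hV
        obtain ⟨hg2, -⟩ := h'.col_le (hV.step h)
        refine ⟨fun _ hg => ?_, fun hg => by simp [hg2] at hg⟩
        refine hR.desc_col hU h' (hV.step h) (hF.toC hs hc) ?_ hg
        intro D hD
        rw [hF.row] at hm
        exact hU.inc.vl_lt hm hD (by omega) hb' (by omega)
  | @diag r x m1 p1 h1 h3 hC =>
    have ha := h1
    rw [← hF.row] at ha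
    cases h with
    | fin h =>
      obtain ⟨-, rfl, -, hs, -⟩ := h.row hV
      exact absurd (hs _ _ ha) hx.not_gt
    | @step _ _ _ _ f' F' m _ _ _ h h' =>
      cases f' with
      | false =>
        obtain ⟨-, d, hd, hdw⟩ := h.row_false hV
        rw [ha] at hd
        have := Option.some.inj hd
        omega
      | true =>
        obtain ⟨hs, -, -, -, hc⟩ := h.row_true hV
        obtain ⟨hg2, -⟩ := h'.col_le (hV.step h)
        refine ⟨fun _ _ => ?_, fun hg => by simp [hg2] at hg⟩
        exact hC.desc h' (hV.step h) (hF.toC hs hc) ((hs.min _ _ ha hx).trans_lt h3)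

end

/-! ### Semistandard arrays and the position of their maximal entry -/

section

variable {Q Q1 Q2 U U1 U2 : Tab} {p p1 p2 : Box} {x x1 x2 y : Letter} {v v1 v2 : ℤ} {g1 g2 : Bool}
  {a b : ℕ}

lemma letter_le : x ≤ y ↔ x.ceil < y.ceil ∨ x.ceil = y.ceil ∧ (y.primed = true → x.primed = true) := by
  have : x ≤ y ↔ toLex (x.ceil, !x.primed) ≤ toLex (y.ceil, !y.primed) := Iff.rfl
  rw [this, Prod.Lex.toLex_le_toLex]
  cases x.primed <;> cases y.primed <;> simp

/-- The array `Q` is semistandard. -/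
structure SS (Q : Tab) : Prop where
  pos : ∀ a b x, Q a b = some x → 0 < x.ceil
  le : ∀ a b a' b' x y, Q a b = some x → Q a' b' = some y → a ≤ a' → b ≤ b' → x ≤ y
  row : ∀ a b b' x, b < b' → Q a b = some x → Q a b' = some x → x.primed = false
  col : ∀ a a' b x, a < a' → Q a b = some x → Q a' b = some x → x.primed = true

/-- The box `p` contains the last occurrence `x` of the maximal entry of `Q`. -/
structure MaxAt (Q : Tab) (p : Box) (x : Letter) : Prop where
  mem : Q p.1 p.2 = some x
  le : ∀ a b y, Q a b = some y → y ≤ x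
  primed : x.primed = true → ∀ a b, Q a b = some x → a ≤ p.1
  unprimed : x.primed = false → ∀ a b, Q a b = some x → b ≤ p.2

lemma SS.remove (h : SS Q) (a b : ℕ) : SS (upd Q a b none) := by
  have key : ∀ {c d x}, upd Q a b none c d = some x → Q c d = some x := by
    intro c d x hx
    simp only [upd] at hx
    split_ifs at hx
    exact hx
  constructor
  · exact fun c d x hx => h.pos c d x (key hx)
  · exact fun c d c' d' x y hx hy => h.le c d c' d' x y (key hx) (key hy)
  · exact fun c d d' x hd hx hy => h.row c d d' x hd (key hx) (key hy)
  · exact fun c c' d x hd hx hy => h.col c c' d x hd (key hx) (key hy)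

lemma MaxAt.unique (hQ : SS Q) (h1 : MaxAt Q p1 x1) (h2 : MaxAt Q p2 x2) : p1 = p2 ∧ x1 = x2 := by
  obtain rfl : x1 = x2 := le_antisymm (h2.le _ _ _ h1.mem) (h1.le _ _ _ h2.mem)
  obtain ⟨a1, b1⟩ := p1
  obtain ⟨a2, b2⟩ := p2
  have m1 := h1.mem
  have m2 := h2.mem
  dsimp only at m1 m2
  refine ⟨?_, rfl⟩
  cases hx : x1.primed with
  | true =>
    obtain rfl : a1 = a2 := le_antisymm (h2.primed hx _ _ m1) (h1.primed hx _ _ m2)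
    rcases lt_trichotomy b1 b2 with h | rfl | h
    · rw [hQ.row _ _ _ _ h m1 m2] at hx; simp at hx
    · rfl
    · rw [hQ.row _ _ _ _ h m2 m1] at hx; simp at hx
  | false =>
    obtain rfl : b1 = b2 := le_antisymm (h2.unprimed hx _ _ m1) (h1.unprimed hx _ _ m2)
    rcases lt_trichotomy a1 a2 with h | rfl | h
    · rw [hQ.col _ _ _ _ h m1 m2] at hx; simp at hx
    · rfl
    · rw [hQ.col _ _ _ _ h m2 m1] at hx; simp at hx

lemma MaxAt.exists (hfin : ∃ n, ∀ a b, n ≤ a ∨ n ≤ b → Q a b = none) (hne : ∃ a b, Q a b ≠ none) :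
    ∃ p x, MaxAt Q p x := by
  obtain ⟨n, hn⟩ := hfin
  obtain ⟨a, b, hab⟩ := hne
  let S : Set Box := {p | Q p.1 p.2 ≠ none}
  have hS : S.Finite := by
    refine ((Set.finite_Iio n).prod (Set.finite_Iio n)).subset ?_
    rintro ⟨c, d⟩ hcd
    simp only [Set.mem_prod, Set.mem_Iio]
    by_contra h
    exact hcd (hn c d (by omega))
  let lt : Box → Letter := fun p => (Q p.1 p.2).getD default
  obtain ⟨p, hp, hmax⟩ := Set.exists_max_image S
    (fun p => toLex (lt p, if (lt p).primed then p.1 else p.2)) hS ⟨(a, b), hab⟩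
  obtain ⟨x, hx⟩ := Option.ne_none_iff_exists'.1 hp
  have hlt : ∀ c d y, Q c d = some y → lt (c, d) = y := fun c d y h => by simp [lt, h]
  have hpx : lt p = x := hlt _ _ _ hx
  have hm : ∀ c d y, Q c d = some y →
      y < x ∨ y = x ∧ (if y.primed then c else d) ≤ if x.primed then p.1 else p.2 := by
    intro c d y h
    have := hmax (c, d) (by simp [S, h])
    rwa [hlt _ _ _ h, hpx, Prod.Lex.toLex_le_toLex] at this
  refine ⟨p, x, hx, fun c d y h => ?_, fun h c d h' => ?_, fun h c d h' => ?_⟩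
  · rcases hm c d y h with h | h
    exacts [h.le, h.1.le]
  · rcases hm c d x h' with h1 | h1
    · exact absurd h1 (lt_irrefl _)
    · simpa [h] using h1.2
  · rcases hm c d x h' with h1 | h1
    · exact absurd h1 (lt_irrefl _)
    · simpa [h] using h1.2

lemma MaxAt.corner (hQ : SS Q) (h : MaxAt Q p x) : Corner Q p where
  mem := by rw [h.mem]; simp
  right := by
    by_contra hc
    obtain ⟨y, hy⟩ := Option.ne_none_iff_exists'.1 hc
    obtain rfl : x = y := le_antisymm (hQ.le _ _ _ _ _ _ h.mem hy le_rfl (by omega)) (h.le _ _ _ hy)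
    have := h.unprimed (hQ.row _ _ _ _ (Nat.lt_succ_self _) h.mem hy) _ _ hy
    omega
  up := by
    by_contra hc
    obtain ⟨y, hy⟩ := Option.ne_none_iff_exists'.1 hc
    obtain rfl : x = y := le_antisymm (hQ.le _ _ _ _ _ _ h.mem hy (by omega) le_rfl) (h.le _ _ _ hy)
    have := h.primed (hQ.col _ _ _ _ (Nat.lt_succ_self _) h.mem hy) _ _ hy
    omega

lemma Corner.congr (h : Corner Q p) (hd : ∀ a b, Q a b ≠ none ↔ U a b ≠ none) : Corner U p where
  mem := (hd _ _).1 h.mem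
  right := not_ne_iff.1 fun hc => (hd _ _).2 hc h.right
  up := not_ne_iff.1 fun hc => (hd _ _).2 hc h.up

lemma SS.add (hQ : SS Q) (hne : ∀ a b, Q a b ≠ none → p.1 ≤ a → p.2 ≤ b → False)
    (hx : 0 < x.ceil) (hle : ∀ a b y, Q a b = some y → y ≤ x)
    (h1 : x.primed = true → ∀ a b, Q a b = some x → a < p.1)
    (h2 : x.primed = false → ∀ a b, Q a b = some x → b < p.2) :
    SS (upd Q p.1 p.2 (some x)) ∧ MaxAt (upd Q p.1 p.2 (some x)) p x := by
  have key : ∀ {c d y}, upd Q p.1 p.2 (some x) c d = some y →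
      (c = p.1 ∧ d = p.2 ∧ x = y) ∨ (Q c d = some y ∧ (p.1 ≤ c → p.2 ≤ d → False)) := by
    intro c d y hy
    simp only [upd] at hy
    split_ifs at hy with h
    · exact Or.inl ⟨h.1, h.2, by simpa using hy⟩
    · exact Or.inr ⟨hy, hne c d (by rw [hy]; simp)⟩
  refine ⟨⟨fun a b y hy => ?_, fun a b a' b' y y' hy hy' ha hb => ?_, fun a b b' y hb hy hy' => ?_,
    fun a a' b y ha hy hy' => ?_⟩, ⟨upd_self _ _ _ _, fun a b y hy => ?_, fun hp a b hy => ?_,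
    fun hp a b hy => ?_⟩⟩
  · rcases key hy with ⟨-, -, rfl⟩ | ⟨h, -⟩
    exacts [hx, hQ.pos _ _ _ h]
  · rcases key hy with ⟨rfl, rfl, rfl⟩ | ⟨h, -⟩ <;> rcases key hy' with ⟨rfl, rfl, rfl⟩ | ⟨h', h''⟩
    · exact le_rfl
    · exact (h'' ha hb).elim
    · exact hle _ _ _ h
    · exact hQ.le _ _ _ _ _ _ h h' ha hb
  · rcases key hy with ⟨rfl, rfl, rfl⟩ | ⟨h, -⟩ <;> rcases key hy' with ⟨h3, h4, h5⟩ | ⟨h', h''⟩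
    · omega
    · exact (h'' le_rfl hb.le).elim
    · subst h5 h3
      by_contra hc
      exact lt_irrefl _ (h1 (by simpa using hc) _ _ h)
    · exact hQ.row _ _ _ _ hb h h'
  · rcases key hy with ⟨rfl, rfl, rfl⟩ | ⟨h, -⟩ <;> rcases key hy' with ⟨h3, h4, h5⟩ | ⟨h', h''⟩
    · omega
    · exact (h'' ha.le le_rfl).elim
    · subst h5 h4
      by_contra hc
      exact lt_irrefl _ (h2 (by simpa using hc) _ _ h)
    · exact hQ.col _ _ _ _ ha h h'
  · rcases key hy with ⟨-, -, rfl⟩ | ⟨h, -⟩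
    exacts [le_rfl, hle _ _ _ h]
  · rcases key hy with ⟨h, -, -⟩ | ⟨h, -⟩
    exacts [h.le, (h1 hp _ _ h).le]
  · rcases key hy with ⟨-, h, -⟩ | ⟨h, -⟩
    exacts [h.le, (h2 hp _ _ h).le]

lemma Ok.mem_of_le (hU : Ok U) (h : U a b ≠ none) (hp : p.1 ≤ p.2) (ha : p.1 ≤ a) (hb : p.2 ≤ b) :
    U p.1 p.2 ≠ none := hU.row _ _ _ hp hb (hU.col _ _ _ ha h)

lemma SS.step (hU1 : Ok U1) (hU2 : Ok U2) (hd : ∀ a b, U2 a b ≠ none ↔ U1 a b ≠ none ∨ (a, b) = p2)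
    (hn : U1 p2.1 p2.2 = none) (hQ : SS Q) (hQd : ∀ a b, Q a b ≠ none ↔ U1 a b ≠ none)
    (hM : MaxAt Q p1 ⟨v1, g1⟩) (hv2 : 0 < v2)
    (hv : v1 < v2 ∨ v1 = v2 ∧ (g2 = true → g1 = true ∧ p2.2 ≤ p1.2) ∧
      (g2 = false → g1 = true ∨ p2.1 ≤ p1.1)) :
    SS (upd Q p2.1 p2.2 (some ⟨v2, g2⟩)) ∧ MaxAt (upd Q p2.1 p2.2 (some ⟨v2, g2⟩)) p2 ⟨v2, g2⟩ := by
  have hp2 : p2.1 ≤ p2.2 := hU2.dom _ _ ((hd _ _).2 (Or.inr rfl))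
  have hne : ∀ a b, Q a b ≠ none → p2.1 ≤ a → p2.2 ≤ b → False := fun a b h ha hb =>
    hU1.mem_of_le ((hQd _ _).1 h) hp2 ha hb hn
  have hp1 := hne p1.1 p1.2 (by rw [hM.mem]; simp)
  refine hQ.add hne hv2 ?_ ?_ ?_
  · intro a b y hy
    have := hM.le _ _ _ hy
    rw [letter_le] at this ⊢
    dsimp only at this ⊢
    rcases hv with hv | ⟨rfl, h1, h2⟩
    · omega
    · exact this.imp_right (And.imp_right fun h hg => h (h1 hg).1)
  · intro hg a b hy
    dsimp only at hg
    subst hg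
    have := hM.le _ _ _ hy
    rw [letter_le] at this
    dsimp only at this
    rcases hv with hv | ⟨rfl, h1, h2⟩
    · omega
    · obtain ⟨rfl, h⟩ := h1 rfl
      have := hM.primed rfl _ _ hy
      exact not_le.1 fun h0 => hp1 (h0.trans this) h
  · intro hg a b hy
    dsimp only at hg
    subst hg
    have := hM.le _ _ _ hy
    rw [letter_le] at this
    dsimp only at this
    rcases hv with hv | ⟨rfl, h1, h2⟩
    · omega
    · cases g1 with
      | true => simp at this
      | false =>
        have h3 := hM.unprimed rfl _ _ hy
        have h4 := h2 rfl
        simp only [Bool.false_eq_true, false_or] at h4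
        exact not_le.1 fun h0 => hp1 h4 (h0.trans h3)

lemma SS.descent (hU2 : Ok U2) (hd : ∀ a b, U2 a b ≠ none ↔ U1 a b ≠ none ∨ (a, b) = p2)
    (hQ : SS Q) (hQd : ∀ a b, Q a b ≠ none ↔ U2 a b ≠ none) (hM2 : MaxAt Q p2 ⟨v2, g2⟩)
    (hM1 : MaxAt (upd Q p2.1 p2.2 none) p1 ⟨v1, g1⟩) (hc : Corner U1 p1) :
    v1 < v2 ∨ v1 = v2 ∧ ¬ ((g2 = true → g1 = true → p1.2 < p2.2) ∧
      (g2 = false → g1 = false ∧ p1.1 < p2.1)) := by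
  have hne : ¬ (p1.1 = p2.1 ∧ p1.2 = p2.2) := by
    intro h
    have := hM1.mem
    rw [h.1, h.2, upd_self] at this
    simp at this
  have hm1 : Q p1.1 p1.2 = some ⟨v1, g1⟩ := by
    have := hM1.mem
    rwa [upd_of_ne hne] at this
  have hle := hM2.le _ _ _ hm1
  rw [letter_le] at hle
  dsimp only at hle
  rcases hle with hle | ⟨rfl, hg⟩
  · exact Or.inl hle
  refine Or.inr ⟨rfl, ?_⟩
  rintro ⟨h1, h2⟩
  have hp1 : p1.1 ≤ p1.2 := hU2.dom _ _ ((hQd _ _).1 (by rw [hm1]; simp))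
  have hm : U2 p2.1 p2.2 ≠ none := (hd _ _).2 (Or.inr rfl)
  have hfin : p1.1 < p2.1 → p1.2 < p2.2 → False := by
    intro ha hb
    have := hU2.mem_of_le (p := (p1.1, p1.2 + 1)) hm (by dsimp only; omega) ha.le hb
    rcases (hd _ _).1 this with h | h
    · exact h hc.right
    · rw [Prod.ext_iff] at h
      dsimp only at h
      omega
  cases g2 with
  | true =>
    obtain rfl := hg rfl
    have h3 := h1 rfl rfl
    have h4 := hM2.primed rfl _ _ hm1
    rcases h4.eq_or_lt with h5 | h5
    · rw [h5] at hm1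
      have := hQ.row _ _ _ _ h3 hm1 hM2.mem
      simp at this
    · exact hfin h5 h3
  | false =>
    obtain ⟨rfl, h3⟩ := h2 rfl
    have h4 := hM2.unprimed rfl _ _ hm1
    rcases h4.eq_or_lt with h5 | h5
    · rw [h5] at hm1
      have := hQ.col _ _ _ _ h3 hm1 hM2.mem
      simp at this
    · exact hfin h3 h5

end

/-! ### Insertion of a biword -/

section

variable {y z z' : Equiv.Perm ℤ} {T T' U V : STab} {Q Q' : Tab} {p p1 p2 : Box} {u u1 u2 : Letter}
  {v v1 v2 : ℤ} {g g1 g2 : Bool} {L L' : List (ℤ × Letter)}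
  {o o' : Option (STab × Letter × ℤ × Box × Bool)}

/-- `RSK z L T Q o` holds if inserting the biword `L` gives the insertion tableau `T` and the
recording tableau `Q`, where `o` describes the last insertion. -/
inductive RSK : Equiv.Perm ℤ → List (ℤ × Letter) → STab → Tab →
    Option (STab × Letter × ℤ × Box × Bool) → Prop
  | nil : RSK 1 [] [] (fun _ _ => none) none
  | snoc {y z : Equiv.Perm ℤ} {L : List (ℤ × Letter)} {T U : STab} {Q : Tab}
      {o : Option (STab × Letter × ℤ × Box × Bool)} {v : ℤ} {u : Letter} {p : Box} {g : Bool}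
      (h : RSK y L T Q o) (hw : rowWord T ++ [u] ∈ RinvPlus z) (hi : Ins T u U p g) (hU : NE U) :
      RSK z (L ++ [(v, u)]) U (upd Q p.1 p.2 (some ⟨v, g⟩)) (some (T, u, v, p, g))

/-- The steps at which a letter can be inserted. -/
structure InsAt (z : Equiv.Perm ℤ) (T : STab) (u : Letter) (U : STab) (p : Box) (g : Bool) :
    Prop where
  ne : NE T
  ok : Ok (entry? T)
  word : rowWord T ++ [u] ∈ RinvPlus z
  ins : Ins T u U p g
  ne' : NE U

lemma InsAt.valid (h : InsAt z T u U p g) : Valid (· ∈ RinvPlus z) false (entry? T) 0 u :=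
  valid_iff.2 ⟨h.ok, h.word⟩

lemma InsAt.rtab (h : InsAt z T u U p g) : RTab z U :=
  have h1 := Run.result h.ins h.valid
  rtab_of_fword h.ne' h1.1 h1.2.1

lemma InsAt.asc (h1 : InsAt y T u1 U p1 g1) (h2 : InsAt z U u2 V p2 g2) (hu : u1.ceil < u2.ceil) :
    (g2 = true → g1 = true ∧ p2.2 ≤ p1.2) ∧ (g2 = false → g1 = true ∨ p2.1 ≤ p1.1) :=
  (Run.rowCert h1.ins rfl h1.valid).asc h2.ok h2.ins h2.valid (fun _ _ => Or.inl rfl) hu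

lemma InsAt.desc (h1 : InsAt y T u1 U p1 g1) (h2 : InsAt z U u2 V p2 g2) (hu : u2.ceil < u1.ceil) :
    (g2 = true → g1 = true → p1.2 < p2.2) ∧ (g2 = false → g1 = false ∧ p1.1 < p2.1) :=
  (Run.rowCert h1.ins rfl h1.valid).desc h2.ok h2.ins h2.valid (fun _ _ => Or.inl rfl) hu

lemma RSK.rtab (h : RSK z L T Q o) : RTab z T := by
  induction h with
  | nil => exact rtab_nil
  | snoc h hw hi hU ih => exact InsAt.rtab ⟨ih.ne, ih.ok, hw, hi, hU⟩

lemma RSK.last (h : RSK z L U Q (some (T, u, v, p, g))) : InsAt z T u U p g := by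
  cases h with
  | snoc h hw hi hU => exact ⟨h.rtab.ne, h.rtab.ok, hw, hi, hU⟩

lemma RSK.getLast? (h : RSK z L U Q o) : L.getLast? = o.map (fun s => (s.2.2.1, s.2.1)) := by
  cases h <;> simp

lemma RSK.word (h : RSK z L T Q o) : L.map Prod.snd ∈ RinvPlus z := by
  induction h with
  | nil => exact mem_RinvPlus_one_nil
  | snoc h hw hi hU ih =>
    rw [List.map_append]
    exact append_mem_congr h.rtab.word ih hw

lemma RSK.peg (h : RSK z L T Q o) : PEG (L.map Prod.snd) = T := by
  induction h with
  | nil => rfl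
  | snoc h hw hi hU ih =>
    rw [List.map_append, List.map_singleton, PEG_snoc, ih,
      hi.eq h.rtab.ne h.rtab.ok hU hw]

lemma RSK.dom (h : RSK z L T Q o) (a b : ℕ) : Q a b ≠ none ↔ entry? T a b ≠ none := by
  induction h generalizing a b with
  | nil => simp [entry?, entryG?]
  | @snoc y z L T U Q o v u p g h hw hi hU ih =>
    have hI := RSK.last (RSK.snoc (v := v) h hw hi hU)
    rw [(Run.dom hi hI.valid).2, ← ih, upd]
    split_ifs with hp
    · simp [hp]
    · simp [Prod.ext_iff, hp]

lemma RSK.not_mem (h : RSK y L T Q o) (hI : InsAt z T u U p g) : Q p.1 p.2 = none :=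
  not_ne_iff.1 fun hc => (h.dom _ _).1 hc (Run.dom hI.ins hI.valid).1

lemma RSK.exists (hw : L.map Prod.snd ∈ RinvPlus z) : ∃ T Q o, RSK z L T Q o := by
  induction L using List.reverseRecOn generalizing z with
  | nil =>
    obtain rfl := RinvPlus_unique hw mem_RinvPlus_one_nil
    exact ⟨_, _, _, RSK.nil⟩
  | append_singleton L s ih =>
    rw [List.map_append, List.map_singleton] at hw
    obtain ⟨y, h1, -⟩ := mem_RinvPlus_append.1 hw
    obtain ⟨T, Q, o, h⟩ := ih h1
    have hw' := append_mem_congr h1 h.rtab.word hw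
    obtain ⟨U, p, g, h2, -, h3⟩ := exists_ins h.rtab.ne h.rtab.ok hw'
    exact ⟨_, _, _, RSK.snoc (v := s.1) h hw' h2 h3.ne⟩

/-- The biword `L` is weakly increasing, with positive labels. -/
def Srt (L : List (ℤ × Letter)) : Prop :=
  L.Pairwise (fun a b => toLex a ≤ toLex b) ∧ ∀ s ∈ L, 0 < s.1

lemma srt_append_singleton : Srt (L ++ [(v, u)]) ↔
    Srt L ∧ 0 < v ∧ ∀ s ∈ L.getLast?, s.1 < v ∨ s.1 = v ∧ s.2 ≤ u := by
  have htr : Trans (fun a b : ℤ × Letter => toLex a ≤ toLex b)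
      (fun a b : ℤ × Letter => toLex a ≤ toLex b) (fun a b : ℤ × Letter => toLex a ≤ toLex b) :=
    ⟨fun h h' => le_trans h h'⟩
  unfold Srt
  rw [← List.isChain_iff_pairwise, ← List.isChain_iff_pairwise, List.isChain_append]
  simp only [List.mem_append, List.mem_singleton, or_imp, forall_and, forall_eq,
    List.isChain_singleton, true_and, List.head?_cons, Option.mem_some_iff, forall_eq']
  have : ∀ s : ℤ × Letter, toLex s ≤ toLex (v, u) ↔ s.1 < v ∨ s.1 = v ∧ s.2 ≤ u := fun s => by
    rw [Prod.Lex.le_iff]; rfl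
  simp only [this]
  tauto

lemma RSK.ceil_ne {s : ℤ × Letter} (h : RSK y L T Q o) (hs : s ∈ L.getLast?)
    (hw : rowWord T ++ [u] ∈ RinvPlus z) : s.2.ceil ≠ u.ceil := by
  have hw' := append_mem_congr h.rtab.word h.word hw
  obtain ⟨L', rfl⟩ := List.getLast?_eq_some_iff.1 hs
  exact (good_RinvPlus z).ne (a := L'.map Prod.snd) (b := []) (by simpa using hw')

lemma RSK.ss (h : RSK z L U Q o) (hL : Srt L) :
    SS Q ∧ ∀ T u v p g, o = some (T, u, v, p, g) → MaxAt Q p ⟨v, g⟩ := by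
  induction h with
  | nil => exact ⟨by constructor <;> simp, by simp⟩
  | @snoc y z L T U Q o v u p g h hw hi hU ih =>
    have hI := RSK.last (RSK.snoc (v := v) h hw hi hU)
    obtain ⟨h1, h2, h3⟩ := srt_append_singleton.1 hL
    obtain ⟨h4, h5⟩ := ih h1
    have h0 := h.getLast?
    have key : SS (upd Q p.1 p.2 (some ⟨v, g⟩)) ∧ MaxAt (upd Q p.1 p.2 (some ⟨v, g⟩)) p ⟨v, g⟩ := by
      rcases o with - | ⟨T0, u0, v0, p0, g0⟩
      · cases h
        refine h4.add (by simp) h2 ?_ ?_ ?_ <;> simp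
      · have hs : (v0, u0) ∈ L.getLast? := by rw [h0]; rfl
        refine h4.step h.rtab.ok hI.rtab.ok (Run.dom hi hI.valid).2 (Run.dom hi hI.valid).1 h.dom
          (h5 _ _ _ _ _ rfl) h2 ((h3 _ hs).imp_right (And.imp_right fun h6 => ?_))
        have h7 := h.ceil_ne hs hw
        rw [letter_le] at h6
        exact h.last.asc hI (by dsimp only at h6 h7; omega)
    refine ⟨key.1, ?_⟩
    rintro _ _ _ _ _ ⟨⟩
    exact key.2

lemma RSK.functional (h : RSK z L T Q o) (h' : RSK z' L T' Q' o') : T = T' ∧ Q = Q' := by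
  refine ⟨by rw [← h.peg, h'.peg], ?_⟩
  induction h generalizing z' T' Q' o' with
  | nil =>
    generalize hL : ([] : List (ℤ × Letter)) = L at h'
    cases h' with
    | nil => rfl
    | snoc => simp at hL
  | @snoc y z L T U Q o v u p g h hw hi hU ih =>
    generalize hL : L ++ [(v, u)] = L1 at h'
    cases h' with
    | nil => simp at hL
    | @snoc _ _ _ _ _ _ _ _ _ p' g' h' hw' hi' hU' =>
      obtain ⟨rfl, hs⟩ := List.append_inj' hL rfl
      obtain ⟨rfl, rfl⟩ : v = _ ∧ u = _ := by simpa using hs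
      obtain rfl := ih h'
      obtain rfl : T = _ := by rw [← h.peg, h'.peg]
      have h1 := hi.eq h.rtab.ne h.rtab.ok hU hw
      have h2 := hi'.eq h.rtab.ne h.rtab.ok hU' hw'
      rw [h1] at h2
      obtain ⟨rfl, rfl⟩ : U = _ ∧ g = _ := by simpa using h2
      have hd := (Run.dom hi (valid_iff.2 ⟨h.rtab.ok, hw⟩))
      have hd' := (Run.dom hi' (valid_iff.2 ⟨h.rtab.ok, hw'⟩))
      have : (p.1, p.2) = p' :=
        (((hd'.2 p.1 p.2).1 ((hd.2 p.1 p.2).2 (Or.inr rfl))).resolve_left (by simp [hd.1]))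
      rw [← this]

lemma RSK.injective (h : RSK z L U Q o) (h' : RSK z' L' U Q o') (hL : Srt L) (hL' : Srt L') :
    L = L' := by
  induction h generalizing z' L' o' with
  | nil =>
    generalize hQ : (fun _ _ => none : Tab) = Q1 at h'
    cases h' with
    | nil => rfl
    | @snoc _ _ _ _ _ _ _ _ _ p =>
      have := congrFun₂ hQ p.1 p.2
      rw [upd_self] at this
      simp at this
  | @snoc y z L T U Q o v u p g h hw hi hU ih =>
    have hI := RSK.last (RSK.snoc (v := v) h hw hi hU)
    obtain ⟨hs1, hs2⟩ := (RSK.snoc (v := v) h hw hi hU).ss hL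
    have hm := hs2 _ _ _ _ _ rfl
    generalize hQ : upd Q p.1 p.2 (some ⟨v, g⟩) = Q1 at h'
    have h0 := h'
    cases h' with
    | nil =>
      have := congrFun₂ hQ p.1 p.2
      rw [upd_self] at this
      simp at this
    | @snoc _ _ _ T' _ Q' _ v' u' p' g' h' hw' hi' hU' =>
      have hm' := (h0.ss hL').2 _ _ _ _ _ rfl
      rw [← hQ] at hm'
      obtain ⟨rfl, hvg⟩ := hm.unique hs1 hm'
      obtain ⟨rfl, rfl⟩ : v = v' ∧ g = g' := by simpa using hvg
      obtain rfl := RinvPlus_unique hI.rtab.word h0.rtab.word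
      obtain ⟨rfl, rfl⟩ := hi.unique hi' h.rtab.ne h.rtab.ok hw h'.rtab.ne h'.rtab.ok hw'
      have hQQ : Q = Q' := by
        rw [← upd_eq_self (h.not_mem hI), ← upd_eq_self (h'.not_mem h0.last),
          ← upd_upd Q _ _ (some ⟨v, g⟩), hQ, upd_upd]
      subst hQQ
      rw [ih h' (srt_append_singleton.1 hL).1 (srt_append_singleton.1 hL').1]

lemma RSK.surjective (hU : RTab z U) (hQ : SS Q)
    (hd : ∀ a b, Q a b ≠ none ↔ entry? U a b ≠ none) : ∃ L o, RSK z L U Q o ∧ Srt L := by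
  induction hn : (rowWord U).length generalizing z U Q with
  | zero =>
    obtain ⟨A, h1, h2, h3⟩ := exists_boxes U
    have hA : A = [] := by
      rw [← List.length_eq_zero_iff, ← hn, ← h2, List.length_map]
    have hU0 : ∀ a b, entry? U a b = none := by
      intro a b
      by_contra hc
      obtain ⟨x, hx⟩ := Option.ne_none_iff_exists'.1 hc
      have := (h3 ((a, b), x)).2 hx
      simp [hA] at this
    obtain rfl : U = [] := entry?_injOn hU.ne rtab_nil.ne (by
      funext a b; rw [hU0]; simp [entry?, entryG?])
    obtain rfl := RinvPlus_unique hU.word mem_RinvPlus_one_nil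
    obtain rfl : Q = fun _ _ => none := by
      funext a b
      exact not_ne_iff.1 fun hc => (hd a b).1 hc (hU0 a b)
    exact ⟨_, _, RSK.nil, by simp [Srt]⟩
  | succ n ih =>
    have hne : ∃ a b, Q a b ≠ none := by
      obtain ⟨A, h1, h2, h3⟩ := exists_boxes U
      rcases A with - | ⟨s, A⟩
      · rw [← h2] at hn; simp at hn
      · exact ⟨s.1.1, s.1.2, (hd _ _).2 (by rw [(h3 s).1 (by simp)]; simp)⟩
    obtain ⟨m, hm⟩ := finite_entry U
    obtain ⟨p, ⟨v, g⟩, hM⟩ := MaxAt.exists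
      ⟨m, fun a b hab => not_ne_iff.1 fun hc => (hd a b).1 hc (hm a b hab)⟩ hne
    obtain ⟨T, u, h1, h2, h3, h4⟩ := exists_unins hU ((hM.corner hQ).congr hd) g
    have hI : InsAt z T u U p g := ⟨h1, h2, h3, h4, hU.ne⟩
    obtain ⟨y, h5, -⟩ := mem_RinvPlus_append.1 h3
    have hD := Run.dom h4 hI.valid
    have hQ' := hQ.remove p.1 p.2
    obtain ⟨L, o, h6, h7⟩ := ih ⟨h1, h2, h5⟩ hQ' (by
      intro a b
      rw [upd]
      have := hD.2 a b
      rw [← hd] at this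
      split_ifs with hab
      · rw [hab.1, hab.2, hD.1]
      · rw [this]
        simp [Prod.ext_iff, hab]) (by
      have e1 := length_of_mem_RinvPlus h3
      have e2 := length_of_mem_RinvPlus hU.word
      rw [List.length_append, List.length_singleton] at e1
      omega)
    have h8 := RSK.snoc (v := v) h6 h3 h4 hU.ne
    rw [upd_upd, upd_eq_self hM.mem] at h8
    refine ⟨_, _, h8, srt_append_singleton.2 ⟨h7, hQ.pos _ _ _ hM.mem, ?_⟩⟩
    intro s hs
    rcases o with - | ⟨T0, u0, v0, p0, g0⟩
    · rw [h6.getLast?] at hs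
      simp at hs
    · have hne := h6.ceil_ne hs h3
      rw [h6.getLast?] at hs
      obtain rfl : (v0, u0) = s := by simpa using hs
      have hM1 := (h6.ss h7).2 _ _ _ _ _ rfl
      have hc : Corner (entry? T) p0 := (hM1.corner hQ').congr h6.dom
      refine (hQ.descent hU.ok hD.2 hd hM hM1 hc).imp_right (And.imp_right fun h9 => ?_)
      rw [letter_le]
      left
      by_contra h10
      exact h9 (h6.last.desc hI (by dsimp only at hne h10; omega))

end

/-! ### Semistandard tableaux as recording tableaux -/

section

variable {z z' : Equiv.Perm ℤ} {T S U : STab} {Q : Tab} {p : Box} {i : ℤ} {L L' : List (ℤ × Letter)}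
  {o : Option (STab × Letter × ℤ × Box × Bool)}

/-- The number of entries of `Q` equal to `i` or `i'`. -/
noncomputable def cnt (Q : Tab) (i : ℤ) : ℕ := {x ∈ graph Q | x.2.ceil = i}.ncard

lemma mem_flatten : ∀ x, x ∈ S.flatten ↔ ∃ a b, entry? S a b = some x := by
  obtain ⟨A, -, h2, h3⟩ := exists_boxes S
  intro x
  have : x ∈ S.flatten ↔ x ∈ rowWord S := by simp [rowWord]
  rw [this, ← h2, List.mem_map]
  constructor
  · rintro ⟨⟨⟨a, b⟩, x⟩, h, rfl⟩
    exact ⟨a, b, (h3 _).1 h⟩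
  · rintro ⟨a, b, h⟩
    exact ⟨((a, b), x), (h3 _).2 h, rfl⟩

lemma countP_flatten : S.flatten.countP (fun x => decide (x.ceil = i)) = cnt (entry? S) i := by
  obtain ⟨A, h1, h2, h3⟩ := exists_boxes S
  have hA : A.Nodup := nodup_of_pairwise_lt h1
  have hp : S.flatten.Perm (rowWord S) := (List.reverse_perm S).symm.flatten
  rw [hp.countP_eq, ← h2, List.countP_map, List.countP_eq_length_filter,
    ← List.toFinset_card_of_nodup (hA.filter _), cnt, ← Set.ncard_coe_finset]
  congr 1
  ext x
  simp [h3]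

lemma RSK.countP (h : RSK z L T Q o) :
    (graph Q).Finite ∧ ∀ i, L.countP (fun s => decide (s.1 = i)) = cnt Q i := by
  induction h with
  | nil =>
    have : graph (fun _ _ => none) = ∅ := by ext; simp [graph]
    exact ⟨by rw [this]; exact Set.finite_empty, fun i => by simp [cnt, this]⟩
  | @snoc y z L T U Q o v u p g h hw hi hU ih =>
    have hn := h.not_mem (RSK.last (RSK.snoc (v := v) h hw hi hU))
    have hg : graph (upd Q p.1 p.2 (some ⟨v, g⟩)) = insert (p, ⟨v, g⟩) (graph Q) := by
      rw [graph_eq_insert (upd_self _ _ _ _), upd_upd, upd_eq_self hn]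
    refine ⟨by rw [hg]; exact ih.1.insert _, fun i => ?_⟩
    rw [List.countP_append, ih.2, cnt, cnt, hg, List.countP_singleton]
    by_cases hv : v = i
    · have : {x ∈ insert (p, ⟨v, g⟩) (graph Q) | x.2.ceil = i} =
          insert (p, ⟨v, g⟩) {x ∈ graph Q | x.2.ceil = i} := by
        ext x
        simp only [Set.mem_ofPred_eq, Set.mem_insert_iff]
        constructor
        · rintro ⟨h1 | h1, h2⟩
          exacts [Or.inl h1, Or.inr ⟨h1, h2⟩]
        · rintro (rfl | ⟨h1, h2⟩)
          exacts [⟨Or.inl rfl, hv⟩, ⟨Or.inr h1, h2⟩]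
      rw [this, Set.ncard_insert_of_notMem _ (ih.1.subset fun x hx => hx.1)]
      · simp [hv]
      · rintro ⟨h1, -⟩
        rw [mem_graph] at h1
        rw [hn] at h1
        simp at h1
    · have : {x ∈ insert (p, ⟨v, g⟩) (graph Q) | x.2.ceil = i} = {x ∈ graph Q | x.2.ceil = i} := by
        ext x
        simp only [Set.mem_ofPred_eq, Set.mem_insert_iff]
        constructor
        · rintro ⟨rfl | h1, h2⟩
          exacts [absurd h2 hv, ⟨h1, h2⟩]
        · rintro ⟨h1, h2⟩
          exact ⟨Or.inr h1, h2⟩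
      rw [this]
      simp [hv]

lemma ss_iff (hU : Ok (entry? U)) (hd : ∀ a b, entry? S a b ≠ none ↔ entry? U a b ≠ none) :
    IsSemistandard S ↔ SS (entry? S) := by
  constructor
  · rintro ⟨h1, h2, h3, h4, h5⟩
    have hrow : ∀ k a b x y, entry? S a b = some x → entry? S a (b + k) = some y → x ≤ y := by
      intro k
      induction k with
      | zero =>
        intro a b x y hx hy
        rw [Nat.add_zero, hx] at hy
        exact (Option.some.inj hy).le
      | succ k ih =>
        intro a b x y hx hy
        obtain ⟨w, hw⟩ := Option.ne_none_iff_exists'.1 ((hd a (b + k)).2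
          (hU.row _ _ _ (by have := hU.dom a b ((hd _ _).1 (by rw [hx]; simp)); omega)
            (by omega) ((hd a (b + (k + 1))).1 (by rw [hy]; simp))))
        exact (ih _ _ _ _ hx hw).trans (h2 _ _ _ _ hw hy)
    have hcol : ∀ k a b x y, entry? S a b = some x → entry? S (a + k) b = some y → x ≤ y := by
      intro k
      induction k with
      | zero =>
        intro a b x y hx hy
        rw [Nat.add_zero, hx] at hy
        exact (Option.some.inj hy).le
      | succ k ih =>
        intro a b x y hx hy
        obtain ⟨w, hw⟩ := Option.ne_none_iff_exists'.1 ((hd (a + k) b).2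
          (hU.col _ _ _ (by omega) ((hd (a + (k + 1)) b).1 (by rw [hy]; simp))))
        exact (ih _ _ _ _ hx hw).trans (h3 _ _ _ _ hw hy)
    refine ⟨fun a b x hx => h1 x ((mem_flatten x).2 ⟨a, b, hx⟩), ?_, h4, h5⟩
    intro a b a' b' x y hx hy ha hb
    obtain ⟨k, rfl⟩ := Nat.exists_eq_add_of_le ha
    obtain ⟨l, rfl⟩ := Nat.exists_eq_add_of_le hb
    obtain ⟨w, hw⟩ := Option.ne_none_iff_exists'.1 ((hd a (b + l)).2
      (hU.col _ _ _ ha ((hd (a + k) (b + l)).1 (by rw [hy]; simp))))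
    exact (hrow _ _ _ _ _ hx hw).trans (hcol _ _ _ _ _ hw hy)
  · intro h
    refine ⟨fun x hx => ?_, fun r c x y hx hy => h.le _ _ _ _ _ _ hx hy le_rfl (by omega),
      fun r c x y hx hy => h.le _ _ _ _ _ _ hx hy (by omega) le_rfl, h.row, h.col⟩
    obtain ⟨a, b, hab⟩ := (mem_flatten x).1 hx
    exact h.pos _ _ _ hab

lemma entry?_map (f : Letter → Letter) (a b : ℕ) :
    entry? (T.map (List.map f)) a b = (entry? T a b).map f := by
  simp only [entry?, entryG?]
  split_ifs
  · rw [List.getElem?_map]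
    cases T[a]? <;> simp
  · rfl

lemma shapeOf_eq_iff (hT : NE T) :
    shapeOf S = shapeOf T ↔ NE S ∧ ∀ a b, entry? S a b ≠ none ↔ entry? T a b ≠ none := by
  constructor
  · intro h
    have hN : ∀ X : STab, NE X ↔ ∀ m ∈ shapeOf X, 0 < m := by
      intro X
      simp [shapeOf, NE, List.length_pos_iff]
    have hl : ∀ (X : STab) (r : ℕ), (X.getD r []).length = (shapeOf X).getD r 0 := by
      intro X r
      simp only [shapeOf, List.getD_eq_getElem?_getD, List.getElem?_map]
      cases X[r]? <;> rfl
    refine ⟨by rw [hN, h, ← hN]; exact hT, fun a b => ?_⟩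
    rw [entry?_ne_none, entry?_ne_none, hl, hl, h]
  · rintro ⟨hS, hd⟩
    have hN : ∀ X : STab, NE X → NE (X.map (List.map (fun _ : Letter => (default : Letter)))) := by
      intro X hX row hrow
      obtain ⟨row', h1, rfl⟩ := List.mem_map.1 hrow
      simpa using hX row' h1
    have hs : ∀ X : STab, shapeOf (X.map (List.map (fun _ : Letter => (default : Letter)))) = shapeOf X := by
      intro X
      simp [shapeOf]
    rw [← hs S, ← hs T, entry?_injOn (hN S hS) (hN T hT)]
    funext a b
    rw [entry?_map, entry?_map]
    have := hd a b
    cases h1 : entry? S a b <;> cases h2 : entry? T a b <;> simp [h1, h2] at this ⊢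

lemma ncard_eq_of_rel {α β : Type*} {s : Set α} {t : Set β} (R : α → β → Prop)
    (h1 : ∀ a ∈ s, ∃ b ∈ t, R a b) (h2 : ∀ b ∈ t, ∃ a ∈ s, R a b)
    (h3 : ∀ a ∈ s, ∀ b ∈ t, ∀ b' ∈ t, R a b → R a b' → b = b')
    (h4 : ∀ a ∈ s, ∀ a' ∈ s, ∀ b ∈ t, R a b → R a' b → a = a') : s.ncard = t.ncard := by
  choose f hf hR using h1
  refine Set.ncard_congr f hf ?_ ?_
  · intro a b ha hb hab
    exact h4 _ ha _ hb _ (hf a ha) (hR a ha) (by rw [hab]; exact hR b hb)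
  · intro b hb
    obtain ⟨a, ha, hab⟩ := h2 b hb
    exact ⟨a, ha, h3 a ha _ (hf a ha) _ hb (hR a ha) hab⟩

/-- Weakly increasing biwords for `z` of weight `d`. -/
def Biword (z : Equiv.Perm ℤ) (d : ℤ →₀ ℕ) : Set (List (ℤ × Letter)) :=
  {L | Srt L ∧ L.map Prod.snd ∈ RinvPlus z ∧ ∀ i, d i = L.countP (fun s => decide (s.1 = i))}

lemma ncard_fiber (hT : RTab z T) (d : ℤ →₀ ℕ) :
    {L ∈ Biword z d | PEG (L.map Prod.snd) = T}.ncard =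
      {S : STab | shapeOf S = shapeOf T ∧ IsSemistandard S ∧
        ∀ i : ℤ, d i = S.flatten.countP (fun x => decide (x.ceil = i))}.ncard := by
  refine ncard_eq_of_rel (fun L S => ∃ o, RSK z L T (entry? S) o) ?_ ?_ ?_ ?_
  · rintro L ⟨⟨h1, h2, h3⟩, h4⟩
    obtain ⟨T', Q, o, h⟩ := RSK.exists h2
    obtain rfl : T' = T := by rw [← h.peg, h4]
    obtain ⟨n, hn⟩ := finite_entry T'
    obtain ⟨S, rfl, hS⟩ := exists_list hT.ok h.dom
      ⟨n, fun a b hab => not_ne_iff.1 fun hc => (h.dom a b).1 hc (hn a b hab)⟩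
    refine ⟨S, ⟨(shapeOf_eq_iff hT.ne).2 ⟨hS, h.dom⟩, (ss_iff hT.ok h.dom).2 (h.ss h1).1,
      fun i => ?_⟩, o, h⟩
    rw [h3, h.countP.2, countP_flatten]
  · rintro S ⟨h1, h2, h3⟩
    obtain ⟨hS, hd⟩ := (shapeOf_eq_iff hT.ne).1 h1
    obtain ⟨L, o, h, hL⟩ := RSK.surjective hT ((ss_iff hT.ok hd).1 h2) hd
    refine ⟨L, ⟨⟨hL, h.word, fun i => ?_⟩, h.peg⟩, o, h⟩
    rw [h3, h.countP.2, countP_flatten]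
  · rintro L - S ⟨h1, -⟩ S' ⟨h1', -⟩ ⟨o, h⟩ ⟨o', h'⟩
    exact entry?_injOn ((shapeOf_eq_iff hT.ne).1 h1).1 ((shapeOf_eq_iff hT.ne).1 h1').1
      (h.functional h').2
  · rintro L ⟨⟨h1, -⟩, -⟩ L' ⟨⟨h1', -⟩, -⟩ S - ⟨o, h⟩ ⟨o', h'⟩
    exact h.injective h' h1 h1'

lemma biword_injOn (d : ℤ →₀ ℕ) : Set.InjOn (List.map Prod.snd) (Biword z d) := by
  rintro L ⟨⟨h1, -⟩, -, h3⟩ L' ⟨⟨h1', -⟩, -, h3'⟩ h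
  have hf : L.map Prod.fst = L'.map Prod.fst := by
    have hs : ∀ {L : List (ℤ × Letter)}, L.Pairwise (fun a b => toLex a ≤ toLex b) →
        (L.map Prod.fst).Pairwise (· ≤ ·) := by
      intro L hL
      rw [List.pairwise_map]
      refine hL.imp ?_
      intro a b hab
      rw [Prod.Lex.le_iff] at hab
      rcases hab with hab | hab
      exacts [hab.le, hab.1.le]
    refine List.Perm.eq_of_pairwise (fun a b _ _ h h' => le_antisymm h h') (hs h1) (hs h1') ?_
    rw [List.perm_iff_count]
    intro i
    have e : ∀ L : List (ℤ × Letter), (L.map Prod.fst).count i =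
        L.countP (fun s => decide (s.1 = i)) := by
      intro L
      rw [List.count, List.countP_map]
      rfl
    rw [e, e, ← h3, ← h3']
  have hz : ∀ L : List (ℤ × Letter), (L.map Prod.fst).zip (L.map Prod.snd) = L := by
    intro L
    induction L with
    | nil => rfl
    | cons a L ih => simp [ih]
  rw [← hz L, ← hz L', hf, h]

lemma finite_biword (d : ℤ →₀ ℕ) : (Biword z d).Finite :=
  Set.Finite.of_finite_image ((finite_RinvPlus z).subset (by
    rintro _ ⟨L, ⟨-, h, -⟩, rfl⟩
    exact h)) (biword_injOn d)

lemma ncard_biword (d : ℤ →₀ ℕ) {t : Finset STab} (ht : ∀ T, T ∈ t ↔ T ∈ PEG '' RinvPlus z) :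
    (Biword z d).ncard = ∑ T ∈ t, {S : STab | shapeOf S = shapeOf T ∧ IsSemistandard S ∧
        ∀ i : ℤ, d i = S.flatten.countP (fun x => decide (x.ceil = i))}.ncard := by
  classical
  have hfin := finite_biword (z := z) d
  rw [Set.ncard_eq_toFinset_card _ hfin, Finset.card_eq_sum_card_fiberwise
    (f := fun L => PEG (L.map Prod.snd)) (t := t)]
  · refine Finset.sum_congr rfl fun T hT => ?_
    obtain ⟨a, ha, rfl⟩ := (ht T).1 hT
    rw [← ncard_fiber (rtab_PEG ha), ← Set.ncard_coe_finset]
    congr 1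
    ext L
    simp
  · intro L hL
    have : L ∈ Biword z d := by simpa using hL
    exact (ht _).2 ⟨_, this.2.1, rfl⟩

end

/-! ### Sequences of words and biwords -/

section

variable {z : Equiv.Perm ℤ} {φ : ℕ → PWord} {L : List (ℤ × Letter)} {d : ℤ →₀ ℕ} {N : ℕ}

/-- The biword of the first `N` words of `φ`. -/
def biwordOf (φ : ℕ → PWord) : ℕ → List (ℤ × Letter)
  | 0 => []
  | N + 1 => biwordOf φ N ++ (φ N).map (fun x => ((N : ℤ) + 1, x))

lemma map_snd_biwordOf (φ : ℕ → PWord) (N : ℕ) :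
    (biwordOf φ N).map Prod.snd = ((List.range N).map φ).flatten := by
  induction N with
  | zero => rfl
  | succ N ih => simp [biwordOf, ih, List.range_succ, Function.comp_def]

lemma fst_of_mem_biwordOf {s : ℤ × Letter} (h : s ∈ biwordOf φ N) : 0 < s.1 ∧ s.1 ≤ N := by
  induction N with
  | zero => simp [biwordOf] at h
  | succ N ih =>
    rw [biwordOf, List.mem_append, List.mem_map] at h
    rcases h with h | ⟨x, -, rfl⟩
    · have := ih h
      push_cast
      omega
    · push_cast
      omega

lemma srt_biwordOf (h : ∀ n, (φ n).IsChain (· ≤ ·)) : Srt (biwordOf φ N) := by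
  refine ⟨?_, fun s hs => (fst_of_mem_biwordOf hs).1⟩
  induction N with
  | zero => simp [biwordOf]
  | succ N ih =>
    rw [biwordOf, List.pairwise_append]
    refine ⟨ih, ?_, ?_⟩
    · rw [List.pairwise_map]
      refine (List.isChain_iff_pairwise.1 (h N)).imp fun {a b} hab => ?_
      rw [Prod.Lex.le_iff]
      exact Or.inr ⟨rfl, hab⟩
    · intro s hs t ht
      obtain ⟨x, -, rfl⟩ := List.mem_map.1 ht
      rw [Prod.Lex.le_iff]
      have := (fst_of_mem_biwordOf hs).2
      left
      change s.1 < (N : ℤ) + 1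
      omega

lemma filter_biwordOf (φ : ℕ → PWord) (N n : ℕ) :
    ((biwordOf φ N).filter (fun s => decide (s.1 = (n : ℤ) + 1))).map Prod.snd =
      if n < N then φ n else [] := by
  induction N with
  | zero => simp [biwordOf]
  | succ N ih =>
    rw [biwordOf, List.filter_append, List.map_append, ih, List.filter_map]
    by_cases hn : n = N
    · subst hn
      simp [Function.comp_def]
    · have : ¬ ((N : ℤ) + 1 = (n : ℤ) + 1) := by omega
      have h2 : n < N + 1 ↔ n < N := by omega
      simp only [Function.comp_def, this, decide_false, List.filter_false, List.map_nil,
        List.append_nil, h2]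

lemma flatten_filter (h : Srt L) (N : ℕ) :
    ((List.range N).map (fun n : ℕ => (L.filter (fun s => decide (s.1 = (n : ℤ) + 1))))).flatten =
      L.filter (fun s => decide (s.1 ≤ (N : ℤ))) := by
  induction N with
  | zero =>
    symm
    simp only [List.range_zero, List.map_nil, List.flatten_nil, List.filter_eq_nil_iff]
    intro s hs
    have := h.2 s hs
    simpa using this
  | succ N ih =>
    rw [List.range_succ, List.map_append, List.flatten_append, ih]
    simp only [List.map_singleton, List.flatten_singleton]
    have h1 := h.1
    clear ih h
    induction L with
    | nil => rfl
    | cons s L ih =>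
      rw [List.pairwise_cons] at h1
      have ih := ih h1.2
      simp only [List.filter_cons]
      rcases lt_trichotomy s.1 ((N : ℤ) + 1) with hs | hs | hs
      · have e1 : s.1 ≤ N := by omega
        have e2 : s.1 ≤ ((N + 1 : ℕ) : ℤ) := by push_cast; omega
        simp only [e1, e2, hs.ne, decide_true, decide_false, if_true, List.cons_append]
        rw [← ih]
        simp
      · have e1 : ¬ s.1 ≤ N := by omega
        have e2 : s.1 ≤ ((N + 1 : ℕ) : ℤ) := by push_cast; omega
        have e3 : L.filter (fun s => decide (s.1 ≤ (N : ℤ))) = [] := by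
          rw [List.filter_eq_nil_iff]
          intro t ht
          have := h1.1 t ht
          rw [Prod.Lex.le_iff] at this
          have : s.1 ≤ t.1 := by
            rcases this with this | this
            exacts [this.le, this.1.le]
          simp only [decide_eq_true_eq]
          omega
        rw [e3, List.nil_append] at ih
        rw [e3, ih]
        simp [hs]
      · have e1 : ¬ s.1 ≤ N := by omega
        have e2 : ¬ s.1 ≤ ((N + 1 : ℕ) : ℤ) := by push_cast; omega
        simp only [e1, e2, hs.ne', decide_false]
        simpa using ih

lemma exists_bound (L : List (ℤ × Letter)) : ∃ N : ℕ, ∀ s ∈ L, s.1 ≤ N := by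
  induction L with
  | nil => exact ⟨0, by simp⟩
  | cons s L ih =>
    obtain ⟨N, hN⟩ := ih
    refine ⟨max N s.1.toNat, fun t ht => ?_⟩
    rcases List.mem_cons.1 ht with rfl | ht
    · omega
    · have := hN t ht
      omega

lemma flatten_eq_map_snd (h : Srt L)
    (hφ : ∀ n : ℕ, φ n = (L.filter (fun s => decide (s.1 = (n : ℤ) + 1))).map Prod.snd)
    (hN : ∀ s ∈ L, s.1 ≤ N) : ((List.range N).map φ).flatten = L.map Prod.snd := by
  have h1 := congrArg (List.map Prod.snd) (flatten_filter h N)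
  rw [List.filter_eq_self.2 (fun s hs => decide_eq_true (hN s hs)), List.map_flatten,
    List.map_map] at h1
  rw [← h1, show φ = _ from funext hφ]
  rfl

lemma countP_label (L : List (ℤ × Letter)) (i : ℤ) : L.countP (fun s => decide (s.1 = i)) =
    ((L.filter (fun s => decide (s.1 = i))).map Prod.snd).length := by
  rw [List.length_map, List.countP_eq_length_filter]

lemma countP_label_of_nonpos (h : Srt L) {i : ℤ} (hi : i ≤ 0) :
    L.countP (fun s => decide (s.1 = i)) = 0 := by
  rw [List.countP_eq_zero]
  intro s hs
  have := h.2 s hs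
  simp only [decide_eq_true_eq]
  omega

lemma ncard_incrSeq (z : Equiv.Perm ℤ) (d : ℤ →₀ ℕ) :
    {φ : ℕ → PWord | φ ∈ IncrSeq z ∧ (∀ i : ℕ, d ((i : ℤ) + 1) = (φ i).length) ∧
      (∀ j : ℤ, j ≤ 0 → d j = 0)}.ncard = (Biword z d).ncard := by
  refine ncard_eq_of_rel (fun φ L => ∀ n : ℕ,
    φ n = (L.filter (fun s => decide (s.1 = (n : ℤ) + 1))).map Prod.snd) ?_ ?_ ?_ ?_
  · rintro φ ⟨⟨h1, N, h2, h3⟩, h4, h5⟩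
    have hR : ∀ n : ℕ, φ n =
        ((biwordOf φ N).filter (fun s => decide (s.1 = (n : ℤ) + 1))).map Prod.snd := by
      intro n
      rw [filter_biwordOf]
      split_ifs with hn
      · rfl
      · exact h2 n (not_lt.1 hn)
    have hs : Srt (biwordOf φ N) := srt_biwordOf h1
    refine ⟨biwordOf φ N, ⟨hs, by rwa [map_snd_biwordOf], fun i => ?_⟩, hR⟩
    rcases le_or_gt i 0 with hi | hi
    · rw [h5 i hi, countP_label_of_nonpos hs hi]
    · obtain ⟨n, rfl⟩ : ∃ n : ℕ, i = (n : ℤ) + 1 := ⟨(i - 1).toNat, by omega⟩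
      rw [h4, hR, countP_label]
  · rintro L ⟨h1, h2, h3⟩
    obtain ⟨N, hN⟩ := exists_bound L
    refine ⟨fun n => (L.filter (fun s => decide (s.1 = (n : ℤ) + 1))).map Prod.snd,
      ⟨⟨fun n => ?_, N, fun n hn => ?_, ?_⟩, fun i => ?_, fun j hj => ?_⟩, fun n => rfl⟩
    · refine List.isChain_iff_pairwise.2 (List.pairwise_map.2 ?_)
      rw [List.pairwise_filter]
      refine h1.1.imp fun {a b} hab ha hb => ?_
      rw [Prod.Lex.le_iff] at hab
      rcases hab with hab | hab
      · have hab : a.1 < b.1 := hab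
        simp only [decide_eq_true_eq] at ha hb
        omega
      · exact hab.2
    · rw [List.map_eq_nil_iff, List.filter_eq_nil_iff]
      intro s hs
      have := hN s hs
      simp only [decide_eq_true_eq]
      omega
    · rwa [flatten_eq_map_snd h1 (fun _ => rfl) hN]
    · rw [h3, countP_label]
    · rw [h3, countP_label_of_nonpos h1 hj]
  · rintro φ - L hL L' hL' h h'
    obtain ⟨N, hN⟩ := exists_bound L
    obtain ⟨N', hN'⟩ := exists_bound L'
    refine biword_injOn d hL hL' ?_
    rw [← flatten_eq_map_snd (N := max N N') hL.1 h, ← flatten_eq_map_snd hL'.1 h']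
    · exact fun s hs => (hN' s hs).trans (by exact_mod_cast le_max_right _ _)
    · exact fun s hs => (hN s hs).trans (by exact_mod_cast le_max_left _ _)
  · rintro φ - φ' - L - h h'
    funext n
    rw [h, h']

end

end OEG

/-- Corollary 3.23: for every `z ∈ I_ℤ`, the set
`{P_EGᴼ(a) : a ∈ R_inv⁺(z)}` is finite and `Q_z = Σ_T Q_{shape(T)}` over this set. -/
theorem stmt9 (z : Equiv.Perm ℤ) (hz : IZ z) :
    (PEG '' RinvPlus z).Finite ∧
    Qz z = ∑ᶠ T ∈ PEG '' RinvPlus z, SchurQ (shapeOf T) := by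
  have hfin := (OEG.finite_RinvPlus z).image PEG
  refine ⟨hfin, ?_⟩
  rw [finsum_mem_eq_finite_toFinset_sum _ hfin]
  ext d
  rw [map_sum]
  change (_ : ℤ) = ∑ T ∈ hfin.toFinset, SchurQ (shapeOf T) d
  have h1 := (OEG.ncard_incrSeq z d).trans
    (OEG.ncard_biword d (t := hfin.toFinset) (fun T => hfin.mem_toFinset))
  have h2 := congrArg (Nat.cast : ℕ → ℤ) h1
  rw [Nat.cast_sum] at h2
  exact h2
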